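/- Let N ≥ 1 and let a ribbon graph with n ≥ 1 edges and a single vertex be given, i.e. σ is a permutation of H = {±1,…,±n} consisting of a single 2n-cycle, with corner matrices C_i ∈ M_N(ℂ). Then, as formal power series in the variables p = (p_1, p_2, …), the integral over (X_1,…,X_n) ∈ SU(N)^n (product Haar probability measure) of exp(N Σ_{m≥1} (p_m/m) Tr(𝔙(X)^m)) equals the same integral over U(N)^n, and both equal Σ_{λ : ℓ(λ) ≤ N} s_λ(I_N)^{−n} · s_λ(Np) · ∏_{f ∈ cycles(φ)} s_λ(𝔙*_f), where 𝔙(X) is the dressed monodromy of the unique vertex, φ = τ∘σ, and the sum runs over all partitions λ with at most N parts. -/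

import Mathlib

open scoped BigOperators Classical
open MeasureTheory Matrix

noncomputable section

/-- Complete homogeneous symmetric functions of the eigenvalues of `X`, defined through
Newton's identities from the power sums `p_m = Tr(X^m)`. -/
def hMat {N : ℕ} (X : Matrix (Fin N) (Fin N) ℂ) : ℕ → ℂ
  | 0 => 1
  | (k+1) => ((k : ℂ) + 1)⁻¹ *
      ∑ m ∈ Finset.range (k+1), (X ^ (m+1)).trace * hMat X (k - m)
  termination_by k => k
  decreasing_by exact Nat.lt_succ_of_le (Nat.sub_le _ _)

def hMatZ {N : ℕ} (X : Matrix (Fin N) (Fin N) ℂ) (k : ℤ) : ℂ :=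
  if k < 0 then 0 else hMat X k.toNat

/-- The Schur polynomial `s_λ(X)` of an `N×N` complex matrix `X`, evaluated at the
eigenvalues of `X`, via the Jacobi-Trudi formula `s_λ = det(h_{λ_i - i + j})`.
Here `l : Fin N → ℕ` lists the (at most `N`) parts of the partition `λ`. -/
def schur {N : ℕ} (l : Fin N → ℕ) (X : Matrix (Fin N) (Fin N) ℂ) : ℂ :=
  (Matrix.of fun i j : Fin N => hMatZ X ((l i : ℤ) - (i : ℤ) + (j : ℤ))).det

/-- Partitions with at most `N` parts (weakly decreasing functions `Fin N → ℕ`). -/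
def PartitionN (N : ℕ) := {l : Fin N → ℕ // Antitone l}

/-- The unitary group `U(N)`. -/
abbrev UN (N : ℕ) := Matrix.unitaryGroup (Fin N) ℂ

instance (N : ℕ) : MeasurableSpace (UN N) := borel _

/-- The special unitary group `SU(N)`, as a subgroup of `U(N)`. -/
def SUN (N : ℕ) : Subgroup (UN N) where
  carrier := {U | (U : Matrix (Fin N) (Fin N) ℂ).det = 1}
  one_mem' := by simp
  mul_mem' := by
    intro a b ha hb
    simp only [Set.mem_setOf_eq, Submonoid.coe_mul, Matrix.det_mul] at *
    rw [ha, hb, mul_one]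
  inv_mem' := by
    intro a ha
    simp only [Set.mem_setOf_eq] at *
    have h1 : ((a⁻¹ : UN N) : Matrix (Fin N) (Fin N) ℂ)
        = star (a : Matrix (Fin N) (Fin N) ℂ) := rfl
    have h2 : (star (a : Matrix (Fin N) (Fin N) ℂ)).det
        = star ((a : Matrix (Fin N) (Fin N) ℂ)).det := by
      simp [Matrix.star_eq_conjTranspose, Matrix.det_conjTranspose]
    rw [h1, h2, ha, star_one]

instance (N : ℕ) : MeasurableSpace (SUN N) := borel _

/-- The product of the values of `F` along the cycle of the permutation `σ` through `x`:
`F x * F (σ x) * ⋯ * F (σ^{k-1} x)`, `k` being the length of that cycle. -/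
def cycleProd {α R : Type*} [Monoid R] (σ : Equiv.Perm α) (F : α → R) (x : α) : R :=
  ((List.range (Function.minimalPeriod σ x)).map fun t => F ((σ ^ t) x)).prod

/-- The involution `τ : i ↦ -i` on the set `H = {±1,…,±n}` of sides of the ribbon edges;
a side is encoded as a pair in `Fin n × Bool`, `(i, true)` standing for the side `+i`
and `(i, false)` for the side `-i`. -/
def tauPerm (n : ℕ) : Equiv.Perm (Fin n × Bool) :=
  Equiv.prodCongr (Equiv.refl (Fin n)) ⟨not, not, Bool.not_not, Bool.not_not⟩

/-- The dressing `C_i ↦ X_i C_i` of the corner matrices, where `X_{-i} = X_i†`. -/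
def dress {N n : ℕ} (C : Fin n × Bool → Matrix (Fin N) (Fin N) ℂ)
    (X : Fin n → Matrix (Fin N) (Fin N) ℂ) : Fin n × Bool → Matrix (Fin N) (Fin N) ℂ :=
  fun s => (if s.2 then X s.1 else (X s.1)ᴴ) * C s

/-- The complete homogeneous symmetric functions expressed through the power sums
`p_1, p_2, …` (formal variables indexed by `ℕ+`), via Newton's identities. -/
def hPow : ℕ → MvPolynomial ℕ+ ℂ
  | 0 => 1
  | (k+1) => MvPolynomial.C (((k : ℂ) + 1)⁻¹) *
      ∑ m ∈ Finset.range (k+1),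
        (MvPolynomial.X (R := ℂ) (σ := ℕ+) ⟨m+1, Nat.succ_pos m⟩) * hPow (k - m)
  termination_by k => k
  decreasing_by exact Nat.lt_succ_of_le (Nat.sub_le _ _)

def hPowZ (k : ℤ) : MvPolynomial ℕ+ ℂ := if k < 0 then 0 else hPow k.toNat

/-- The Schur function `s_λ` expressed through the power sums `p_m` (Jacobi-Trudi). -/
def schurP {M : ℕ} (l : Fin M → ℕ) : MvPolynomial ℕ+ ℂ :=
  (Matrix.of fun i j : Fin M => hPowZ ((l i : ℤ) - (i : ℤ) + (j : ℤ))).det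

/-- `s_λ(Np)`: the Schur function through power sums, with `p_m` replaced by `N·p_m`. -/
def schurNP (N : ℕ) {M : ℕ} (l : Fin M → ℕ) : MvPolynomial ℕ+ ℂ :=
  MvPolynomial.aeval (fun m : ℕ+ => MvPolynomial.C (N : ℂ) * MvPolynomial.X m) (schurP l)


/-! ### Complete homogeneous symmetric functions of a diagonal matrix -/

open PowerSeries in
/-- The geometric series `1 / (1 - y t)`. -/
def geomSeries (y : ℂ) : PowerSeries ℂ := PowerSeries.mk fun n => y ^ n

lemma geomSeries_mul (y : ℂ) :
    geomSeries y * (1 - PowerSeries.C y * PowerSeries.X) = 1 := by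
  ext n
  rcases n with _ | n
  · simp [geomSeries, mul_sub, ← mul_assoc]
  · rw [mul_sub, mul_one, map_sub, ← mul_assoc, PowerSeries.coeff_succ_mul_X,
      PowerSeries.coeff_mul_C]
    simp [geomSeries, PowerSeries.coeff_one, pow_succ]

lemma derivative_geomSeries (y : ℂ) :
    PowerSeries.derivative ℂ (geomSeries y) =
      geomSeries y * (PowerSeries.C y * geomSeries y) := by
  have h := congrArg (PowerSeries.derivative ℂ) (geomSeries_mul y)
  simp only [Derivation.leibniz, smul_eq_mul, map_sub, Derivation.map_one_eq_zero,
    PowerSeries.derivative_C, PowerSeries.derivative_X] at h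
  linear_combination geomSeries y * h - PowerSeries.derivative ℂ (geomSeries y) * geomSeries_mul y

lemma derivative_prod_geomSeries {ι : Type*} (s : Finset ι) (y : ι → ℂ) :
    PowerSeries.derivative ℂ (∏ i ∈ s, geomSeries (y i)) =
      (∏ i ∈ s, geomSeries (y i)) * ∑ i ∈ s, PowerSeries.C (y i) * geomSeries (y i) := by
  induction s using Finset.induction_on with
  | empty => simp
  | insert a s ha ih =>
    rw [Finset.prod_insert ha, Finset.sum_insert ha, Derivation.leibniz, ih,
      derivative_geomSeries]
    simp only [smul_eq_mul]
    ring

lemma hMat_succ {N : ℕ} (X : Matrix (Fin N) (Fin N) ℂ) (k : ℕ) :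
    ((k : ℂ) + 1) * hMat X (k + 1) =
      ∑ m ∈ Finset.range (k + 1), (X ^ (m + 1)).trace * hMat X (k - m) := by
  rw [hMat, ← mul_assoc, mul_inv_cancel₀ (by exact_mod_cast Nat.succ_ne_zero k), one_mul]

lemma hMat_zero {N : ℕ} (X : Matrix (Fin N) (Fin N) ℂ) : hMat X 0 = 1 := by
  rw [hMat]

lemma hMat_diagonal {N : ℕ} (y : Fin N → ℂ) (k : ℕ) :
    hMat (Matrix.diagonal y) k = PowerSeries.coeff k (∏ i, geomSeries (y i)) := by
  induction k using Nat.strong_induction_on with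
  | _ k ih =>
    rcases k with _ | k
    · rw [hMat_zero, PowerSeries.coeff_zero_eq_constantCoeff_apply, map_prod]
      simp [geomSeries]
    · have hk : ((k : ℂ) + 1) ≠ 0 := by exact_mod_cast Nat.succ_ne_zero k
      apply mul_left_cancel₀ hk
      rw [hMat_succ]
      have h := congrArg (PowerSeries.coeff k) (derivative_prod_geomSeries Finset.univ y)
      rw [PowerSeries.coeff_derivative, mul_comm (∏ i, geomSeries (y i)), PowerSeries.coeff_mul,
        Finset.Nat.sum_antidiagonal_eq_sum_range_succ_mk] at h
      rw [mul_comm, h]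
      refine Finset.sum_congr rfl fun m hm => ?_
      rw [ih (k - m) (by omega), Matrix.diagonal_pow, Matrix.trace_diagonal, map_sum]
      simp [geomSeries, pow_succ']

lemma hMat_diagonal_eq_sum {N : ℕ} (y : Fin N → ℂ) (k : ℕ) :
    hMat (Matrix.diagonal y) k =
      ∑ β ∈ (Finset.univ : Finset (Fin N)).finsuppAntidiag k, ∏ j, y j ^ β j := by
  rw [hMat_diagonal, PowerSeries.coeff_prod]
  simp [geomSeries]

/-! ### The bialternant formula -/

/-- The staircase exponent `δ = (N-1, …, 1, 0)`. -/
def stair (N : ℕ) (i : Fin N) : ℕ := N - 1 - i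

/-- The polynomial `∏_{r ≠ l} (1 - y_r t)`. -/
def coGeom {N : ℕ} (y : Fin N → ℂ) (l : Fin N) : Polynomial ℂ :=
  ∏ r ∈ Finset.univ.erase l, (1 - Polynomial.C (y r) * Polynomial.X)

lemma natDegree_coGeom {N : ℕ} (y : Fin N → ℂ) (l : Fin N) : (coGeom y l).natDegree ≤ N - 1 := by
  refine (Polynomial.natDegree_prod_le _ _).trans ?_
  refine (Finset.sum_le_card_nsmul _ _ 1 fun r _ => ?_).trans (by simp)
  compute_degree

lemma prod_geomSeries_mul_coGeom {N : ℕ} (y : Fin N → ℂ) (l : Fin N) :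
    (∏ i, geomSeries (y i)) * (coGeom y l : PowerSeries ℂ) = geomSeries (y l) := by
  have h : (coGeom y l : PowerSeries ℂ) =
      ∏ r ∈ Finset.univ.erase l, (1 - PowerSeries.C (y r) * PowerSeries.X) := by
    rw [coGeom, ← Polynomial.coeToPowerSeries.ringHom_apply, map_prod]
    simp
  rw [h, ← Finset.mul_prod_erase _ _ (Finset.mem_univ l), mul_assoc, ← Finset.prod_mul_distrib]
  simp [geomSeries_mul]

lemma sum_hMatZ_mul_coeff_coGeom {N : ℕ} (y : Fin N → ℂ) (l : Fin N) (n : ℕ) :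
    ∑ j : Fin N, hMatZ (Matrix.diagonal y) ((n : ℤ) - (N - 1 - (j : ℕ) : ℕ)) *
      (coGeom y l).coeff (N - 1 - j) = y l ^ n := by
  have h := congrArg (PowerSeries.coeff n) (prod_geomSeries_mul_coGeom y l)
  rw [mul_comm, PowerSeries.coeff_mul, Finset.Nat.sum_antidiagonal_eq_sum_range_succ_mk] at h
  have hr : PowerSeries.coeff n (geomSeries (y l)) = y l ^ n := by simp [geomSeries]
  rw [hr] at h
  rw [← h]
  have e1 : ∑ j : Fin N, hMatZ (Matrix.diagonal y) ((n : ℤ) - (N - 1 - (j : ℕ) : ℕ)) *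
      (coGeom y l).coeff (N - 1 - j) = ∑ b ∈ Finset.range N,
        hMatZ (Matrix.diagonal y) ((n : ℤ) - b) * (coGeom y l).coeff b := by
    rw [← Fin.sum_univ_eq_sum_range
      (fun b => hMatZ (Matrix.diagonal y) ((n : ℤ) - b) * (coGeom y l).coeff b)]
    refine Fintype.sum_equiv Fin.revPerm _ _ fun j => ?_
    have : N - 1 - (j : ℕ) = (Fin.revPerm j : ℕ) := by simp [Fin.val_rev]; omega
    rw [this]
  have e2 : ∀ M : ℕ, N ≤ M → n + 1 ≤ M →
      ∑ b ∈ Finset.range N, hMatZ (Matrix.diagonal y) ((n : ℤ) - b) * (coGeom y l).coeff b =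
      ∑ b ∈ Finset.range M, hMatZ (Matrix.diagonal y) ((n : ℤ) - b) * (coGeom y l).coeff b := by
    intro M hM _
    refine Finset.sum_subset (by simpa using hM) fun b _ hb => ?_
    have hl := l.2
    rw [Polynomial.coeff_eq_zero_of_natDegree_lt, mul_zero]
    have := natDegree_coGeom y l
    simp at hb
    omega
  rw [e1, e2 (N + n + 1) (by omega) (by omega)]
  symm
  refine (Finset.sum_congr rfl fun b hb => ?_).trans
    (Finset.sum_subset (s₁ := Finset.range n.succ) (by simp) fun b _ hb => ?_)
  · simp at hb
    rw [Polynomial.coeff_coe, hMatZ, if_neg (by omega), ← hMat_diagonal, mul_comm]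
    congr 2
    omega
  · simp at hb
    rw [hMatZ, if_pos (by omega), zero_mul]

lemma schur_diagonal_mul_aux {N : ℕ} (y : Fin N → ℂ) (l : Fin N → ℕ) :
    schur l (Matrix.diagonal y) *
      (Matrix.of fun j m : Fin N => (coGeom y m).coeff (N - 1 - j)).det =
    (Matrix.of fun i m : Fin N => y m ^ (l i + stair N i)).det := by
  rw [schur, ← Matrix.det_mul]
  congr 1
  ext i m
  rw [Matrix.mul_apply, Matrix.of_apply, ← sum_hMatZ_mul_coeff_coGeom]
  refine Finset.sum_congr rfl fun j _ => ?_
  rw [Matrix.of_apply, Matrix.of_apply]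
  congr 2
  have := i.2
  have := j.2
  simp only [stair]
  omega

lemma schur_zero {N : ℕ} (X : Matrix (Fin N) (Fin N) ℂ) : schur (fun _ => 0) X = 1 := by
  rw [schur, Matrix.det_of_isUpperTriangular]
  · simp [hMatZ, hMat_zero]
  · intro i j hij
    simp only [id] at hij
    rw [Matrix.of_apply, hMatZ, if_pos]
    have : (j : ℕ) < i := hij
    push_cast
    omega

/-- Jacobi's bialternant formula `s_λ a_δ = a_{λ+δ}`. -/
lemma schur_diagonal_mul {N : ℕ} (y : Fin N → ℂ) (l : Fin N → ℕ) :
    schur l (Matrix.diagonal y) * (Matrix.of fun i m : Fin N => y m ^ stair N i).det =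
    (Matrix.of fun i m : Fin N => y m ^ (l i + stair N i)).det := by
  have h := schur_diagonal_mul_aux y (fun _ => 0)
  rw [schur_zero, one_mul] at h
  simp only [zero_add] at h
  rw [← h, schur_diagonal_mul_aux]

/-! ### Alternants -/

/-- A function on `Fin N` as an exponent vector. -/
abbrev toExp {N : ℕ} (α : Fin N → ℕ) : Fin N →₀ ℕ := Finsupp.equivFunOnFinite.symm α

lemma toExp_injective {N : ℕ} : Function.Injective (toExp (N := N)) :=
  Finsupp.equivFunOnFinite.symm.injective

/-- The alternant `a_α = det (x_m ^ α_i)`. -/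
def alternant {N : ℕ} (α : Fin N → ℕ) : MvPolynomial (Fin N) ℂ :=
  (Matrix.of fun i m : Fin N => MvPolynomial.X (R := ℂ) m ^ α i).det

lemma eval_alternant {N : ℕ} (α : Fin N → ℕ) (y : Fin N → ℂ) :
    MvPolynomial.eval y (alternant α) = (Matrix.of fun i m : Fin N => y m ^ α i).det := by
  rw [alternant, RingHom.map_det]
  congr 1
  ext i m
  simp

lemma monomial_toExp {N : ℕ} (α : Fin N → ℕ) :
    MvPolynomial.monomial (toExp α) (1 : ℂ) = ∏ i, MvPolynomial.X i ^ α i := by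
  rw [MvPolynomial.monomial_eq, map_one, one_mul, Finsupp.prod_fintype _ _ (by simp)]
  rfl

lemma alternant_eq_sum {N : ℕ} (α : Fin N → ℕ) :
    alternant α = ∑ σ : Equiv.Perm (Fin N),
      MvPolynomial.monomial (toExp (α ∘ σ)) ((Equiv.Perm.sign σ : ℤ) : ℂ) := by
  rw [alternant, Matrix.det_apply']
  refine Finset.sum_congr rfl fun σ _ => ?_
  rw [← mul_one (((Equiv.Perm.sign σ : ℤ) : ℂ)), ← MvPolynomial.C_mul_monomial, monomial_toExp]
  simp

lemma rename_alternant {N : ℕ} (α : Fin N → ℕ) (π : Equiv.Perm (Fin N)) :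
    MvPolynomial.rename π (alternant α) = ((Equiv.Perm.sign π : ℤ) : ℂ) • alternant α := by
  have h := Matrix.det_permute' π
    (Matrix.of fun i m : Fin N => MvPolynomial.X (R := ℂ) m ^ α i)
  rw [← alternant] at h
  rw [MvPolynomial.smul_eq_C_mul, alternant, AlgHom.map_det]
  simp only [map_intCast]
  rw [← alternant, ← h]
  congr 1
  ext i m
  simp

/-- The coefficient of `x^ν` in `g`, extended by zero to exponents `ν ∈ ℤ^N`. -/
def coeffZ {N : ℕ} (g : MvPolynomial (Fin N) ℂ) (ν : Fin N → ℤ) : ℂ :=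
  if ∀ i, 0 ≤ ν i then MvPolynomial.coeff (toExp fun i => (ν i).toNat) g else 0

lemma coeff_alternant_mul {N : ℕ} (l : Fin N → ℕ) (g : MvPolynomial (Fin N) ℂ) :
    MvPolynomial.coeff (toExp (l + stair N)) (alternant (stair N) * g) =
      ∑ σ : Equiv.Perm (Fin N), ((Equiv.Perm.sign σ : ℤ) : ℂ) *
        coeffZ g (fun i => (l i : ℤ) - (i : ℤ) + (σ i : ℤ)) := by
  rw [alternant_eq_sum, Finset.sum_mul, MvPolynomial.coeff_sum]
  refine Finset.sum_congr rfl fun σ _ => ?_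
  rw [MvPolynomial.coeff_monomial_mul', coeffZ]
  have key : ∀ i, stair N (σ i) ≤ l i + stair N i ↔ 0 ≤ (l i : ℤ) - (i : ℤ) + (σ i : ℤ) := by
    intro i
    have := i.2
    have := (σ i).2
    simp only [stair]
    omega
  have hiff : toExp (stair N ∘ σ) ≤ toExp (l + stair N) ↔
      ∀ i, 0 ≤ (l i : ℤ) - (i : ℤ) + (σ i : ℤ) :=
    ⟨fun h i => (key i).1 (h i), fun h i => (key i).2 (h i)⟩
  by_cases h : ∀ i, 0 ≤ (l i : ℤ) - (i : ℤ) + (σ i : ℤ)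
  · rw [if_pos h, if_pos (hiff.2 h)]
    congr 2
    ext i
    have h1 := h i
    have := i.2
    have := (σ i).2
    simp [stair]
    omega
  · rw [if_neg h, if_neg (fun h' => h (hiff.1 h')), mul_zero]

lemma det_eq_sum_prod_row {N : ℕ} {R : Type*} [CommRing R] (M : Matrix (Fin N) (Fin N) R) :
    M.det = ∑ σ : Equiv.Perm (Fin N), ((Equiv.Perm.sign σ : ℤ) : R) * ∏ i, M i (σ i) := by
  rw [← Matrix.det_transpose, Matrix.det_apply']
  rfl

lemma strictAnti_add_stair {N : ℕ} {l : Fin N → ℕ} (hl : Antitone l) :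
    StrictAnti (l + stair N) := by
  intro i j hij
  have := hl hij.le
  have := j.2
  have : (i : ℕ) < j := hij
  simp only [stair, Pi.add_apply]
  omega

lemma exists_eq_add_stair {N : ℕ} {γ : Fin N → ℕ} (hγ : StrictAnti γ) :
    ∃ l : Fin N → ℕ, Antitone l ∧ γ = l + stair N := by
  have hstep : ∀ i j : Fin N, i ≤ j → γ j + (j - i : ℕ) ≤ γ i := by
    intro i j hij
    obtain ⟨d, hd⟩ := Nat.exists_eq_add_of_le (show (i : ℕ) ≤ j from hij)
    induction d generalizing j with
    | zero =>
      have : i = j := Fin.ext (by omega)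
      subst this; simp
    | succ d ih =>
      have hj := j.2
      have h1 := ih ⟨i + d, by omega⟩ (Fin.mk_le_mk.2 (by omega)) rfl
      have h2 : γ j < γ ⟨i + d, by omega⟩ := hγ (Fin.mk_lt_mk.2 (by omega))
      simp at h1
      omega
  rcases N.eq_zero_or_pos with h0 | hpos
  · subst h0
    exact ⟨fun _ => 0, fun i => i.elim0, funext fun i => i.elim0⟩
  have hge : ∀ i : Fin N, stair N i ≤ γ i := by
    intro i
    have := hstep i ⟨N - 1, by omega⟩ (Fin.mk_le_mk.2 (by omega))
    simp [stair] at this ⊢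
    omega
  refine ⟨fun i => γ i - stair N i, fun i j hij => ?_, ?_⟩
  · have := hstep i j hij
    have := hge i
    have := hge j
    have := j.2
    have : (i : ℕ) ≤ j := hij
    simp only [stair] at *
    omega
  · ext i
    have := hge i
    simp only [Pi.add_apply]
    omega

lemma coeff_alternant_add_stair {N : ℕ} {l m : Fin N → ℕ} (hl : Antitone l) (hm : Antitone m) :
    MvPolynomial.coeff (toExp (m + stair N)) (alternant (l + stair N)) =
      if l = m then 1 else 0 := by
  have key : ∀ σ : Equiv.Perm (Fin N), (l + stair N) ∘ σ = m + stair N → σ = 1 := by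
    intro σ h
    have h1 := strictAnti_add_stair hl
    have h2 := strictAnti_add_stair hm
    have hmono : StrictMono σ := by
      intro i j hij
      have := h2 hij
      rw [← h] at this
      exact h1.lt_iff_gt.1 this
    have := Subsingleton.elim (hmono.orderIsoOfSurjective σ σ.surjective) (OrderIso.refl (Fin N))
    exact Equiv.ext fun i => DFunLike.congr_fun this i
  rw [alternant_eq_sum, MvPolynomial.coeff_sum, Finset.sum_eq_single 1]
  · rw [MvPolynomial.coeff_monomial]
    simp
  · intro σ _ hσ
    rw [MvPolynomial.coeff_monomial, if_neg]
    exact fun h => hσ (key σ (toExp_injective h))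
  · simp

/-- An antisymmetric polynomial without strictly decreasing exponents vanishes. -/
lemma eq_zero_of_antisymm {N : ℕ} (f : MvPolynomial (Fin N) ℂ)
    (hf : ∀ π : Equiv.Perm (Fin N),
      MvPolynomial.rename π f = ((Equiv.Perm.sign π : ℤ) : ℂ) • f)
    (h : ∀ l : Fin N → ℕ, Antitone l → MvPolynomial.coeff (toExp (l + stair N)) f = 0) :
    f = 0 := by
  have hc : ∀ (π : Equiv.Perm (Fin N)) (γ : Fin N → ℕ), MvPolynomial.coeff (toExp γ) f =
      ((Equiv.Perm.sign π : ℤ) : ℂ) * MvPolynomial.coeff (toExp (γ ∘ π)) f := by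
    intro π γ
    have h1 := MvPolynomial.coeff_rename_mapDomain π π.injective f (toExp (γ ∘ π))
    have h2 : Finsupp.mapDomain π (toExp (γ ∘ π)) = toExp γ := by
      ext i
      rw [Finsupp.mapDomain_equiv_apply]
      simp
    rw [h2, hf, MvPolynomial.coeff_smul, smul_eq_mul] at h1
    rw [← h1, ← mul_assoc, ← Int.cast_mul, Int.units_coe_mul_self, Int.cast_one, one_mul]
  ext γ
  obtain ⟨γ, rfl⟩ := Finsupp.equivFunOnFinite.symm.surjective γ
  rw [MvPolynomial.coeff_zero]
  by_cases hinj : Function.Injective γ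
  · set π : Equiv.Perm (Fin N) := Fin.revPerm.trans (Tuple.sort γ) with hπ
    have hanti : StrictAnti (γ ∘ π) := by
      have hmono : StrictMono (γ ∘ Tuple.sort γ) :=
        (Tuple.monotone_sort γ).strictMono_of_injective
          (hinj.comp (Tuple.sort γ).injective)
      intro i j hij
      exact hmono (Fin.rev_lt_rev.2 hij)
    obtain ⟨l, hl, hγ⟩ := exists_eq_add_stair hanti
    have := hc π γ
    rw [hγ, h l hl, mul_zero] at this
    exact this
  · rw [Function.not_injective_iff] at hinj
    obtain ⟨i, j, hij, hne⟩ := hinj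
    have := hc (Equiv.swap i j) γ
    have hsw : γ ∘ Equiv.swap i j = γ := by
      ext k
      simp only [Function.comp_apply]
      rcases eq_or_ne k i with rfl | hi
      · rw [Equiv.swap_apply_left, hij]
      · rcases eq_or_ne k j with rfl | hj
        · rw [Equiv.swap_apply_right, hij]
        · rw [Equiv.swap_apply_of_ne_of_ne hi hj]
    rw [hsw, Equiv.Perm.sign_swap hne] at this
    push_cast at this
    change MvPolynomial.coeff (toExp γ) f = 0
    linear_combination (1 / 2 : ℂ) * this

lemma alternant_stair_ne_zero (N : ℕ) : alternant (stair N) ≠ 0 := by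
  intro h
  have := coeff_alternant_add_stair (l := fun _ : Fin N => 0) (m := fun _ => 0)
    antitone_const antitone_const
  rw [if_pos rfl] at this
  have h0 : (fun _ : Fin N => 0) + stair N = stair N := by ext; simp
  rw [h0, h] at this
  simp at this

/-- A symmetric polynomial is zero as soon as its product with `a_δ` has no coefficient at an
exponent `λ + δ`. -/
lemma eq_zero_of_isSymmetric {N : ℕ} (g : MvPolynomial (Fin N) ℂ) (hg : g.IsSymmetric)
    (h : ∀ l : Fin N → ℕ, Antitone l →
      MvPolynomial.coeff (toExp (l + stair N)) (alternant (stair N) * g) = 0) :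
    g = 0 := by
  refine (mul_eq_zero.1 (eq_zero_of_antisymm (alternant (stair N) * g)
    (fun π => ?_) h)).resolve_left
    (alternant_stair_ne_zero N)
  rw [map_mul, rename_alternant, hg π, smul_mul_assoc]

/-! ### Polynomial functions of a matrix -/

/-- Polynomials in the entries of an `N × N` matrix. -/
abbrev EntryPoly (N : ℕ) := MvPolynomial (Fin N × Fin N) ℂ

/-- Polynomials as functions of a matrix. -/
def toFun (N : ℕ) : EntryPoly N →ₐ[ℂ] (Matrix (Fin N) (Fin N) ℂ → ℂ) :=
  MvPolynomial.aeval fun ij Z => Z ij.1 ij.2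

/-- The algebra of polynomial functions of a matrix. -/
def matPoly (N : ℕ) : Subalgebra ℂ (Matrix (Fin N) (Fin N) ℂ → ℂ) := (toFun N).range

lemma toFun_apply {N : ℕ} (p : EntryPoly N) (Z : Matrix (Fin N) (Fin N) ℂ) :
    toFun N p Z = MvPolynomial.eval (fun ij => Z ij.1 ij.2) p := by
  induction p using MvPolynomial.induction_on with
  | C a => simp [toFun]
  | add p q hp hq => simp [hp, hq]
  | mul_X p ij hp => rw [map_mul, map_mul, Pi.mul_apply, hp]; simp [toFun]

lemma toFun_X {N : ℕ} (i j : Fin N) (Z : Matrix (Fin N) (Fin N) ℂ) :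
    toFun N (MvPolynomial.X (i, j)) Z = Z i j := by
  simp [toFun]

lemma toFun_injective (N : ℕ) : Function.Injective (toFun N) := by
  intro p q h
  refine MvPolynomial.funext fun x => ?_
  have := congrFun h (Matrix.of fun i j => x (i, j))
  rwa [toFun_apply, toFun_apply] at this

lemma toFun_mem {N : ℕ} (p : EntryPoly N) : toFun N p ∈ matPoly N := ⟨p, rfl⟩

lemma entry_mem_matPoly {N : ℕ} (i j : Fin N) : (fun Z => Z i j) ∈ matPoly N :=
  ⟨MvPolynomial.X (i, j), by funext Z; exact toFun_X i j Z⟩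

/-- Polynomial functions may be composed with matrix valued functions. -/
lemma comp_mem_of_mem_matPoly {N : ℕ} {E : Type*} (S : Subalgebra ℂ (E → ℂ))
    {Φ : E → Matrix (Fin N) (Fin N) ℂ} (hΦ : ∀ i j, (fun e => Φ e i j) ∈ S)
    {f : Matrix (Fin N) (Fin N) ℂ → ℂ} (hf : f ∈ matPoly N) : (fun e => f (Φ e)) ∈ S := by
  obtain ⟨p, rfl⟩ := hf
  change (fun e => toFun N p (Φ e)) ∈ S
  induction p using MvPolynomial.induction_on with
  | C a =>
    convert S.algebraMap_mem a using 1
    funext e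
    simp [toFun_apply]
  | add p q hp hq =>
    convert S.add_mem hp hq using 1
    funext e
    simp
  | mul_X p ij hp =>
    convert S.mul_mem hp (hΦ ij.1 ij.2) using 1
    funext e
    simp [toFun_apply]

/-- The subalgebra of continuous functions. -/
def contAlg (E : Type*) [TopologicalSpace E] : Subalgebra ℂ (E → ℂ) where
  carrier := {f | Continuous f}
  mul_mem' hf hg := Continuous.mul hf hg
  add_mem' hf hg := Continuous.add hf hg
  algebraMap_mem' _ := continuous_const

lemma continuous_of_mem_matPoly {N : ℕ} {f : Matrix (Fin N) (Fin N) ℂ → ℂ} (hf : f ∈ matPoly N) :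
    Continuous f :=
  comp_mem_of_mem_matPoly (contAlg _) (Φ := id)
    (fun i j => (continuous_id.matrix_elem i j : Continuous _)) hf

lemma comp_mul_mem_matPoly {N : ℕ} {f : Matrix (Fin N) (Fin N) ℂ → ℂ} (hf : f ∈ matPoly N)
    (A B : Matrix (Fin N) (Fin N) ℂ) : (fun Z => f (A * Z * B)) ∈ matPoly N := by
  refine comp_mem_of_mem_matPoly _ (fun i j => ?_) hf
  have : (fun Z : Matrix (Fin N) (Fin N) ℂ => (A * Z * B) i j) =
      ∑ l, ∑ k, (fun Z : Matrix (Fin N) (Fin N) ℂ => Z k l) * algebraMap ℂ _ (A i k * B l j) := by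
    funext Z
    simp only [Matrix.mul_apply, Finset.sum_mul, Finset.sum_apply, Pi.mul_apply,
      Pi.algebraMap_apply, Algebra.algebraMap_self, RingHom.id_apply]
    exact Finset.sum_congr rfl fun l _ => Finset.sum_congr rfl fun k _ => by ring
  rw [this]
  exact sum_mem fun l _ => sum_mem fun k _ => mul_mem (entry_mem_matPoly k l)
    (Subalgebra.algebraMap_mem _ _)

lemma comp_mul_left_mem_matPoly {N : ℕ} {f : Matrix (Fin N) (Fin N) ℂ → ℂ} (hf : f ∈ matPoly N)
    (A : Matrix (Fin N) (Fin N) ℂ) : (fun Z => f (A * Z)) ∈ matPoly N := by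
  simpa using comp_mul_mem_matPoly hf A 1

lemma comp_mul_right_mem_matPoly {N : ℕ} {f : Matrix (Fin N) (Fin N) ℂ → ℂ} (hf : f ∈ matPoly N)
    (A : Matrix (Fin N) (Fin N) ℂ) : (fun Z => f (Z * A)) ∈ matPoly N := by
  simpa using comp_mul_mem_matPoly hf 1 A

/-- Restriction to diagonal matrices. -/
def diagRes (N : ℕ) : EntryPoly N →ₐ[ℂ] MvPolynomial (Fin N) ℂ :=
  MvPolynomial.aeval fun ij => if ij.1 = ij.2 then MvPolynomial.X ij.1 else 0

lemma eval_diagRes {N : ℕ} (p : EntryPoly N) (y : Fin N → ℂ) :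
    MvPolynomial.eval y (diagRes N p) = toFun N p (Matrix.diagonal y) := by
  induction p using MvPolynomial.induction_on with
  | C a => simp [toFun_apply, diagRes]
  | add p q hp hq => simp [hp, hq]
  | mul_X p ij hp =>
    rw [map_mul, map_mul, map_mul, Pi.mul_apply, hp]
    obtain ⟨i, j⟩ := ij
    rw [toFun_X]
    by_cases h : i = j
    · subst h; simp [diagRes]
    · simp [diagRes, h]

/-- A polynomial function of one complex variable is determined on an infinite set. -/
lemma line_eq_zero {N : ℕ} {f : Matrix (Fin N) (Fin N) ℂ → ℂ} (hf : f ∈ matPoly N)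
    (Φ : Matrix (Fin N) (Fin N) (Polynomial ℂ)) (S : Set ℂ) (hS : S.Infinite)
    (h : ∀ t ∈ S, f (Φ.map (Polynomial.eval t)) = 0) (t : ℂ) :
    f (Φ.map (Polynomial.eval t)) = 0 := by
  have hmem := comp_mem_of_mem_matPoly
    (Polynomial.aeval (R := ℂ) (fun t : ℂ => t)).range
    (Φ := fun t : ℂ => Φ.map (Polynomial.eval t)) (fun i j => ⟨Φ i j, by
      funext t
      simp [Polynomial.aeval_fn_apply]⟩) hf
  obtain ⟨q, hq⟩ := hmem
  have hq' : ∀ t, f (Φ.map (Polynomial.eval t)) = q.eval t := by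
    intro t
    rw [← congrFun hq t]
    simp [Polynomial.aeval_fn_apply]
  have : q = 0 := Polynomial.eq_zero_of_infinite_isRoot q
    (hS.mono fun t ht => by
      change q.eval t = 0
      rw [← hq', h t ht])
  rw [hq', this, Polynomial.eval_zero]

/-! ### Zariski density -/

lemma eq_zero_of_isHermitian {N : ℕ} {f : Matrix (Fin N) (Fin N) ℂ → ℂ} (hf : f ∈ matPoly N)
    (h : ∀ H : Matrix (Fin N) (Fin N) ℂ, H.IsHermitian → f H = 0) : f = 0 := by
  funext Z
  change f Z = 0
  set P : Matrix (Fin N) (Fin N) ℂ := (1 / 2 : ℂ) • (Z + Zᴴ) with hP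
  set Q : Matrix (Fin N) (Fin N) ℂ := (-Complex.I / 2 : ℂ) • (Z - Zᴴ) with hQ
  have hPh : P.IsHermitian := by
    rw [Matrix.IsHermitian, hP, Matrix.conjTranspose_smul, Matrix.conjTranspose_add,
      Matrix.conjTranspose_conjTranspose, add_comm]
    simp
  have hQh : Q.IsHermitian := by
    rw [Matrix.IsHermitian, hQ, Matrix.conjTranspose_smul, Matrix.conjTranspose_sub,
      Matrix.conjTranspose_conjTranspose, ← neg_sub Z Zᴴ, smul_neg, ← neg_smul]
    congr 1
    simp [neg_div]
  set Φ : Matrix (Fin N) (Fin N) (Polynomial ℂ) :=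
    P.map Polynomial.C + (Polynomial.X : Polynomial ℂ) • Q.map Polynomial.C with hΦ
  have hev : ∀ t : ℂ, Φ.map (Polynomial.eval t) = P + t • Q := by
    intro t
    ext i j
    simp only [hΦ, Matrix.map_apply, Matrix.add_apply, Matrix.smul_apply, smul_eq_mul,
      Polynomial.eval_add, Polynomial.eval_mul, Polynomial.eval_C, Polynomial.eval_X]
  have key := line_eq_zero hf Φ (Set.range ((↑) : ℝ → ℂ))
    (Set.infinite_range_of_injective Complex.ofReal_injective) (by
      rintro _ ⟨t, rfl⟩
      rw [hev]
      refine h _ (hPh.add ?_)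
      rw [Matrix.IsHermitian, Matrix.conjTranspose_smul, hQh.eq]
      simp) Complex.I
  rw [hev] at key
  convert key using 2
  rw [hP, hQ, smul_smul]
  ext i j
  simp
  linear_combination (1 / 2 * (Z i j - (starRingEnd ℂ) (Z j i))) * Complex.I_sq

lemma conjTranspose_mul_self_UN {N : ℕ} (U : UN N) :
    (U : Matrix (Fin N) (Fin N) ℂ)ᴴ * U = 1 := by
  rw [← Matrix.star_eq_conjTranspose]; exact Unitary.coe_star_mul_self U

lemma mul_conjTranspose_self_UN {N : ℕ} (U : UN N) :
    (U : Matrix (Fin N) (Fin N) ℂ) * (U : Matrix (Fin N) (Fin N) ℂ)ᴴ = 1 := by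
  rw [← Matrix.star_eq_conjTranspose]; exact Unitary.coe_mul_star_self U

lemma coe_inv_UN {N : ℕ} (U : UN N) :
    ((U⁻¹ : UN N) : Matrix (Fin N) (Fin N) ℂ) = (U : Matrix (Fin N) (Fin N) ℂ)ᴴ := rfl

lemma coe_mul_UN {N : ℕ} (U V : UN N) :
    ((U * V : UN N) : Matrix (Fin N) (Fin N) ℂ) = (U : Matrix (Fin N) (Fin N) ℂ) * V := rfl

lemma eq_zero_of_conj_diagonal {N : ℕ} {f : Matrix (Fin N) (Fin N) ℂ → ℂ} (hf : f ∈ matPoly N)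
    (S : Set ℂ) (hS : S.Infinite)
    (h : ∀ (V : UN N) (y : Fin N → ℂ), (∀ i, y i ∈ S) →
      f ((V : Matrix (Fin N) (Fin N) ℂ) * Matrix.diagonal y *
        (V : Matrix (Fin N) (Fin N) ℂ)ᴴ) = 0) : f = 0 := by
  refine eq_zero_of_isHermitian hf fun H hH => ?_
  obtain ⟨p, hp⟩ := comp_mul_mem_matPoly hf (hH.eigenvectorUnitary : Matrix (Fin N) (Fin N) ℂ)
    (hH.eigenvectorUnitary : Matrix (Fin N) (Fin N) ℂ)ᴴ
  have hp' : ∀ y, MvPolynomial.eval y (diagRes N p) = f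
      ((hH.eigenvectorUnitary : Matrix (Fin N) (Fin N) ℂ) * Matrix.diagonal y *
        (hH.eigenvectorUnitary : Matrix (Fin N) (Fin N) ℂ)ᴴ) := by
    intro y
    rw [eval_diagRes]
    exact congrFun hp _
  have h0 : diagRes N p = 0 := MvPolynomial.funext_set (fun _ => S) (fun _ => hS) fun y hy => by
    rw [hp', h _ y fun i => hy i (Set.mem_univ i), map_zero]
  have hs := hH.spectral_theorem
  rw [Unitary.conjStarAlgAut_apply] at hs
  rw [hs]
  have := hp' (RCLike.ofReal ∘ hH.eigenvalues)
  rw [h0, map_zero] at this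
  exact this.symm

lemma infinite_unit_circle : {z : ℂ | star z * z = 1}.Infinite := by
  have hpi : Real.pi = -Real.pi + 2 * Real.pi := by ring
  have h : Set.InjOn (fun t : ℝ => Complex.exp (t * Complex.I)) (Set.Ioc (-Real.pi) Real.pi) := by
    intro a ha b hb hab
    have := congrArg Complex.arg hab
    simp only at this
    rwa [Complex.arg_exp_mul_I, Complex.arg_exp_mul_I, (toIocMod_eq_self _).2 (hpi ▸ ha),
      (toIocMod_eq_self _).2 (hpi ▸ hb)] at this
  refine ((Set.Ioc_infinite (by linarith [Real.pi_pos])).image h).mono ?_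
  rintro _ ⟨t, _, rfl⟩
  have := Complex.norm_exp_ofReal_mul_I t
  simp only [Set.mem_ofPred_eq, Complex.star_def, ← Complex.normSq_eq_conj_mul_self,
    Complex.normSq_eq_norm_sq, this]
  simp

/-- Diagonal unitary matrices. -/
def diagUN {N : ℕ} (y : Fin N → ℂ) (hy : ∀ i, star (y i) * y i = 1) : UN N :=
  ⟨Matrix.diagonal y, by
    rw [Matrix.mem_unitaryGroup_iff', Matrix.star_eq_conjTranspose, Matrix.diagonal_conjTranspose,
      Matrix.diagonal_mul_diagonal, ← Matrix.diagonal_one]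
    congr 1
    funext i
    exact hy i⟩

lemma eq_zero_of_unitary {N : ℕ} {f : Matrix (Fin N) (Fin N) ℂ → ℂ} (hf : f ∈ matPoly N)
    (h : ∀ U : UN N, f U = 0) : f = 0 :=
  eq_zero_of_conj_diagonal hf _ infinite_unit_circle fun V y hy => h (V * diagUN y hy * V⁻¹)

open scoped ComplexOrder in
lemma eq_zero_of_posDef {N : ℕ} {f : Matrix (Fin N) (Fin N) ℂ → ℂ} (hf : f ∈ matPoly N)
    (h : ∀ H : Matrix (Fin N) (Fin N) ℂ, H.PosDef → f H = 0) : f = 0 := by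
  refine eq_zero_of_conj_diagonal hf ((↑) '' Set.Ioi (0 : ℝ))
    ((Set.Ioi_infinite _).image Complex.ofReal_injective.injOn) fun V y hy => h _ ?_
  refine Matrix.PosDef.mul_mul_conjTranspose_same (Matrix.PosDef.diagonal fun i => ?_) ?_
  · obtain ⟨r, hr, hr'⟩ := hy i
    rw [← hr']
    exact_mod_cast hr
  · refine Function.LeftInverse.injective (g := fun v => v ᵥ* (V : Matrix (Fin N) (Fin N) ℂ)ᴴ) ?_
    intro v
    simp [Matrix.vecMul_vecMul, mul_conjTranspose_self_UN]

/-- Functions on matrices that are invariant under unitary conjugation. -/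
def IsClass {N : ℕ} (f : Matrix (Fin N) (Fin N) ℂ → ℂ) : Prop :=
  ∀ (V : UN N) (Z : Matrix (Fin N) (Fin N) ℂ),
    f ((V : Matrix (Fin N) (Fin N) ℂ) * Z * (V : Matrix (Fin N) (Fin N) ℂ)ᴴ) = f Z

lemma IsClass.eq_of_diagonal {N : ℕ} {f g : Matrix (Fin N) (Fin N) ℂ → ℂ} (hf : f ∈ matPoly N)
    (hg : g ∈ matPoly N) (hf' : IsClass f) (hg' : IsClass g)
    (h : ∀ y : Fin N → ℂ, f (Matrix.diagonal y) = g (Matrix.diagonal y)) : f = g := by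
  rw [← sub_eq_zero]
  refine eq_zero_of_conj_diagonal (sub_mem hf hg) Set.univ Set.infinite_univ fun V y _ => ?_
  rw [Pi.sub_apply, hf', hg', h, sub_self]

lemma eq_of_unitary {N : ℕ} {f g : Matrix (Fin N) (Fin N) ℂ → ℂ} (hf : f ∈ matPoly N)
    (hg : g ∈ matPoly N) (h : ∀ U : UN N, f U = g U) : f = g := by
  rw [← sub_eq_zero]
  exact eq_zero_of_unitary (sub_mem hf hg) fun U => sub_eq_zero.2 (h U)

/-! ### Haar measure on the unitary groups -/

lemma isMulRightInvariant_of_compactSpace {G : Type*} [Group G] [TopologicalSpace G]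
    [IsTopologicalGroup G] [CompactSpace G] [MeasurableSpace G] [BorelSpace G]
    (μ : Measure G) [μ.IsHaarMeasure] [IsProbabilityMeasure μ] : μ.IsMulRightInvariant := by
  refine ⟨fun g => ?_⟩
  have hm : Measurable (fun x : G => x * g) := (continuous_mul_const g).measurable
  have : IsProbabilityMeasure (μ.map (· * g)) := Measure.isProbabilityMeasure_map hm.aemeasurable
  have h := Measure.isMulInvariant_eq_smul_of_compactSpace (μ.map (· * g)) μ
  have h1 : (μ.map (· * g)) Set.univ = 1 := measure_univ
  rw [h] at h1
  simp only [Measure.smul_apply, measure_univ, ENNReal.smul_def, smul_eq_mul, mul_one,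
    ENNReal.coe_eq_one] at h1
  rw [h, h1, one_smul]

instance (N : ℕ) : BorelSpace (UN N) := ⟨rfl⟩

instance (N : ℕ) : BorelSpace (SUN N) := ⟨rfl⟩

lemma isCompact_unitaryGroup (N : ℕ) :
    IsCompact (Matrix.unitaryGroup (Fin N) ℂ : Set (Matrix (Fin N) (Fin N) ℂ)) := by
  have hK : IsCompact (Set.pi Set.univ fun _ : Fin N => Set.pi Set.univ fun _ : Fin N =>
      Metric.closedBall (0 : ℂ) 1) :=
    isCompact_univ_pi fun _ => isCompact_univ_pi fun _ => isCompact_closedBall _ _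
  refine IsCompact.of_isClosed_subset hK ?_ ?_
  · exact isClosed_unitary
  · intro U hU i _ j _
    simpa using entry_norm_bound_of_unitary hU i j

instance (N : ℕ) : CompactSpace (UN N) := isCompact_iff_compactSpace.1 (isCompact_unitaryGroup N)

instance (N : ℕ) : SecondCountableTopology (UN N) :=
  have : SecondCountableTopology (Matrix (Fin N) (Fin N) ℂ) :=
    inferInstanceAs (SecondCountableTopology (Fin N → Fin N → ℂ))
  TopologicalSpace.Subtype.secondCountableTopology _

instance (N : ℕ) : SecondCountableTopology (SUN N) :=
  inferInstanceAs (SecondCountableTopology (SUN N : Set (UN N)))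

lemma continuous_coe_UN (N : ℕ) : Continuous fun U : UN N => (U : Matrix (Fin N) (Fin N) ℂ) :=
  continuous_subtype_val

instance (N : ℕ) : CompactSpace (SUN N) := by
  refine isCompact_iff_compactSpace.1 (IsClosed.isCompact ?_)
  exact isClosed_singleton.preimage (continuous_coe_UN N).matrix_det

instance (N : ℕ) (μ : Measure (UN N)) [μ.IsHaarMeasure] [IsProbabilityMeasure μ] :
    μ.IsMulRightInvariant := isMulRightInvariant_of_compactSpace μ

lemma integrable_of_continuous {Ω : Type*} [TopologicalSpace Ω] [CompactSpace Ω]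
    [MeasurableSpace Ω] [BorelSpace Ω] [SecondCountableTopology Ω] (μ : Measure Ω)
    [IsFiniteMeasure μ] {f : Ω → ℂ} (hf : Continuous f) : Integrable f μ := by
  obtain ⟨C, hC⟩ := (isCompact_range hf).isBounded.exists_norm_le
  exact Integrable.of_bound hf.aestronglyMeasurable C
    (Filter.Eventually.of_forall fun x => hC _ ⟨x, rfl⟩)

/-! ### Two-sided substitution -/

/-- The substitution `Z ↦ F Z G` in polynomials in the entries of `Z`. -/
def substMul {N : ℕ} (F G : Matrix (Fin N) (Fin N) ℂ) : EntryPoly N →ₐ[ℂ] EntryPoly N :=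
  MvPolynomial.aeval fun ij => ∑ kl : Fin N × Fin N,
    MvPolynomial.C (F ij.1 kl.1 * G kl.2 ij.2) * MvPolynomial.X kl

lemma substMul_X {N : ℕ} (F G : Matrix (Fin N) (Fin N) ℂ) (ij : Fin N × Fin N) :
    substMul F G (MvPolynomial.X ij) = ∑ kl : Fin N × Fin N,
      MvPolynomial.C (F ij.1 kl.1 * G kl.2 ij.2) * MvPolynomial.X kl := by
  simp [substMul]

lemma toFun_substMul {N : ℕ} (F G : Matrix (Fin N) (Fin N) ℂ) (p : EntryPoly N)
    (Z : Matrix (Fin N) (Fin N) ℂ) : toFun N (substMul F G p) Z = toFun N p (F * Z * G) := by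
  induction p using MvPolynomial.induction_on with
  | C a => simp [toFun_apply, substMul]
  | add p q hp hq => simp [hp, hq]
  | mul_X p ij hp =>
    rw [map_mul, map_mul, map_mul, Pi.mul_apply, Pi.mul_apply, hp, toFun_X, substMul_X]
    congr 1
    rw [toFun_apply]
    simp only [map_sum, map_mul, MvPolynomial.eval_C, MvPolynomial.eval_X, Matrix.mul_apply,
      Finset.sum_mul, Fintype.sum_prod_type]
    rw [Finset.sum_comm]
    exact Finset.sum_congr rfl fun l _ => Finset.sum_congr rfl fun k _ => by ring

lemma coeff_substMul_mem {N : ℕ} {Ω : Type*} (S : Subalgebra ℂ (Ω → ℂ))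
    {F G : Ω → Matrix (Fin N) (Fin N) ℂ} (hF : ∀ i j, (fun ω => F ω i j) ∈ S)
    (hG : ∀ i j, (fun ω => G ω i j) ∈ S) (p : EntryPoly N) (γ : Fin N × Fin N →₀ ℕ) :
    (fun ω => MvPolynomial.coeff γ (substMul (F ω) (G ω) p)) ∈ S := by
  induction p using MvPolynomial.induction_on generalizing γ with
  | C a =>
    convert S.algebraMap_mem (MvPolynomial.coeff γ (MvPolynomial.C a : EntryPoly N)) using 1
    funext ω
    simp [substMul]
  | add p q hp hq =>
    convert S.add_mem (hp γ) (hq γ) using 1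
    funext ω
    simp
  | mul_X p ij hp =>
    have : (fun ω => MvPolynomial.coeff γ (substMul (F ω) (G ω) (p * MvPolynomial.X ij))) =
        ∑ kl : Fin N × Fin N, (fun ω => F ω ij.1 kl.1) * (fun ω => G ω kl.2 ij.2) *
          (if kl ∈ γ.support then
            (fun ω => MvPolynomial.coeff (γ - Finsupp.single kl 1) (substMul (F ω) (G ω) p))
            else 0) := by
      funext ω
      rw [map_mul, substMul_X, Finset.mul_sum, MvPolynomial.coeff_sum, Finset.sum_apply]
      refine Finset.sum_congr rfl fun kl _ => ?_
      rw [mul_left_comm, MvPolynomial.coeff_C_mul, MvPolynomial.coeff_mul_X']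
      split_ifs <;> simp
    rw [this]
    refine sum_mem fun kl _ => mul_mem (mul_mem (hF _ _) (hG _ _)) ?_
    split_ifs
    · exact hp _
    · exact zero_mem _

lemma exists_support_substMul_subset {N : ℕ} (p : EntryPoly N) :
    ∃ T : Finset (Fin N × Fin N →₀ ℕ), ∀ F G : Matrix (Fin N) (Fin N) ℂ,
      (substMul F G p).support ⊆ T := by
  have h : ∃ d, ∀ F G : Matrix (Fin N) (Fin N) ℂ, (substMul F G p).totalDegree ≤ d := by
    induction p using MvPolynomial.induction_on with
    | C a => exact ⟨0, fun F G => by simp [substMul]⟩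
    | add p q hp hq =>
      obtain ⟨d, hd⟩ := hp
      obtain ⟨e, he⟩ := hq
      refine ⟨max d e, fun F G => ?_⟩
      rw [map_add]
      exact (MvPolynomial.totalDegree_add _ _).trans (max_le_max (hd F G) (he F G))
    | mul_X p ij hp =>
      obtain ⟨d, hd⟩ := hp
      refine ⟨d + 1, fun F G => ?_⟩
      rw [map_mul, substMul_X]
      refine (MvPolynomial.totalDegree_mul _ _).trans (add_le_add (hd F G) ?_)
      refine MvPolynomial.totalDegree_finsetSum_le fun kl _ => ?_
      refine (MvPolynomial.totalDegree_mul _ _).trans ?_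
      simp [-MvPolynomial.C_mul, -map_mul]
  obtain ⟨d, hd⟩ := h
  refine ⟨(Finset.range (d + 1)).biUnion fun k => Finset.univ.finsuppAntidiag k,
    fun F G m hm => ?_⟩
  have := (MvPolynomial.le_totalDegree hm).trans (hd F G)
  rw [Finset.mem_biUnion]
  refine ⟨_, Finset.mem_range.2 (Nat.lt_succ_of_le this), ?_⟩
  rw [Finset.mem_finsuppAntidiag]
  exact ⟨(Finsupp.sum_fintype m (fun _ e => e) fun _ => rfl).symm, Finset.subset_univ _⟩

lemma eval_eq_sum_of_support_subset {N : ℕ} {p : EntryPoly N} {T : Finset (Fin N × Fin N →₀ ℕ)}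
    (h : p.support ⊆ T) (Z : Matrix (Fin N) (Fin N) ℂ) :
    toFun N p Z = ∑ γ ∈ T, MvPolynomial.coeff γ p * ∏ ij, Z ij.1 ij.2 ^ γ ij := by
  rw [toFun_apply, MvPolynomial.eval_eq']
  refine Finset.sum_subset h fun γ _ hγ => ?_
  rw [MvPolynomial.notMem_support_iff.1 hγ, zero_mul]

/-- Integrating a polynomial function in a parameter gives a polynomial function, whose
coefficients are the integrals of the coefficients. -/
lemma exists_integral_substMul {N : ℕ} {Ω : Type*} [TopologicalSpace Ω] [CompactSpace Ω]
    [MeasurableSpace Ω] [BorelSpace Ω] [SecondCountableTopology Ω] (μ : Measure Ω)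
    [IsFiniteMeasure μ] {c : Ω → ℂ} (hc : Continuous c) {F G : Ω → Matrix (Fin N) (Fin N) ℂ}
    (hF : Continuous F) (hG : Continuous G) (p : EntryPoly N) :
    ∃ q : EntryPoly N, (∀ Z, toFun N q Z = ∫ ω, c ω * toFun N p (F ω * Z * G ω) ∂μ) ∧
      ∀ γ, MvPolynomial.coeff γ q =
        ∫ ω, c ω * MvPolynomial.coeff γ (substMul (F ω) (G ω) p) ∂μ := by
  obtain ⟨T, hT⟩ := exists_support_substMul_subset p
  have hcont : ∀ γ, Continuous fun ω => c ω * MvPolynomial.coeff γ (substMul (F ω) (G ω) p) :=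
    fun γ => hc.mul (coeff_substMul_mem (contAlg Ω) (fun i j => (hF.matrix_elem i j : Continuous _))
      (fun i j => (hG.matrix_elem i j : Continuous _)) p γ)
  set q : EntryPoly N := ∑ γ ∈ T, MvPolynomial.monomial γ
    (∫ ω, c ω * MvPolynomial.coeff γ (substMul (F ω) (G ω) p) ∂μ) with hq
  have hcoeff : ∀ γ, MvPolynomial.coeff γ q =
        ∫ ω, c ω * MvPolynomial.coeff γ (substMul (F ω) (G ω) p) ∂μ := by
    intro γ
    rw [hq, MvPolynomial.coeff_sum]
    simp only [MvPolynomial.coeff_monomial]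
    rw [Finset.sum_ite_eq']
    split_ifs with h
    · rfl
    · symm
      refine integral_eq_zero_of_ae (Filter.Eventually.of_forall fun ω => ?_)
      simp only [Pi.zero_apply]
      rw [MvPolynomial.notMem_support_iff.1 fun h' => h (hT _ _ h'), mul_zero]
  refine ⟨q, fun Z => ?_, hcoeff⟩
  have hqT : q.support ⊆ T := fun γ hγ => by
    by_contra h
    refine MvPolynomial.mem_support_iff.1 hγ ?_
    rw [hq, MvPolynomial.coeff_sum]
    simp only [MvPolynomial.coeff_monomial]
    rw [Finset.sum_ite_eq', if_neg h]
  rw [eval_eq_sum_of_support_subset hqT]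
  simp only [← toFun_substMul, eval_eq_sum_of_support_subset (hT _ _), hcoeff, Finset.mul_sum,
    ← mul_assoc]
  rw [integral_finsetSum]
  · exact Finset.sum_congr rfl fun γ _ => (integral_mul_const _ _).symm
  · exact fun γ _ => (integrable_of_continuous μ (hcont γ)).mul_const _

lemma integral_mem_matPoly {N : ℕ} {Ω : Type*} [TopologicalSpace Ω] [CompactSpace Ω]
    [MeasurableSpace Ω] [BorelSpace Ω] [SecondCountableTopology Ω] (μ : Measure Ω)
    [IsFiniteMeasure μ] {c : Ω → ℂ} (hc : Continuous c) {F G : Ω → Matrix (Fin N) (Fin N) ℂ}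
    (hF : Continuous F) (hG : Continuous G) {f : Matrix (Fin N) (Fin N) ℂ → ℂ}
    (hf : f ∈ matPoly N) :
    (fun Z => ∫ ω, c ω * f (F ω * Z * G ω) ∂μ) ∈ matPoly N := by
  obtain ⟨p, rfl⟩ := hf
  obtain ⟨q, hq, _⟩ := exists_integral_substMul μ hc hF hG p
  exact ⟨q, funext hq⟩

/-! ### Schur functions as class functions -/

lemma conj_pow_UN {N : ℕ} (V : UN N) (Z : Matrix (Fin N) (Fin N) ℂ) (k : ℕ) :
    ((V : Matrix (Fin N) (Fin N) ℂ) * Z * (V : Matrix (Fin N) (Fin N) ℂ)ᴴ) ^ k =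
      (V : Matrix (Fin N) (Fin N) ℂ) * Z ^ k * (V : Matrix (Fin N) (Fin N) ℂ)ᴴ := by
  induction k with
  | zero => simp [mul_conjTranspose_self_UN]
  | succ k ih =>
    rw [pow_succ, ih, pow_succ]
    simp only [Matrix.mul_assoc]
    rw [← Matrix.mul_assoc _ (V : Matrix (Fin N) (Fin N) ℂ), conjTranspose_mul_self_UN,
      Matrix.one_mul]

lemma isClass_trace_pow {N : ℕ} (k : ℕ) :
    IsClass fun Z : Matrix (Fin N) (Fin N) ℂ => (Z ^ k).trace := by
  intro V Z
  simp only
  rw [conj_pow_UN, Matrix.trace_mul_comm, ← Matrix.mul_assoc, conjTranspose_mul_self_UN,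
    Matrix.one_mul]

lemma pow_entry_mem_matPoly {N : ℕ} (k : ℕ) (i j : Fin N) :
    (fun Z : Matrix (Fin N) (Fin N) ℂ => (Z ^ k) i j) ∈ matPoly N := by
  induction k generalizing i j with
  | zero => exact Subalgebra.algebraMap_mem (matPoly N) ((1 : Matrix (Fin N) (Fin N) ℂ) i j)
  | succ k ih =>
    convert sum_mem (t := Finset.univ) fun l _ => mul_mem (ih i l) (entry_mem_matPoly l j)
    simp [pow_succ, Matrix.mul_apply]

lemma trace_pow_mem_matPoly {N : ℕ} (k : ℕ) :
    (fun Z : Matrix (Fin N) (Fin N) ℂ => (Z ^ k).trace) ∈ matPoly N := by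
  convert sum_mem (t := Finset.univ) fun i _ => pow_entry_mem_matPoly (N := N) k i i
  simp [Matrix.trace]

lemma hMat_conj {N : ℕ} (V : UN N) (Z : Matrix (Fin N) (Fin N) ℂ) (k : ℕ) :
    hMat ((V : Matrix (Fin N) (Fin N) ℂ) * Z * (V : Matrix (Fin N) (Fin N) ℂ)ᴴ) k = hMat Z k := by
  induction k using Nat.strong_induction_on with
  | _ k ih =>
    cases k with
    | zero => rw [hMat_zero, hMat_zero]
    | succ k =>
      rw [hMat, hMat]
      congr 1
      refine Finset.sum_congr rfl fun m _ => ?_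
      rw [ih (k - m) (by omega)]
      congr 1
      exact isClass_trace_pow (m + 1) V Z

lemma hMat_mem_matPoly {N : ℕ} (k : ℕ) :
    (fun Z : Matrix (Fin N) (Fin N) ℂ => hMat Z k) ∈ matPoly N := by
  induction k using Nat.strong_induction_on with
  | _ k ih =>
    cases k with
    | zero =>
      convert one_mem (matPoly N) using 1
      funext Z
      exact hMat_zero Z
    | succ k =>
      convert mul_mem (Subalgebra.algebraMap_mem (matPoly N) ((k : ℂ) + 1)⁻¹)
        (sum_mem (t := Finset.range (k + 1)) fun m _ =>
          mul_mem (trace_pow_mem_matPoly (N := N) (m + 1)) (ih (k - m) (by omega))) using 1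
      funext Z
      rw [hMat]
      simp

lemma isClass_schur {N : ℕ} (l : Fin N → ℕ) : IsClass (schur l) := by
  intro V Z
  simp only [schur, hMatZ, hMat_conj]

lemma hMatZ_mem_matPoly {N : ℕ} (k : ℤ) :
    (fun Z : Matrix (Fin N) (Fin N) ℂ => hMatZ Z k) ∈ matPoly N := by
  unfold hMatZ
  split_ifs
  · exact zero_mem _
  · exact hMat_mem_matPoly _

lemma schur_mem_matPoly {N : ℕ} (l : Fin N → ℕ) : schur l ∈ matPoly N := by
  convert sum_mem (t := Finset.univ) fun (σ : Equiv.Perm (Fin N)) _ =>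
    mul_mem (Subalgebra.algebraMap_mem (matPoly N) ((Equiv.Perm.sign σ : ℤ) : ℂ))
      (prod_mem (t := Finset.univ) fun i _ => hMatZ_mem_matPoly (N := N) ((l i : ℤ) - i + σ i))
    using 1
  funext Z
  rw [schur, det_eq_sum_prod_row]
  simp

/-! ### Symmetric polynomials and class functions -/

/-- Permutation matrices are unitary. -/
def permUN {N : ℕ} (π : Equiv.Perm (Fin N)) : UN N :=
  ⟨π.permMatrix ℂ, by
    rw [Matrix.mem_unitaryGroup_iff', Matrix.star_eq_conjTranspose, Matrix.conjTranspose_permMatrix,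
      ← Matrix.permMatrix_mul]
    simp⟩

lemma isSymmetric_diagRes {N : ℕ} {p : EntryPoly N} (hp : IsClass (toFun N p)) :
    (diagRes N p).IsSymmetric := by
  intro π
  refine MvPolynomial.funext fun y => ?_
  rw [MvPolynomial.eval_rename, eval_diagRes, eval_diagRes, ← hp (permUN π) (Matrix.diagonal y)]
  refine congrArg (toFun N p) ?_
  rw [show (permUN π : Matrix (Fin N) (Fin N) ℂ) = π.permMatrix ℂ from rfl,
    Matrix.conjTranspose_permMatrix]
  ext i j
  simp [Equiv.Perm.permMatrix, PEquiv.toMatrix_toPEquiv_mul, PEquiv.mul_toMatrix_toPEquiv,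
    Matrix.diagonal_apply, Equiv.Perm.inv_def]

/-- The coefficient of `s_λ` in a polynomial class function. -/
def schurCoeff {N : ℕ} (l : Fin N → ℕ) (g : MvPolynomial (Fin N) ℂ) : ℂ :=
  MvPolynomial.coeff (toExp (l + stair N)) (alternant (stair N) * g)

lemma alternant_mul_diagRes_schur {N : ℕ} (l : Fin N → ℕ) {p : EntryPoly N}
    (hp : toFun N p = schur l) : alternant (stair N) * diagRes N p = alternant (l + stair N) := by
  refine MvPolynomial.funext fun y => ?_
  rw [map_mul, eval_diagRes, hp, eval_alternant, eval_alternant, mul_comm]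
  exact schur_diagonal_mul y l

lemma schurCoeff_schur {N : ℕ} {l m : Fin N → ℕ} (hl : Antitone l) (hm : Antitone m)
    {p : EntryPoly N} (hp : toFun N p = schur l) :
    schurCoeff m (diagRes N p) = if l = m then 1 else 0 := by
  rw [schurCoeff, alternant_mul_diagRes_schur l hp, coeff_alternant_add_stair hl hm]

/-- A polynomial class function is the combination of Schur functions given by its
`schurCoeff`s. -/
lemma eq_sum_schurCoeff {N : ℕ} {p : EntryPoly N} (hp : IsClass (toFun N p))
    (T : Finset (Fin N → ℕ)) (hT : ∀ l ∈ T, Antitone l)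
    (h : ∀ l, Antitone l → l ∉ T → schurCoeff l (diagRes N p) = 0) :
    toFun N p = ∑ l ∈ T, schurCoeff l (diagRes N p) • schur l := by
  have hmem : ∀ l : Fin N → ℕ, ∃ q, toFun N q = schur l := fun l => schur_mem_matPoly l
  choose q hq using hmem
  have hsum : toFun N (∑ l ∈ T, schurCoeff l (diagRes N p) • q l) =
      ∑ l ∈ T, schurCoeff l (diagRes N p) • schur l := by
    simp [hq]
  have hclass : IsClass (∑ l ∈ T, schurCoeff l (diagRes N p) • schur l) := by
    intro V Z
    simp only [Finset.sum_apply, Pi.smul_apply, isClass_schur _ V Z]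
  have h0 : diagRes N (p - ∑ l ∈ T, schurCoeff l (diagRes N p) • q l) = 0 := by
    refine eq_zero_of_isSymmetric _ (isSymmetric_diagRes ?_) fun m hm => ?_
    · intro V Z
      rw [map_sub, hsum, Pi.sub_apply, Pi.sub_apply, hp V Z, hclass V Z]
    · rw [map_sub, map_sum, mul_sub, MvPolynomial.coeff_sub, Finset.mul_sum, MvPolynomial.coeff_sum]
      have : ∀ l ∈ T, MvPolynomial.coeff (toExp (m + stair N)) (alternant (stair N) *
          diagRes N (schurCoeff l (diagRes N p) • q l)) =
          if l = m then schurCoeff m (diagRes N p) else 0 := by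
        intro l hl
        rw [map_smul, mul_smul_comm, MvPolynomial.coeff_smul, ← schurCoeff,
          schurCoeff_schur (hT l hl) hm (hq l)]
        split_ifs with hlm
        · subst hlm; simp
        · simp
      rw [Finset.sum_congr rfl this, Finset.sum_ite_eq']
      split_ifs with hmT
      · exact sub_self _
      · rw [sub_zero]; exact h m hm hmT
  rw [← hsum]
  refine IsClass.eq_of_diagonal (toFun_mem _) (toFun_mem _) hp (hsum ▸ hclass) fun y => ?_
  rw [← eval_diagRes, ← eval_diagRes]
  rw [map_sub, sub_eq_zero] at h0
  exact congrArg _ h0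

/-! ### The reproducing identity -/

/-- The row sums of a matrix of exponents. -/
def rowSum {N : ℕ} (γ : Fin N × Fin N →₀ ℕ) (i : Fin N) : ℕ := ∑ j, γ (i, j)

/-- The matrices of exponents with prescribed row sums. -/
def rowSet {N : ℕ} (ν : Fin N → ℕ) : Finset (Fin N × Fin N →₀ ℕ) :=
  (Finset.univ.finsuppAntidiag (∑ i, ν i)).filter fun γ => rowSum γ = ν

lemma mem_rowSet {N : ℕ} {ν : Fin N → ℕ} {γ : Fin N × Fin N →₀ ℕ} :
    γ ∈ rowSet ν ↔ rowSum γ = ν := by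
  rw [rowSet, Finset.mem_filter, and_iff_right_iff_imp, Finset.mem_finsuppAntidiag]
  rintro rfl
  exact ⟨Fintype.sum_prod_type _, Finset.subset_univ _⟩

/-- The monomial `∏ Z_ij ^ γ_ij`. -/
abbrev entryMonomial {N : ℕ} (γ : Fin N × Fin N →₀ ℕ) : EntryPoly N := MvPolynomial.monomial γ 1

lemma toFun_entryMonomial {N : ℕ} (γ : Fin N × Fin N →₀ ℕ) (Z : Matrix (Fin N) (Fin N) ℂ) :
    toFun N (entryMonomial γ) Z = ∏ ij, Z ij.1 ij.2 ^ γ ij := by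
  rw [toFun_apply, MvPolynomial.eval_monomial, one_mul, Finsupp.prod_fintype _ _ (by simp)]

lemma substMul_substMul {N : ℕ} (F G F' G' : Matrix (Fin N) (Fin N) ℂ) (p : EntryPoly N) :
    substMul F G (substMul F' G' p) = substMul (F' * F) (G * G') p := by
  refine toFun_injective N (funext fun Z => ?_)
  simp only [toFun_substMul, Matrix.mul_assoc]

lemma coeff_substMul_diagonal {N : ℕ} (x y : Fin N → ℂ) (p : EntryPoly N)
    (γ : Fin N × Fin N →₀ ℕ) :
    MvPolynomial.coeff γ (substMul (Matrix.diagonal x) (Matrix.diagonal y) p) =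
      MvPolynomial.coeff γ p * ∏ ij : Fin N × Fin N, (x ij.1 * y ij.2) ^ γ ij := by
  have hmon : ∀ (β : Fin N × Fin N →₀ ℕ) (a : ℂ),
      substMul (Matrix.diagonal x) (Matrix.diagonal y) (MvPolynomial.monomial β a) =
        MvPolynomial.monomial β (a * ∏ ij : Fin N × Fin N, (x ij.1 * y ij.2) ^ β ij) := by
    intro β a
    refine toFun_injective N (funext fun Z => ?_)
    rw [toFun_substMul, toFun_apply, toFun_apply, MvPolynomial.eval_monomial,
      MvPolynomial.eval_monomial, Finsupp.prod_fintype _ _ (by simp),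
      Finsupp.prod_fintype _ _ (by simp), mul_assoc a, ← Finset.prod_mul_distrib]
    congr 1
    refine Finset.prod_congr rfl fun ij _ => ?_
    rw [Matrix.mul_diagonal, Matrix.diagonal_mul, ← mul_pow]
    congr 1
    ring
  induction p using MvPolynomial.induction_on' with
  | add p q hp hq => rw [map_add, MvPolynomial.coeff_add, hp, hq, MvPolynomial.coeff_add, add_mul]
  | monomial β a =>
    rw [hmon, MvPolynomial.coeff_monomial, MvPolynomial.coeff_monomial]
    split_ifs with h
    · rw [h]
    · rw [zero_mul]

lemma prod_pow_rowSum {N : ℕ} (x : Fin N → ℂ) (γ : Fin N × Fin N →₀ ℕ) :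
    ∏ ij : Fin N × Fin N, x ij.1 ^ γ ij = ∏ i, x i ^ rowSum γ i := by
  rw [Fintype.prod_prod_type]
  exact Finset.prod_congr rfl fun i _ => by
    rw [rowSum]
    exact Finset.prod_pow_eq_pow_sum Finset.univ (fun j => γ (i, j)) (x i)

lemma rowSum_eq_of_coeff_ne_zero {N : ℕ} (V : Matrix (Fin N) (Fin N) ℂ)
    {β γ : Fin N × Fin N →₀ ℕ}
    (h : MvPolynomial.coeff γ (substMul 1 V (entryMonomial β)) ≠ 0) : rowSum γ = rowSum β := by
  funext i
  set x : Fin N → ℂ := Function.update 1 i 2 with hx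
  have hprod : ∀ δ : Fin N × Fin N →₀ ℕ,
      ∏ ij : Fin N × Fin N, (x ij.1 * (1 : Fin N → ℂ) ij.2) ^ δ ij = 2 ^ rowSum δ i := by
    intro δ
    simp only [Pi.one_apply, mul_one]
    rw [prod_pow_rowSum, Finset.prod_eq_single i]
    · simp [hx]
    · intro j _ hj
      simp [hx, hj]
    · simp
  have h1 : substMul (Matrix.diagonal x) (Matrix.diagonal 1) (entryMonomial β) =
      (2 ^ rowSum β i : ℂ) • entryMonomial β := by
    ext δ
    rw [coeff_substMul_diagonal, hprod, MvPolynomial.coeff_smul, MvPolynomial.coeff_monomial]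
    split_ifs with hδ
    · rw [hδ, smul_eq_mul, mul_comm]
    · simp
  have h2 : substMul (Matrix.diagonal x) (Matrix.diagonal 1) (substMul 1 V (entryMonomial β)) =
      substMul 1 V (substMul (Matrix.diagonal x) (Matrix.diagonal 1) (entryMonomial β)) := by
    simp [substMul_substMul, -MvPolynomial.coe_aeval_eq_eval]
  have h3 := congrArg (MvPolynomial.coeff γ) h2
  rw [coeff_substMul_diagonal, hprod, h1, map_smul, MvPolynomial.coeff_smul, smul_eq_mul,
    mul_comm] at h3
  have h4 := mul_right_cancel₀ h h3
  exact Nat.pow_right_injective (le_refl 2) (by exact_mod_cast h4)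

/-- The action of `Z ↦ Z V` on the monomials with given row sums. -/
def rowMatrix {N : ℕ} (ν : Fin N → ℕ) (V : Matrix (Fin N) (Fin N) ℂ) :
    Matrix (rowSet ν) (rowSet ν) ℂ :=
  fun β γ => MvPolynomial.coeff γ.1 (substMul 1 V (entryMonomial β.1))

lemma rowMatrix_mul {N : ℕ} (ν : Fin N → ℕ) (U V : Matrix (Fin N) (Fin N) ℂ) :
    rowMatrix ν (U * V) = rowMatrix ν V * rowMatrix ν U := by
  ext β γ
  have hV : substMul 1 V (entryMonomial β.1) =
      ∑ δ : rowSet ν, rowMatrix ν V β δ • entryMonomial δ.1 := by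
    ext ε
    simp only [MvPolynomial.coeff_sum, MvPolynomial.coeff_smul, MvPolynomial.coeff_monomial,
      smul_eq_mul, mul_ite, mul_one, mul_zero]
    by_cases hε : ε ∈ rowSet ν
    · rw [Finset.sum_eq_single ⟨ε, hε⟩]
      · simp [rowMatrix]
      · intro δ _ hδ
        rw [if_neg fun h => hδ (Subtype.ext h)]
      · simp
    · rw [Finset.sum_eq_zero]
      · by_contra hne
        refine hε (mem_rowSet.2 ?_)
        rw [rowSum_eq_of_coeff_ne_zero V hne, mem_rowSet.1 β.2]
      · intro δ _
        rw [if_neg]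
        rintro rfl
        exact hε δ.2
  rw [Matrix.mul_apply]
  have : substMul 1 (U * V) (entryMonomial β.1) =
      substMul 1 U (substMul 1 V (entryMonomial β.1)) := by
    rw [substMul_substMul, Matrix.one_mul]
  rw [rowMatrix, this, hV, map_sum, MvPolynomial.coeff_sum]
  refine Finset.sum_congr rfl fun δ _ => ?_
  rw [map_smul, MvPolynomial.coeff_smul, smul_eq_mul]
  rfl

lemma trace_rowMatrix_mem_matPoly {N : ℕ} (ν : Fin N → ℕ) :
    (fun V : Matrix (Fin N) (Fin N) ℂ => (rowMatrix ν V).trace) ∈ matPoly N := by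
  have : (fun V : Matrix (Fin N) (Fin N) ℂ => (rowMatrix ν V).trace) = ∑ β : rowSet ν,
      fun V : Matrix (Fin N) (Fin N) ℂ =>
        MvPolynomial.coeff β.1 (substMul 1 V (entryMonomial β.1)) := by
    funext V
    simp [Matrix.trace, rowMatrix]
  rw [this]
  exact sum_mem fun β _ => coeff_substMul_mem _
    (fun i j => Subalgebra.algebraMap_mem (matPoly N) ((1 : Matrix (Fin N) (Fin N) ℂ) i j))
    (fun i j => entry_mem_matPoly i j) _ _

lemma trace_rowMatrix {N : ℕ} (ν : Fin N → ℕ) (U : Matrix (Fin N) (Fin N) ℂ) :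
    (rowMatrix ν U).trace = ∏ i, hMat U (ν i) := by
  have hmem : (fun U : Matrix (Fin N) (Fin N) ℂ => ∏ i, hMat U (ν i)) ∈ matPoly N := by
    convert prod_mem (t := Finset.univ) fun i _ => hMat_mem_matPoly (N := N) (ν i)
    simp
  refine congrFun (IsClass.eq_of_diagonal (trace_rowMatrix_mem_matPoly ν) hmem ?_ ?_ ?_) U
  · intro V Z
    simp only
    rw [rowMatrix_mul, Matrix.trace_mul_comm, ← rowMatrix_mul, ← Matrix.mul_assoc,
      conjTranspose_mul_self_UN, Matrix.one_mul]
  · intro V Z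
    simp only [hMat_conj]
  · intro y
    simp only [hMat_diagonal_eq_sum]
    rw [Finset.prod_univ_sum, Matrix.trace]
    simp only [Matrix.diag_apply, rowMatrix, ← Matrix.diagonal_one, coeff_substMul_diagonal,
      MvPolynomial.coeff_monomial, if_true, one_mul]
    rw [Finset.sum_coe_sort (rowSet ν)
      (fun γ => ∏ ij : Fin N × Fin N, y ij.2 ^ γ ij)]
    refine Finset.sum_bij' (fun γ _ i => toExp fun j => γ (i, j))
      (fun f _ => Finsupp.equivFunOnFinite.symm fun ij => f ij.1 ij.2) ?_ ?_ ?_ ?_ ?_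
    · intro γ hγ
      rw [Fintype.mem_piFinset]
      intro i
      rw [Finset.mem_finsuppAntidiag]
      exact ⟨congrFun (mem_rowSet.1 hγ) i, Finset.subset_univ _⟩
    · intro f hf
      rw [mem_rowSet]
      funext i
      exact (Finset.mem_finsuppAntidiag.1 (Fintype.mem_piFinset.1 hf i)).1
    · intro γ _
      ext ij
      rfl
    · intro f _
      funext i
      ext j
      rfl
    · intro γ _
      rw [Fintype.prod_prod_type]
      rfl

/-- The substitution `X_ij ↦ U_ij x_i`. -/
def rowEval {N : ℕ} (U : Matrix (Fin N) (Fin N) ℂ) : EntryPoly N →ₐ[ℂ] MvPolynomial (Fin N) ℂ :=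
  MvPolynomial.aeval fun ij => MvPolynomial.C (U ij.1 ij.2) * MvPolynomial.X ij.1

lemma eval_rowEval {N : ℕ} (U : Matrix (Fin N) (Fin N) ℂ) (p : EntryPoly N) (x : Fin N → ℂ) :
    MvPolynomial.eval x (rowEval U p) = toFun N p (Matrix.diagonal x * U) := by
  induction p using MvPolynomial.induction_on with
  | C a => simp [toFun_apply, rowEval]
  | add p q hp hq => simp [hp, hq]
  | mul_X p ij hp =>
    rw [map_mul, map_mul, map_mul, Pi.mul_apply, hp]
    simp [rowEval, toFun, Matrix.diagonal_mul, mul_comm]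

lemma rowEval_monomial {N : ℕ} (U : Matrix (Fin N) (Fin N) ℂ) (γ : Fin N × Fin N →₀ ℕ) (a : ℂ) :
    rowEval U (MvPolynomial.monomial γ a) =
      MvPolynomial.monomial (toExp (rowSum γ)) (toFun N (entryMonomial γ) U * a) := by
  refine MvPolynomial.funext fun x => ?_
  rw [eval_rowEval, toFun_apply, MvPolynomial.eval_monomial, MvPolynomial.eval_monomial,
    toFun_entryMonomial, Finsupp.prod_fintype _ _ (by simp), Finsupp.prod_fintype _ _ (by simp)]
  simp only [Matrix.diagonal_mul, mul_pow, Finset.prod_mul_distrib]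
  rw [prod_pow_rowSum]
  simp only [toExp, Finsupp.equivFunOnFinite_symm_apply_apply]
  ring

lemma coeff_rowEval {N : ℕ} (U : Matrix (Fin N) (Fin N) ℂ) (ν : Fin N → ℕ) (p : EntryPoly N) :
    MvPolynomial.coeff (toExp ν) (rowEval U p) =
      ∑ γ ∈ rowSet ν, toFun N (entryMonomial γ) U * MvPolynomial.coeff γ p := by
  induction p using MvPolynomial.induction_on' with
  | add p q hp hq =>
    rw [map_add, MvPolynomial.coeff_add, hp, hq, ← Finset.sum_add_distrib]
    simp only [MvPolynomial.coeff_add, mul_add]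
  | monomial β a =>
    rw [rowEval_monomial, MvPolynomial.coeff_monomial]
    simp only [MvPolynomial.coeff_monomial, mul_ite, mul_zero, Finset.sum_ite_eq]
    exact if_congr (by rw [mem_rowSet, toExp_injective.eq_iff]) rfl rfl

lemma coeff_diagRes_of_isClass {N : ℕ} {p : EntryPoly N} (hp : IsClass (toFun N p)) (U : UN N)
    (ν : Fin N → ℕ) :
    MvPolynomial.coeff (toExp ν) (diagRes N p) =
      ∑ γ ∈ rowSet ν, toFun N (entryMonomial γ) U *
        MvPolynomial.coeff γ (substMul (U : Matrix (Fin N) (Fin N) ℂ)ᴴ 1 p) := by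
  rw [← coeff_rowEval]
  congr 1
  refine MvPolynomial.funext fun x => ?_
  rw [eval_diagRes, eval_rowEval, toFun_substMul, ← hp U⁻¹, coe_inv_UN,
    conjTranspose_conjTranspose, Matrix.mul_one, Matrix.mul_assoc]

lemma prod_hMat_eq_sum {N : ℕ} (ν : Fin N → ℕ) (U : Matrix (Fin N) (Fin N) ℂ) :
    ∏ i, hMat U (ν i) =
      ∑ γ ∈ rowSet ν, MvPolynomial.coeff γ (substMul 1 U (entryMonomial γ)) := by
  rw [← trace_rowMatrix, ← Finset.sum_coe_sort (rowSet ν)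
    fun γ => MvPolynomial.coeff γ (substMul 1 U (entryMonomial γ))]
  simp only [Matrix.trace, Matrix.diag_apply, rowMatrix]

lemma integral_prod_hMat_mul {N : ℕ} (μ : Measure (UN N)) [μ.IsHaarMeasure]
    [IsProbabilityMeasure μ] {p : EntryPoly N} (hp : IsClass (toFun N p)) (ν : Fin N → ℕ) :
    ∫ U : UN N, (∏ i, hMat (U : Matrix (Fin N) (Fin N) ℂ) (ν i)) *
      toFun N p (U : Matrix (Fin N) (Fin N) ℂ)ᴴ ∂μ =
      MvPolynomial.coeff (toExp ν) (diagRes N p) := by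
  have hU := continuous_coe_UN N
  have hp' : Continuous fun U : UN N => toFun N p (U : Matrix (Fin N) (Fin N) ℂ)ᴴ :=
    (continuous_of_mem_matPoly (toFun_mem p)).comp hU.matrix_conjTranspose
  have he : ∀ γ : Fin N × Fin N →₀ ℕ, Continuous fun U : UN N => toFun N (entryMonomial γ) U :=
    fun γ => (continuous_of_mem_matPoly (toFun_mem _)).comp hU
  have key : ∀ γ : Fin N × Fin N →₀ ℕ,
      ∫ U : UN N, toFun N p (U : Matrix (Fin N) (Fin N) ℂ)ᴴ *
        MvPolynomial.coeff γ (substMul 1 (U : Matrix (Fin N) (Fin N) ℂ) (entryMonomial γ)) ∂μ =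
      ∫ U : UN N, toFun N (entryMonomial γ) U *
        MvPolynomial.coeff γ (substMul (U : Matrix (Fin N) (Fin N) ℂ)ᴴ 1 p) ∂μ := by
    intro γ
    obtain ⟨q₁, hq₁, hc₁⟩ := exists_integral_substMul μ hp' continuous_const hU (entryMonomial γ)
      (F := fun _ => 1)
    obtain ⟨q₂, hq₂, hc₂⟩ := exists_integral_substMul μ (he γ) hU.matrix_conjTranspose
      continuous_const p (G := fun _ => 1)
    rw [← hc₁, ← hc₂]
    congr 1
    refine toFun_injective N (eq_of_unitary (toFun_mem _) (toFun_mem _) fun W => ?_)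
    rw [hq₁, hq₂]
    symm
    rw [← integral_mul_left_eq_self (μ := μ) _ W]
    refine integral_congr_ae (.of_forall fun U => ?_)
    simp only [coe_mul_UN, Matrix.one_mul, Matrix.mul_one, conjTranspose_mul, Matrix.mul_assoc,
      conjTranspose_mul_self_UN]
    exact mul_comm _ _
  have hconst : ∀ i j, (fun _ : UN N => (1 : Matrix (Fin N) (Fin N) ℂ) i j) ∈ contAlg (UN N) :=
    fun i j => continuous_const
  have helem : ∀ i j, (fun U : UN N => (U : Matrix (Fin N) (Fin N) ℂ) i j) ∈ contAlg (UN N) :=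
    fun i j => hU.matrix_elem i j
  have helem' : ∀ i j, (fun U : UN N => (U : Matrix (Fin N) (Fin N) ℂ)ᴴ i j) ∈ contAlg (UN N) :=
    fun i j => hU.matrix_conjTranspose.matrix_elem i j
  have hcont : ∀ γ : Fin N × Fin N →₀ ℕ, (fun U : UN N => MvPolynomial.coeff γ
      (substMul 1 (U : Matrix (Fin N) (Fin N) ℂ) (entryMonomial γ))) ∈ contAlg (UN N) :=
    fun γ => coeff_substMul_mem _ hconst helem _ _
  have hcont' : ∀ γ : Fin N × Fin N →₀ ℕ, (fun U : UN N => MvPolynomial.coeff γ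
      (substMul (U : Matrix (Fin N) (Fin N) ℂ)ᴴ 1 p)) ∈ contAlg (UN N) :=
    fun γ => coeff_substMul_mem _ helem' hconst _ _
  calc _ = ∫ U : UN N, ∑ γ ∈ rowSet ν, toFun N p (U : Matrix (Fin N) (Fin N) ℂ)ᴴ *
        MvPolynomial.coeff γ (substMul 1 (U : Matrix (Fin N) (Fin N) ℂ) (entryMonomial γ)) ∂μ := by
        refine integral_congr_ae (.of_forall fun U => ?_)
        simp only
        rw [prod_hMat_eq_sum, mul_comm, ← Finset.mul_sum]
    _ = ∫ U : UN N, ∑ γ ∈ rowSet ν, toFun N (entryMonomial γ) U *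
        MvPolynomial.coeff γ (substMul (U : Matrix (Fin N) (Fin N) ℂ)ᴴ 1 p) ∂μ := by
        refine (integral_finsetSum _ fun γ _ =>
          integrable_of_continuous μ (hp'.mul (hcont γ))).trans (Eq.trans ?_
          (integral_finsetSum _ fun γ _ =>
            integrable_of_continuous μ ((he γ).mul (hcont' γ))).symm)
        exact Finset.sum_congr rfl fun γ _ => key γ
    _ = _ := by
        simp only [← coeff_diagRes_of_isClass hp]
        simp

/-- The coefficients of a class function in the basis of Schur functions are given by its
inner products with them. -/
lemma integral_schur_mul {N : ℕ} (μ : Measure (UN N)) [μ.IsHaarMeasure]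
    [IsProbabilityMeasure μ] {p : EntryPoly N} (hp : IsClass (toFun N p)) (l : Fin N → ℕ) :
    ∫ U : UN N, schur l (U : Matrix (Fin N) (Fin N) ℂ) *
      toFun N p (U : Matrix (Fin N) (Fin N) ℂ)ᴴ ∂μ = schurCoeff l (diagRes N p) := by
  have hU := continuous_coe_UN N
  have hp' : Continuous fun U : UN N => toFun N p (U : Matrix (Fin N) (Fin N) ℂ)ᴴ :=
    (continuous_of_mem_matPoly (toFun_mem p)).comp hU.matrix_conjTranspose
  have key : ∀ ν : Fin N → ℤ, ∫ U : UN N,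
      (∏ i, hMatZ (U : Matrix (Fin N) (Fin N) ℂ) (ν i)) *
        toFun N p (U : Matrix (Fin N) (Fin N) ℂ)ᴴ ∂μ = coeffZ (diagRes N p) ν := by
    intro ν
    rw [coeffZ]
    split_ifs with h
    · rw [← integral_prod_hMat_mul μ hp]
      simp only [hMatZ, not_lt.2 (h _), if_false]
    · push Not at h
      obtain ⟨i, hi⟩ := h
      have : ∀ U : UN N, ∏ i, hMatZ (U : Matrix (Fin N) (Fin N) ℂ) (ν i) = 0 := fun U =>
        Finset.prod_eq_zero (Finset.mem_univ i) (if_pos hi)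
      simp [this]
  rw [schurCoeff, coeff_alternant_mul]
  simp only [← key, schur, det_eq_sum_prod_row, Finset.sum_mul, Matrix.of_apply, mul_assoc,
    ← integral_const_mul]
  rw [integral_finsetSum]
  intro σ _
  refine integrable_of_continuous μ (continuous_const.mul (Continuous.mul ?_ hp'))
  exact continuous_finsetProd _ fun i _ =>
    (continuous_of_mem_matPoly (hMatZ_mem_matPoly _)).comp hU

/-! ### Highest weight functions -/

/-- The leading `k × k` block of `Z`, completed by the identity. -/
def cutMat {N : ℕ} {R : Type*} [Zero R] [One R] (k : ℕ) (Z : Matrix (Fin N) (Fin N) R) :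
    Matrix (Fin N) (Fin N) R :=
  Matrix.of fun i j => if (i : ℕ) < k ∧ (j : ℕ) < k then Z i j else if i = j then 1 else 0

lemma cutMat_transpose {N : ℕ} {R : Type*} [Zero R] [One R] (k : ℕ)
    (Z : Matrix (Fin N) (Fin N) R) : cutMat k Zᵀ = (cutMat k Z)ᵀ := by
  ext i j
  simp only [cutMat, Matrix.transpose_apply, Matrix.of_apply, and_comm, eq_comm]

lemma cutMat_mul_of_lower {N : ℕ} (k : ℕ) {L : Matrix (Fin N) (Fin N) ℂ}
    (hL : ∀ i j, i < j → L i j = 0) (Z : Matrix (Fin N) (Fin N) ℂ) :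
    cutMat k (L * Z) = cutMat k L * cutMat k Z := by
  ext i j
  rw [Matrix.mul_apply]
  simp only [cutMat, Matrix.of_apply, Matrix.mul_apply]
  by_cases hi : (i : ℕ) < k
  · by_cases hj : (j : ℕ) < k
    · rw [if_pos ⟨hi, hj⟩]
      refine Finset.sum_congr rfl fun m _ => ?_
      by_cases hm : (m : ℕ) < k
      · rw [if_pos ⟨hi, hm⟩, if_pos ⟨hm, hj⟩]
      · have him : i < m := Fin.lt_def.2 (by omega)
        rw [hL i m him, if_neg (fun h => hm h.2), if_neg him.ne, zero_mul, zero_mul]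
    · have hij : i ≠ j := by rintro rfl; exact hj hi
      rw [if_neg (fun h => hj h.2), if_neg hij]
      refine (Finset.sum_eq_zero fun m _ => ?_).symm
      by_cases hm : m = j
      · rw [hm, if_neg (fun h => hj h.2), if_neg hij, zero_mul]
      · rw [if_neg (c := _ ∧ (j : ℕ) < k) (fun h => hj h.2), if_neg hm, mul_zero]
  · rw [if_neg (fun h => hi h.1), Finset.sum_eq_single i]
    · simp [hi]
    · intro m _ hm
      rw [if_neg (fun h => hi h.1), if_neg (Ne.symm hm), zero_mul]
    · simp

lemma cutMat_mul_of_upper {N : ℕ} (k : ℕ) {R : Matrix (Fin N) (Fin N) ℂ}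
    (hR : ∀ i j, j < i → R i j = 0) (Z : Matrix (Fin N) (Fin N) ℂ) :
    cutMat k (Z * R) = cutMat k Z * cutMat k R := by
  refine Matrix.transpose_injective ?_
  rw [← cutMat_transpose, Matrix.transpose_mul,
    cutMat_mul_of_lower k (L := Rᵀ) fun i j h => hR j i h,
    cutMat_transpose, cutMat_transpose, Matrix.transpose_mul]

/-- The highest weight function with exponents `e`: the product of the powers of the leading
principal minors. -/
def hwFun {N : ℕ} (e : Fin N → ℕ) (Z : Matrix (Fin N) (Fin N) ℂ) : ℂ :=
  ∏ k : Fin N, (cutMat (k + 1) Z).det ^ e k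

/-- The weight of `hwFun e`. -/
def hwWeight {N : ℕ} (e : Fin N → ℕ) (i : Fin N) : ℕ := ∑ k ∈ Finset.Ici i, e k

lemma exists_hwWeight_eq {N : ℕ} {l : Fin N → ℕ} (hl : Antitone l) :
    ∃ e : Fin N → ℕ, hwWeight e = l := by
  induction N with
  | zero => exact ⟨0, Subsingleton.elim _ _⟩
  | succ N ih =>
    obtain ⟨e, he⟩ := ih (l := fun i => l i.succ) fun i j h => hl (Fin.succ_le_succ_iff.2 h)
    cases N with
    | zero =>
      refine ⟨l, funext fun i => ?_⟩
      fin_cases i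
      rfl
    | succ N =>
      have hsucc : ∀ i : Fin (N + 1), ∀ f : Fin (N + 2) → ℕ,
          ∑ k ∈ Finset.Ici i.succ, f k = ∑ k ∈ Finset.Ici i, f k.succ := by
        intro i f
        exact Fin.sum_Ici_succ f i
      have hs : ∀ i : Fin (N + 1),
          hwWeight (Fin.cons (l 0 - l 1) e : Fin (N + 2) → ℕ) i.succ = l i.succ := by
        intro i
        rw [hwWeight, hsucc, ← congrFun he i]
        rfl
      refine ⟨Fin.cons (l 0 - l 1) e, funext fun i => ?_⟩
      refine Fin.cases ?_ hs i
      have h0 := hs 0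
      have h1 : l 1 ≤ l 0 := hl (Fin.zero_le _)
      rw [hwWeight, hsucc] at h0
      have hb : (Finset.Ici (0 : Fin (N + 1))) = Finset.univ := Finset.Ici_bot
      have hb' : (Finset.Ici (0 : Fin (N + 2))) = Finset.univ := Finset.Ici_bot
      rw [hb] at h0
      rw [hwWeight, hb', Fin.sum_univ_succ, h0, Fin.cons_zero]
      change l 0 - l 1 + l 1 = l 0
      omega

lemma hwFun_mem_matPoly {N : ℕ} (e : Fin N → ℕ) : hwFun e ∈ matPoly N := by
  have hcut : ∀ (k : ℕ) (i j : Fin N),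
      (fun Z : Matrix (Fin N) (Fin N) ℂ => cutMat k Z i j) ∈ matPoly N := by
    intro k i j
    simp only [cutMat, Matrix.of_apply]
    split_ifs
    · exact entry_mem_matPoly i j
    · exact one_mem _
    · exact zero_mem _
  have hdet : ∀ k : ℕ, (fun Z : Matrix (Fin N) (Fin N) ℂ => (cutMat k Z).det) ∈ matPoly N := by
    intro k
    convert sum_mem (t := Finset.univ) fun (σ : Equiv.Perm (Fin N)) _ =>
      mul_mem (Subalgebra.algebraMap_mem (matPoly N) ((Equiv.Perm.sign σ : ℤ) : ℂ))
        (prod_mem (t := Finset.univ) fun i _ => hcut k i (σ i)) using 1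
    funext Z
    rw [det_eq_sum_prod_row]
    simp [Finset.sum_apply, Finset.prod_apply]
  convert prod_mem (t := Finset.univ) fun (k : Fin N) _ => pow_mem (hdet (k + 1)) (e k) using 1
  funext Z
  simp [hwFun]

lemma hwFun_mul_of_lower {N : ℕ} (e : Fin N → ℕ) {L : Matrix (Fin N) (Fin N) ℂ}
    (hL : ∀ i j, i < j → L i j = 0) (Z : Matrix (Fin N) (Fin N) ℂ) :
    hwFun e (L * Z) = hwFun e L * hwFun e Z := by
  simp only [hwFun, cutMat_mul_of_lower _ hL, Matrix.det_mul, mul_pow, Finset.prod_mul_distrib]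

lemma hwFun_mul_of_upper {N : ℕ} (e : Fin N → ℕ) {R : Matrix (Fin N) (Fin N) ℂ}
    (hR : ∀ i j, j < i → R i j = 0) (Z : Matrix (Fin N) (Fin N) ℂ) :
    hwFun e (Z * R) = hwFun e Z * hwFun e R := by
  simp only [hwFun, cutMat_mul_of_upper _ hR, Matrix.det_mul, mul_pow, Finset.prod_mul_distrib]

lemma hwFun_of_upper {N : ℕ} (e : Fin N → ℕ) {R : Matrix (Fin N) (Fin N) ℂ}
    (hR : ∀ i j, j < i → R i j = 0) : hwFun e R = ∏ i, R i i ^ hwWeight e i := by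
  have hdet : ∀ k : Fin N, (cutMat (k + 1) R).det = ∏ i ∈ Finset.Iic k, R i i := by
    intro k
    rw [Matrix.det_of_isUpperTriangular]
    · simp only [cutMat, Matrix.of_apply, and_self, if_true]
      rw [← Finset.prod_subset (Finset.subset_univ (Finset.Iic k))]
      · refine Finset.prod_congr rfl fun i hi => if_pos ?_
        exact Nat.lt_succ_of_le (Fin.le_def.1 (Finset.mem_Iic.1 hi))
      · intro i _ hi
        refine if_neg fun h => hi (Finset.mem_Iic.2 (Fin.le_def.2 (Nat.le_of_lt_succ h)))
    · intro i j hij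
      have hij' : j < i := hij
      simp only [cutMat, Matrix.of_apply, hR i j hij', if_neg hij'.ne', ite_self]
  have hpow : ∀ i, R i i ^ hwWeight e i = ∏ k ∈ Finset.Ici i, R i i ^ e k := fun i =>
    (Finset.prod_pow_eq_pow_sum _ _ _).symm
  simp only [hwFun, hdet, hpow, ← Finset.prod_pow]
  exact Finset.prod_comm' fun i j => by simp

lemma hwFun_diagonal {N : ℕ} (e : Fin N → ℕ) (x : Fin N → ℂ) :
    hwFun e (Matrix.diagonal x) = ∏ i, x i ^ hwWeight e i := by
  rw [hwFun_of_upper e fun i j h => Matrix.diagonal_apply_ne _ h.ne']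
  simp

lemma hwFun_one {N : ℕ} (e : Fin N → ℕ) : hwFun e (1 : Matrix (Fin N) (Fin N) ℂ) = 1 := by
  rw [← Matrix.diagonal_one, hwFun_diagonal]
  simp

open scoped ComplexOrder in
lemma exists_lower_mul_upper {N : ℕ} {H : Matrix (Fin N) (Fin N) ℂ} (hH : H.PosDef) :
    ∃ L R : Matrix (Fin N) (Fin N) ℂ, (∀ i j, i < j → L i j = 0) ∧ (∀ i j, j < i → R i j = 0) ∧
      H = L * R := by
  have hinv : Matrix.BlockTriangular (LDL.lowerInv hH) OrderDual.toDual := fun i j hij =>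
    LDL.lowerInv_triangular hH hij
  have hL : ∀ i j, i < j → LDL.lower hH i j = 0 := fun i j hij =>
    Matrix.blockTriangular_inv_of_blockTriangular hinv hij
  refine ⟨LDL.lower hH, LDL.diag hH * (LDL.lower hH)ᴴ, hL, fun i j hij => ?_, ?_⟩
  · rw [LDL.diag, Matrix.diagonal_mul, conjTranspose_apply, hL j i hij, star_zero, mul_zero]
  · rw [← Matrix.mul_assoc, LDL.lower_conj_diag]

lemma star_pow_mul_pow_of_unit {t : ℂ} (ht : star t * t = 1) {i j : ℕ} (hij : i ≤ j) :
    star (t ^ i) * t ^ j = t ^ (j - i) := by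
  rw [← Nat.add_sub_of_le hij, pow_add, ← mul_assoc, star_pow, ← mul_pow, ht, one_pow, one_mul,
    Nat.add_sub_of_le hij]

/-- The highest weight function is determined by its equivariance properties. -/
lemma eq_mul_hwFun {N : ℕ} (e : Fin N → ℕ) {f : Matrix (Fin N) (Fin N) ℂ → ℂ} (hf : f ∈ matPoly N)
    (hL : ∀ L : Matrix (Fin N) (Fin N) ℂ, (∀ i j, i < j → L i j = 0) →
      ∀ X, f (L * X) = hwFun e L * f X)
    (hT : ∀ y : Fin N → ℂ, (∀ i, star (y i) * y i = 1) →
      ∀ X, f (X * Matrix.diagonal y) = hwFun e (Matrix.diagonal y) * f X)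
    (X : Matrix (Fin N) (Fin N) ℂ) : f X = f 1 * hwFun e X := by
  have hdiag : ∀ x : Fin N → ℂ, ∀ i j, i < j → Matrix.diagonal x i j = 0 := fun x i j h =>
    Matrix.diagonal_apply_ne _ h.ne
  have hR : ∀ R : Matrix (Fin N) (Fin N) ℂ, (∀ i j, j < i → R i j = 0) →
      f R = f 1 * hwFun e R := by
    intro R hR
    set Φ : Matrix (Fin N) (Fin N) (Polynomial ℂ) := fun i j =>
      Polynomial.C (R i j) * Polynomial.X ^ ((j : ℕ) - i) with hΦ
    have hΦ0 : Φ.map (Polynomial.eval 0) = Matrix.diagonal fun i => R i i := by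
      ext i j
      rw [Matrix.map_apply, hΦ]
      simp only [Polynomial.eval_mul, Polynomial.eval_C, Polynomial.eval_pow, Polynomial.eval_X]
      rcases lt_trichotomy i j with h | h | h
      · rw [zero_pow (by have := Fin.lt_def.1 h; omega), mul_zero,
          Matrix.diagonal_apply_ne _ h.ne]
      · simp [h]
      · rw [hR i j h, zero_mul, Matrix.diagonal_apply_ne _ h.ne']
    have hcirc : ∀ t ∈ {z : ℂ | star z * z = 1}, f (Φ.map (Polynomial.eval t)) - f R = 0 := by
      intro t ht
      have ht' : star t * t = 1 := ht
      have hy : ∀ i : Fin N, star (t ^ (i : ℕ)) * t ^ (i : ℕ) = 1 := fun i => by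
        rw [star_pow_mul_pow_of_unit ht' le_rfl, Nat.sub_self, pow_zero]
      have hconj : Φ.map (Polynomial.eval t) =
          Matrix.diagonal (fun i : Fin N => star (t ^ (i : ℕ))) *
            (R * Matrix.diagonal fun i : Fin N => t ^ (i : ℕ)) := by
        ext i j
        rw [Matrix.map_apply, Matrix.diagonal_mul, Matrix.mul_diagonal, hΦ]
        simp only [Polynomial.eval_mul, Polynomial.eval_C, Polynomial.eval_pow, Polynomial.eval_X]
        rcases le_or_gt i j with h | h
        · rw [mul_left_comm, star_pow_mul_pow_of_unit ht' h]
        · rw [hR i j h, zero_mul, zero_mul, mul_zero]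
      rw [hconj, hL _ (hdiag _), hT _ hy, ← mul_assoc, ← hwFun_mul_of_lower e (hdiag _),
        Matrix.diagonal_mul_diagonal]
      simp only [hy]
      rw [Matrix.diagonal_one, hwFun_one, one_mul, sub_self]
    have hmem : (fun Z => f Z - f R) ∈ matPoly N :=
      sub_mem hf (Subalgebra.algebraMap_mem (matPoly N) (f R))
    have h0 := line_eq_zero hmem Φ _ infinite_unit_circle hcirc 0
    rw [← sub_eq_zero.1 h0, hΦ0, ← Matrix.mul_one (Matrix.diagonal fun i => R i i), hL _ (hdiag _),
      hwFun_of_upper e hR, hwFun_diagonal, mul_comm]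
  have hmem : (fun Z => f Z - f 1 * hwFun e Z) ∈ matPoly N :=
    sub_mem hf (mul_mem (Subalgebra.algebraMap_mem (matPoly N) (f 1)) (hwFun_mem_matPoly e))
  have h := eq_zero_of_posDef hmem fun H hH => by
    obtain ⟨L, R, hL', hR', rfl⟩ := exists_lower_mul_upper hH
    rw [hL L hL', hR R hR', hwFun_mul_of_lower e hL']
    ring
  exact sub_eq_zero.1 (congrFun h X)

/-- The zonal spherical function attached to a highest weight function. -/
def sph {N : ℕ} (μ : Measure (UN N)) (e : Fin N → ℕ) (Z : Matrix (Fin N) (Fin N) ℂ) : ℂ :=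
  ∫ U : UN N, hwFun e ((U : Matrix (Fin N) (Fin N) ℂ) * Z * (U : Matrix (Fin N) (Fin N) ℂ)ᴴ) ∂μ

lemma continuous_hwFun {N : ℕ} (e : Fin N → ℕ) : Continuous (hwFun e) :=
  continuous_of_mem_matPoly (hwFun_mem_matPoly e)

section Spherical

variable {N : ℕ} (μ : Measure (UN N)) [IsProbabilityMeasure μ]

lemma exists_sph_eq (e : Fin N → ℕ) {δ : EntryPoly N} (hδ : toFun N δ = hwFun e) :
    ∃ q : EntryPoly N, toFun N q = sph μ e ∧ ∀ γ, MvPolynomial.coeff γ q =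
      ∫ U : UN N, MvPolynomial.coeff γ (substMul (U : Matrix (Fin N) (Fin N) ℂ)
        (U : Matrix (Fin N) (Fin N) ℂ)ᴴ δ) ∂μ := by
  have hU := continuous_coe_UN N
  obtain ⟨q, hq, hc⟩ := exists_integral_substMul μ (continuous_const (y := (1 : ℂ))) hU
    hU.matrix_conjTranspose δ
  refine ⟨q, funext fun Z => ?_, fun γ => ?_⟩
  · rw [hq, sph]
    simp only [hδ, one_mul]
  · rw [hc]
    simp only [one_mul]

lemma sph_mem_matPoly (e : Fin N → ℕ) : sph μ e ∈ matPoly N := by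
  obtain ⟨δ, hδ⟩ := hwFun_mem_matPoly e
  obtain ⟨q, hq, -⟩ := exists_sph_eq μ e hδ
  exact ⟨q, hq⟩

lemma continuous_sph (e : Fin N → ℕ) : Continuous (sph μ e) :=
  continuous_of_mem_matPoly (sph_mem_matPoly μ e)

lemma sph_one (e : Fin N → ℕ) : sph μ e 1 = 1 := by
  simp [sph, mul_conjTranspose_self_UN, hwFun_one]

variable [μ.IsHaarMeasure]

lemma isClass_sph (e : Fin N → ℕ) : IsClass (sph μ e) := by
  intro V Z
  symm
  rw [sph, sph, ← integral_mul_right_eq_self (μ := μ) _ V]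
  simp only [coe_mul_UN, conjTranspose_mul, Matrix.mul_assoc]

end Spherical

section Integration

variable {N : ℕ} (μ : Measure (UN N)) [IsProbabilityMeasure μ]

lemma integral_swap_of_continuous {f : UN N → UN N → ℂ}
    (hf : Continuous fun p : UN N × UN N => f p.1 p.2) :
    ∫ U, ∫ V, f U V ∂μ ∂μ = ∫ V, ∫ U, f U V ∂μ ∂μ :=
  integral_integral_swap (integrable_of_continuous _ hf)

variable [μ.IsHaarMeasure]

lemma integral_conj_UN (f : UN N → ℂ) (W : UN N) :
    ∫ U, f (W * (U * W⁻¹)) ∂μ = ∫ U, f U ∂μ := by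
  rw [integral_mul_right_eq_self (fun U => f (W * U)) W⁻¹, integral_mul_left_eq_self f W]

lemma integral_hwFun_mul_conj (e : Fin N → ℕ) (X B : Matrix (Fin N) (Fin N) ℂ) :
    ∫ V : UN N, hwFun e (X * (V.1 * B * V.1ᴴ)) ∂μ = sph μ e B * hwFun e X := by
  have hmem : (fun X : Matrix (Fin N) (Fin N) ℂ =>
      ∫ V : UN N, hwFun e (X * (V.1 * B * V.1ᴴ)) ∂μ) ∈ matPoly N := by
    have := integral_mem_matPoly μ (continuous_const (y := (1 : ℂ)))
      (continuous_const (y := (1 : Matrix (Fin N) (Fin N) ℂ)))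
      (G := fun V : UN N => V.1 * B * V.1ᴴ) (by fun_prop) (hwFun_mem_matPoly e)
    simpa only [one_mul, Matrix.one_mul] using this
  have h := eq_mul_hwFun e hmem ?_ ?_ X
  · rw [h]
    simp only [Matrix.one_mul]
    rfl
  · intro L hL X
    simp only [Matrix.mul_assoc L, hwFun_mul_of_lower e hL]
    exact integral_const_mul _ _
  · intro y hy X
    have hup : ∀ i j, j < i → Matrix.diagonal y i j = 0 := fun i j h =>
      Matrix.diagonal_apply_ne _ h.ne'
    rw [← integral_const_mul, ← integral_mul_left_eq_self (μ := μ)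
      (fun V : UN N => hwFun e (X * Matrix.diagonal y * (V.1 * B * V.1ᴴ))) (diagUN y hy)⁻¹]
    refine integral_congr_ae (.of_forall fun V => ?_)
    have h1 : Matrix.diagonal y * (Matrix.diagonal y)ᴴ = 1 :=
      mul_conjTranspose_self_UN (diagUN y hy)
    have h2 : ((diagUN y hy)⁻¹ * V).1 = (Matrix.diagonal y)ᴴ * V.1 := rfl
    simp only [h2, conjTranspose_mul, conjTranspose_conjTranspose]
    rw [mul_comm, ← hwFun_mul_of_upper e hup]
    congr 1
    simp only [Matrix.mul_assoc]
    rw [← Matrix.mul_assoc (Matrix.diagonal y) (Matrix.diagonal y)ᴴ, h1, Matrix.one_mul]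

/-- The product formula of a zonal spherical function. -/
lemma integral_sph_mul_conj (e : Fin N → ℕ) (A B : Matrix (Fin N) (Fin N) ℂ) :
    ∫ V : UN N, sph μ e (A * (V.1 * B * V.1ᴴ)) ∂μ = sph μ e A * sph μ e B := by
  have hc : Continuous fun p : UN N × UN N =>
      hwFun e (p.2.1 * (A * (p.1.1 * B * p.1.1ᴴ)) * p.2.1ᴴ) :=
    (continuous_hwFun e).comp (by fun_prop)
  simp only [sph]
  rw [integral_swap_of_continuous μ hc, ← integral_mul_const]
  refine integral_congr_ae (.of_forall fun U => ?_)
  change _ = _ * sph μ e B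
  symm
  rw [mul_comm, ← integral_hwFun_mul_conj, ← integral_mul_left_eq_self (μ := μ) _ U]
  refine integral_congr_ae (.of_forall fun V => ?_)
  have : (U * V).1 = U.1 * V.1 := rfl
  simp only [this, conjTranspose_mul, Matrix.mul_assoc]
  rw [← Matrix.mul_assoc U.1ᴴ, conjTranspose_mul_self_UN, Matrix.one_mul]

/-- Convolution with a class function acts on a highest weight function by a scalar. -/
lemma integral_hwFun_mul (e : Fin N → ℕ) {g : Matrix (Fin N) (Fin N) ℂ → ℂ} (hg : Continuous g)
    (hg' : IsClass g) (X : Matrix (Fin N) (Fin N) ℂ) :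
    ∫ U : UN N, hwFun e (X * U.1) * g U.1ᴴ ∂μ =
      (∫ U : UN N, hwFun e U.1 * g U.1ᴴ ∂μ) * hwFun e X := by
  have hmem : (fun X : Matrix (Fin N) (Fin N) ℂ =>
      ∫ U : UN N, hwFun e (X * U.1) * g U.1ᴴ ∂μ) ∈ matPoly N := by
    have := integral_mem_matPoly μ (c := fun U => g U.1ᴴ) (hg.comp (by fun_prop))
      (continuous_const (y := (1 : Matrix (Fin N) (Fin N) ℂ)))
      (G := fun V : UN N => V.1) (by fun_prop) (hwFun_mem_matPoly e)
    simpa only [Matrix.one_mul, mul_comm (g _)] using this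
  have h := eq_mul_hwFun e hmem ?_ ?_ X
  · rw [h]
    simp only [Matrix.one_mul]
  · intro L hL X
    simp only [Matrix.mul_assoc L, hwFun_mul_of_lower e hL, mul_assoc]
    exact integral_const_mul _ _
  · intro y hy X
    have hup : ∀ i j, j < i → Matrix.diagonal y i j = 0 := fun i j h =>
      Matrix.diagonal_apply_ne _ h.ne'
    set T := diagUN y hy
    have hT : Matrix.diagonal y = T.1 := rfl
    rw [← integral_const_mul,
      ← integral_conj_UN μ (fun U => hwFun e (X * Matrix.diagonal y * U.1) * g U.1ᴴ) T⁻¹]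
    refine integral_congr_ae (.of_forall fun U => ?_)
    have h2 : (T⁻¹ * (U * T⁻¹⁻¹)).1 = T.1ᴴ * (U.1 * T.1) := by rw [inv_inv]; rfl
    simp only [h2, conjTranspose_mul, conjTranspose_conjTranspose]
    rw [hT] at hup ⊢
    have h3 : g (T.1ᴴ * U.1ᴴ * T.1) = g U.1ᴴ := by
      have := hg' T⁻¹ U.1ᴴ
      rwa [coe_inv_UN, conjTranspose_conjTranspose] at this
    rw [h3, Matrix.mul_assoc X, ← Matrix.mul_assoc T.1, mul_conjTranspose_self_UN, Matrix.one_mul,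
      ← Matrix.mul_assoc, hwFun_mul_of_upper e hup]
    ring

lemma integral_sph_mul (e : Fin N → ℕ) {g : Matrix (Fin N) (Fin N) ℂ → ℂ} (hg : Continuous g)
    (hg' : IsClass g) (X : Matrix (Fin N) (Fin N) ℂ) :
    ∫ U : UN N, sph μ e (X * U.1) * g U.1ᴴ ∂μ =
      (∫ U : UN N, hwFun e U.1 * g U.1ᴴ ∂μ) * sph μ e X := by
  have hc : Continuous fun p : UN N × UN N =>
      hwFun e (p.2.1 * (X * p.1.1) * p.2.1ᴴ) * g p.1.1ᴴ :=
    ((continuous_hwFun e).comp (by fun_prop)).mul (hg.comp (by fun_prop))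
  simp only [sph, ← integral_mul_const, ← integral_const_mul]
  rw [integral_swap_of_continuous μ hc]
  refine integral_congr_ae (.of_forall fun W => ?_)
  symm
  simp only
  rw [integral_mul_const, ← integral_hwFun_mul μ e hg hg', ← integral_conj_UN μ _ W]
  refine integral_congr_ae (.of_forall fun U => ?_)
  have h2 : (W * (U * W⁻¹)).1 = W.1 * (U.1 * W.1ᴴ) := rfl
  have h3 := hg' W U.1ᴴ
  simp only [h2, conjTranspose_mul, conjTranspose_conjTranspose, Matrix.mul_assoc]
  rw [← Matrix.mul_assoc W.1ᴴ, conjTranspose_mul_self_UN, Matrix.one_mul]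
  simp only [← Matrix.mul_assoc] at h3 ⊢
  rw [h3]

/-- Highest weight functions of different weights are orthogonal. -/
lemma integral_hwFun_mul_hwFun {e e' : Fin N → ℕ} (he : hwWeight e ≠ hwWeight e')
    (P Q : Matrix (Fin N) (Fin N) ℂ) :
    ∫ U : UN N, hwFun e U.1 * hwFun e' (P * U.1ᴴ * Q) ∂μ = 0 := by
  set f : Matrix (Fin N) (Fin N) ℂ → ℂ := fun Q =>
    ∫ U : UN N, hwFun e U.1 * hwFun e' (P * U.1ᴴ * Q) ∂μ with hf
  have hc : Continuous fun U : UN N => hwFun e U.1 := (continuous_hwFun e).comp (by fun_prop)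
  have hmem : f ∈ matPoly N := by
    have := integral_mem_matPoly μ hc (F := fun U => P * U.1ᴴ) (by fun_prop)
      (continuous_const (y := (1 : Matrix (Fin N) (Fin N) ℂ))) (hwFun_mem_matPoly e')
    simpa only [Matrix.mul_one] using this
  have hmove : ∀ X Q : Matrix (Fin N) (Fin N) ℂ,
      ∫ U : UN N, hwFun e (X * U.1) * hwFun e' (P * U.1ᴴ * Q) ∂μ = f (X * Q) := by
    intro X Q
    have h1 : (fun X => ∫ U : UN N, hwFun e (X * U.1) * hwFun e' (P * U.1ᴴ * Q) ∂μ) ∈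
        matPoly N := by
      have := integral_mem_matPoly μ (c := fun U => hwFun e' (P * U.1ᴴ * Q))
        ((continuous_hwFun e').comp (by fun_prop))
        (continuous_const (y := (1 : Matrix (Fin N) (Fin N) ℂ)))
        (G := fun V : UN N => V.1) (by fun_prop) (hwFun_mem_matPoly e)
      simpa only [Matrix.one_mul, mul_comm (hwFun e' _)] using this
    refine congrFun (eq_of_unitary h1 (comp_mul_right_mem_matPoly hmem Q) fun V => ?_) X
    simp only [hf]
    rw [← integral_mul_left_eq_self (μ := μ) _ V⁻¹]
    refine integral_congr_ae (.of_forall fun U => ?_)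
    have h2 : (V⁻¹ * U).1 = V.1ᴴ * U.1 := rfl
    simp only [h2, conjTranspose_mul, conjTranspose_conjTranspose, Matrix.mul_assoc]
    rw [← Matrix.mul_assoc V.1, mul_conjTranspose_self_UN, Matrix.one_mul]
  have hL : ∀ L : Matrix (Fin N) (Fin N) ℂ, (∀ i j, i < j → L i j = 0) →
      ∀ X, f (L * X) = hwFun e L * f X := by
    intro L hL X
    rw [← hmove]
    simp only [hwFun_mul_of_lower e hL, mul_assoc (hwFun e L)]
    exact integral_const_mul (hwFun e L) _
  have hR : ∀ R : Matrix (Fin N) (Fin N) ℂ, (∀ i j, j < i → R i j = 0) →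
      ∀ X, f (X * R) = f X * hwFun e' R := by
    intro R hR X
    simp only [hf, ← Matrix.mul_assoc, hwFun_mul_of_upper e' hR]
    simp only [← mul_assoc]
    exact integral_mul_const (L := ℂ) (hwFun e' R) _
  have h1 : f 1 = 0 := by
    obtain ⟨i, hi⟩ := Function.ne_iff.1 he
    set T : Matrix (Fin N) (Fin N) ℂ := Matrix.diagonal (Function.update 1 i 2) with hT
    have hw : ∀ e : Fin N → ℕ, hwFun e T = 2 ^ hwWeight e i := by
      intro e
      rw [hT, hwFun_diagonal, Finset.prod_eq_single i]
      · simp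
      · intro j _ hj
        simp [hj]
      · simp
    have h2 := hL T (fun i j h => Matrix.diagonal_apply_ne _ h.ne) 1
    have h3 := hR T (fun i j h => Matrix.diagonal_apply_ne _ h.ne') 1
    rw [Matrix.mul_one, hw] at h2
    rw [Matrix.one_mul, hw, h2, mul_comm] at h3
    by_contra hne
    exact hi (Nat.pow_right_injective (le_refl 2) (by exact_mod_cast mul_left_cancel₀ hne h3))
  have h := eq_zero_of_posDef hmem fun H hH => by
    obtain ⟨L, R, hL', hR', rfl⟩ := exists_lower_mul_upper hH
    rw [hL L hL', ← Matrix.one_mul R, hR R hR', h1, zero_mul, mul_zero]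
  exact congrFun h Q

lemma integral_sph_mul_sph {e e' : Fin N → ℕ} (he : hwWeight e ≠ hwWeight e') :
    ∫ U : UN N, sph μ e U.1 * sph μ e' U.1ᴴ ∂μ = 0 := by
  have h := integral_sph_mul μ e (continuous_sph μ e') (isClass_sph μ e') 1
  simp only [Matrix.one_mul] at h
  have hc : Continuous fun p : UN N × UN N =>
      hwFun e p.1.1 * hwFun e' (p.2.1 * p.1.1ᴴ * p.2.1ᴴ) :=
    ((continuous_hwFun e).comp (by fun_prop)).mul ((continuous_hwFun e').comp (by fun_prop))
  rw [h, sph_one, mul_one]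
  simp only [sph, ← integral_const_mul]
  rw [integral_swap_of_continuous μ hc]
  simp only [integral_hwFun_mul_hwFun μ he, integral_zero]

end Integration

/-! ### Weights of zonal spherical functions -/

/-- All monomials of `p` have weight at most `b`. -/
def WeightLE {N : ℕ} (w : Fin N → ℕ) (b : ℕ) (p : MvPolynomial (Fin N) ℂ) : Prop :=
  ∀ α, MvPolynomial.coeff α p ≠ 0 → Finsupp.weight w α ≤ b

namespace WeightLE

variable {N : ℕ} {w : Fin N → ℕ} {a b : ℕ} {p q : MvPolynomial (Fin N) ℂ}

lemma const (c : ℂ) : WeightLE w b (MvPolynomial.C c) := fun α hα => by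
  rw [MvPolynomial.coeff_C] at hα
  split_ifs at hα with h
  · simp [← h]
  · exact absurd rfl hα

lemma zero : WeightLE w b 0 := by simpa using const (w := w) (b := b) 0

lemma one : WeightLE w b 1 := by simpa using const (w := w) (b := b) 1

lemma var {i : Fin N} (h : w i ≤ b) : WeightLE w b (MvPolynomial.X i) := fun α hα => by
  rw [MvPolynomial.coeff_X] at hα
  split_ifs at hα with h'
  · simpa [← h', Finsupp.weight_apply] using h
  · exact absurd rfl hα

lemma add (hp : WeightLE w b p) (hq : WeightLE w b q) : WeightLE w b (p + q) := fun α hα => by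
  by_contra hb
  refine hα ?_
  rw [MvPolynomial.coeff_add, not_not.1 (mt (hp α) hb), not_not.1 (mt (hq α) hb), add_zero]

lemma sum {ι : Type*} {s : Finset ι} {f : ι → MvPolynomial (Fin N) ℂ}
    (h : ∀ i ∈ s, WeightLE w b (f i)) : WeightLE w b (∑ i ∈ s, f i) :=
  Finset.sum_induction _ _ (fun _ _ => add) zero h

lemma mul (hp : WeightLE w a p) (hq : WeightLE w b q) : WeightLE w (a + b) (p * q) :=
  fun α hα => by
  rw [MvPolynomial.coeff_mul] at hα
  obtain ⟨βγ, hβγ, h⟩ := Finset.exists_ne_zero_of_sum_ne_zero hα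
  rw [← Finset.HasAntidiagonal.mem_antidiagonal.1 hβγ, map_add]
  exact add_le_add (hp _ (left_ne_zero_of_mul h)) (hq _ (right_ne_zero_of_mul h))

lemma prod {ι : Type*} {s : Finset ι} {c : ι → ℕ} {f : ι → MvPolynomial (Fin N) ℂ}
    (h : ∀ i ∈ s, WeightLE w (c i) (f i)) : WeightLE w (∑ i ∈ s, c i) (∏ i ∈ s, f i) := by
  induction s using Finset.cons_induction with
  | empty => exact one
  | cons i s hi ih =>
    rw [Finset.sum_cons, Finset.prod_cons]
    exact (h i (Finset.mem_cons_self i s)).mul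
      (ih fun j hj => h j (Finset.mem_cons_of_mem hj))

lemma pow (hp : WeightLE w b p) (k : ℕ) : WeightLE w (k * b) (p ^ k) := by
  simpa using prod (s := Finset.range k) (c := fun _ => b) fun _ _ => hp

lemma det {ι : Type*} [Fintype ι] [DecidableEq ι] {M : Matrix ι ι (MvPolynomial (Fin N) ℂ)}
    {c : ι → ℕ} (h : ∀ i j, WeightLE w (c j) (M i j)) : WeightLE w (∑ j, c j) M.det := by
  rw [Matrix.det_apply']
  refine sum fun σ _ => ?_
  have hσ : WeightLE w 0 (((Equiv.Perm.sign σ : ℤ) : MvPolynomial (Fin N) ℂ)) := by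
    simpa using const (w := w) (b := 0) ((Equiv.Perm.sign σ : ℤ) : ℂ)
  simpa using hσ.mul (prod fun i _ => h (σ i) i)

end WeightLE

/-- The generic matrix. -/
def genMat (N : ℕ) : Matrix (Fin N) (Fin N) (EntryPoly N) :=
  Matrix.of fun i j => MvPolynomial.X (i, j)

lemma map_cutMat {N : ℕ} {R S : Type*} [CommRing R] [CommRing S] (f : R →+* S) (k : ℕ)
    (Z : Matrix (Fin N) (Fin N) R) : f.mapMatrix (cutMat k Z) = cutMat k (f.mapMatrix Z) := by
  ext i j
  simp only [RingHom.mapMatrix_apply, Matrix.map_apply, cutMat, Matrix.of_apply]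
  split_ifs <;> simp

/-- The polynomial whose function is `hwFun e`. -/
def hwPoly {N : ℕ} (e : Fin N → ℕ) : EntryPoly N :=
  ∏ k : Fin N, (cutMat (k + 1) (genMat N)).det ^ e k

lemma toFun_hwPoly {N : ℕ} (e : Fin N → ℕ) : toFun N (hwPoly e) = hwFun e := by
  funext Z
  rw [toFun_apply, hwPoly, hwFun, map_prod]
  refine Finset.prod_congr rfl fun k _ => ?_
  rw [map_pow, RingHom.map_det, map_cutMat]
  congr 3
  ext i j
  simp [genMat]

lemma diagRes_substMul_X {N : ℕ} (F G : Matrix (Fin N) (Fin N) ℂ) (i j : Fin N) :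
    diagRes N (substMul F G (MvPolynomial.X (i, j))) =
      ∑ a, MvPolynomial.C (F i a * G a j) * MvPolynomial.X a := by
  rw [substMul_X, map_sum, Fintype.sum_prod_type]
  refine Finset.sum_congr rfl fun a _ => ?_
  rw [Finset.sum_eq_single a]
  · simp [diagRes]
  · intro b _ hb
    simp [diagRes, Ne.symm hb]
  · simp

lemma weightLE_minor {N : ℕ} (F G : Matrix (Fin N) (Fin N) ℂ) (k r : Fin N) :
    WeightLE (fun i => if i ≤ r then 1 else 0)
      (∑ i ∈ Finset.Iic r, if i ≤ k then 1 else 0) (cutMat (k + 1) (Matrix.of fun i j =>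
        ∑ a, MvPolynomial.C (F i a * G a j) * MvPolynomial.X a)).det := by
  rcases le_total k r with hkr | hkr
  · have h : ∑ i ∈ Finset.Iic r, (if i ≤ k then 1 else 0) = ∑ i, if i ≤ k then 1 else 0 := by
      refine Finset.sum_subset (Finset.subset_univ _) fun i _ hi => if_neg fun hik => hi ?_
      exact Finset.mem_Iic.2 (hik.trans hkr)
    rw [h]
    refine WeightLE.det fun i j => ?_
    simp only [cutMat, Matrix.of_apply]
    by_cases h1 : (i : ℕ) < k + 1 ∧ (j : ℕ) < k + 1
    · rw [if_pos h1, if_pos (Fin.le_def.2 (Nat.lt_succ_iff.1 h1.2))]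
      refine WeightLE.sum fun a _ => ?_
      simpa using (WeightLE.const (b := 0) (F i a * G a j)).mul
        (WeightLE.var (w := fun i => if i ≤ r then 1 else 0) (b := 1) (i := a)
          (by split_ifs <;> simp))
    · rw [if_neg h1]
      split_ifs
      all_goals first | exact WeightLE.one | exact WeightLE.zero
  · have h : ∑ i ∈ Finset.Iic r, (if i ≤ k then 1 else 0) =
        ∑ j : Fin N ⊕ Fin N, Sum.elim (fun i => if i ≤ r then 1 else 0) (fun _ => 0) j := by
      rw [Fintype.sum_sum_type]
      simp only [Sum.elim_inl, Sum.elim_inr, Finset.sum_const_zero, add_zero]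
      rw [← Finset.sum_filter, Finset.filter_true_of_mem fun i hi =>
        (Finset.mem_Iic.1 hi).trans hkr, ← Finset.sum_filter]
      congr 1
      ext i
      simp
    set u : Matrix (Fin N) (Fin N) (MvPolynomial (Fin N) ℂ) := Matrix.of fun i a =>
      if (i : ℕ) < k + 1 ∧ a ≤ r then -(MvPolynomial.C (F i a) * MvPolynomial.X a) else 0 with hu
    set v : Matrix (Fin N) (Fin N) (MvPolynomial (Fin N) ℂ) := Matrix.of fun a j =>
      if (j : ℕ) < k + 1 then MvPolynomial.C (G a j) else 0 with hv
    set E : Matrix (Fin N) (Fin N) (MvPolynomial (Fin N) ℂ) := cutMat (k + 1) (Matrix.of fun i j =>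
      ∑ a, if a ≤ r then 0 else MvPolynomial.C (F i a * G a j) * MvPolynomial.X a) with hE
    have hdet : cutMat (k + 1) (Matrix.of fun i j =>
        ∑ a, MvPolynomial.C (F i a * G a j) * MvPolynomial.X a) = E - u * v := by
      ext1 i j
      rw [Matrix.sub_apply, Matrix.mul_apply]
      simp only [hE, hu, hv, cutMat, Matrix.of_apply]
      by_cases hij : (i : ℕ) < k + 1 ∧ (j : ℕ) < k + 1
      · rw [if_pos hij, if_pos hij, ← Finset.sum_sub_distrib]
        refine Finset.sum_congr rfl fun a _ => ?_
        by_cases ha : a ≤ r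
        · rw [if_pos ha, if_pos ⟨hij.1, ha⟩, if_pos hij.2, map_mul]
          ring
        · rw [if_neg ha, if_neg fun h => ha h.2, zero_mul, sub_zero]
      · rw [if_neg hij, if_neg hij, Finset.sum_eq_zero, sub_zero]
        intro a _
        by_cases hi : (i : ℕ) < k + 1
        · rw [if_neg (fun hj => hij ⟨hi, hj⟩), mul_zero]
        · rw [if_neg (fun h => hi h.1), zero_mul]
    rw [hdet, ← Matrix.det_fromBlocks_one₁₁, h]
    refine WeightLE.det fun i j => ?_
    rcases i with i | i <;> rcases j with j | j
    · simp only [Matrix.fromBlocks_apply₁₁, Matrix.one_apply]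
      split_ifs
      exacts [WeightLE.one, WeightLE.zero]
    · simp only [Matrix.fromBlocks_apply₁₂, hv, Matrix.of_apply]
      split_ifs
      exacts [WeightLE.const _, WeightLE.zero]
    · simp only [Matrix.fromBlocks_apply₂₁, hu, Matrix.of_apply, Sum.elim_inl]
      by_cases h1 : (i : ℕ) < k + 1 ∧ j ≤ r
      · rw [if_pos h1, if_pos h1.2, ← neg_mul, ← map_neg]
        simpa using (WeightLE.const (b := 0) (-F i j)).mul (WeightLE.var (b := 1)
          (w := fun i => if i ≤ r then 1 else 0) (i := j) (by simp [h1.2]))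
      · rw [if_neg h1]
        exact WeightLE.zero
    · simp only [Matrix.fromBlocks_apply₂₂, hE, cutMat, Matrix.of_apply, Sum.elim_inr]
      split_ifs
      · refine WeightLE.sum fun a _ => ?_
        split_ifs with ha
        · exact WeightLE.zero
        · simpa using (WeightLE.const (b := 0) (F i a * G a j)).mul (WeightLE.var (b := 0)
            (w := fun i => if i ≤ r then 1 else 0) (i := a) (by simp [ha]))
      · exact WeightLE.one
      · exact WeightLE.zero

lemma weightLE_hwPoly {N : ℕ} (e : Fin N → ℕ) (F G : Matrix (Fin N) (Fin N) ℂ) (r : Fin N) :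
    WeightLE (fun i => if i ≤ r then 1 else 0) (∑ i ∈ Finset.Iic r, hwWeight e i)
      (diagRes N (substMul F G (hwPoly e))) := by
  have h : ∑ i ∈ Finset.Iic r, hwWeight e i =
      ∑ k, e k * ∑ i ∈ Finset.Iic r, if i ≤ k then 1 else 0 := by
    simp only [hwWeight, Finset.mul_sum]
    rw [Finset.sum_comm]
    refine Finset.sum_congr rfl fun i _ => ?_
    simp only [mul_ite, mul_one, mul_zero]
    rw [← Finset.sum_filter]
    congr 1
    ext k
    simp
  rw [h, hwPoly, map_prod, map_prod]
  refine WeightLE.prod fun k _ => ?_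
  rw [map_pow, map_pow]
  refine WeightLE.pow ?_ _
  have := weightLE_minor F G k r
  convert this
  change ((diagRes N).toRingHom.comp (substMul F G).toRingHom) _ = _
  rw [RingHom.map_det, map_cutMat]
  congr 2
  ext1 i j
  exact diagRes_substMul_X F G i j

lemma coeff_diagRes {N : ℕ} (p : EntryPoly N) (α : Fin N →₀ ℕ) :
    MvPolynomial.coeff α (diagRes N p) =
      MvPolynomial.coeff (α.mapDomain fun i => (i, i)) p := by
  have hinj : Function.Injective fun i : Fin N => (i, i) := fun i j h => congrArg Prod.fst h
  rw [← MvPolynomial.coeff_killCompl (hf := hinj)]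
  congr 1
  refine congrArg (fun f : EntryPoly N →ₐ[ℂ] MvPolynomial (Fin N) ℂ => f p)
    (MvPolynomial.algHom_ext fun ij => ?_)
  obtain ⟨i, j⟩ := ij
  simp only [diagRes, MvPolynomial.aeval_X, MvPolynomial.killCompl]
  by_cases hij : i = j
  · subst hij
    have hmem : (i, i) ∈ Set.range fun i : Fin N => (i, i) := ⟨i, rfl⟩
    rw [if_pos rfl, dif_pos hmem]
    congr 1
    rw [Equiv.eq_symm_apply]
    rfl
  · rw [if_neg hij, dif_neg]
    rintro ⟨a, ha⟩
    exact hij ((congrArg Prod.fst ha).symm.trans (congrArg Prod.snd ha))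

lemma weightLE_alternant_stair {N : ℕ} (r : Fin N) :
    WeightLE (fun i => if i ≤ r then 1 else 0) (∑ i ∈ Finset.Iic r, stair N i)
      (alternant (stair N)) := by
  rw [alternant_eq_sum]
  refine WeightLE.sum fun σ _ α hα => ?_
  rw [MvPolynomial.coeff_monomial] at hα
  split_ifs at hα with h
  · rw [← h, Finsupp.weight_apply, Finsupp.sum_fintype _ _ (by simp)]
    have hmono : Monovary (stair N) fun i : Fin N => if i ≤ r then 1 else 0 := by
      intro i j hij
      have hi : ¬ i ≤ r := by
        intro hi
        simp only [if_pos hi] at hij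
        split_ifs at hij <;> simp at hij
      have hj : j ≤ r := by
        by_contra hj
        simp [hj] at hij
      have := Fin.le_def.1 (hj.trans (not_le.1 hi).le)
      simp only [stair]
      omega
    refine (hmono.sum_comp_perm_smul_le_sum_smul (σ := σ)).trans (le_of_eq ?_)
    simp only [smul_eq_mul, mul_ite, mul_one, mul_zero]
    rw [← Finset.sum_filter]
    congr 1
    ext i
    simp
  · exact absurd rfl hα

section Dominance

variable {N : ℕ} (μ : Measure (UN N)) [IsProbabilityMeasure μ]

/-- The expansion of a zonal spherical function only involves lower weights. -/
lemma sum_Iic_le_of_schurCoeff_ne_zero {e : Fin N → ℕ} {q : EntryPoly N}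
    (hq : toFun N q = sph μ e) {m : Fin N → ℕ} (hm : schurCoeff m (diagRes N q) ≠ 0) (r : Fin N) :
    ∑ i ∈ Finset.Iic r, m i ≤ ∑ i ∈ Finset.Iic r, hwWeight e i := by
  have hbound : WeightLE (fun i => if i ≤ r then 1 else 0) (∑ i ∈ Finset.Iic r, hwWeight e i)
      (diagRes N q) := by
    intro α hα
    obtain ⟨q', hq', hc⟩ := exists_sph_eq μ e (toFun_hwPoly e)
    obtain rfl : q = q' := toFun_injective N (hq.trans hq'.symm)
    by_contra hb
    refine hα ?_
    rw [coeff_diagRes, hc]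
    refine (integral_congr_ae (.of_forall fun U => ?_)).trans
      (integral_zero (UN N) ℂ)
    rw [← coeff_diagRes]
    by_contra h
    exact hb (weightLE_hwPoly e _ _ r α h)
  have h := ((weightLE_alternant_stair r).mul hbound) _ hm
  rw [Finsupp.weight_apply, Finsupp.sum_fintype _ _ (by simp)] at h
  have h2 : ∑ i, toExp (m + stair N) i • (if i ≤ r then 1 else 0) =
      ∑ i ∈ Finset.Iic r, m i + ∑ i ∈ Finset.Iic r, stair N i := by
    rw [← Finset.sum_add_distrib]
    simp only [smul_eq_mul, mul_ite, mul_one, mul_zero]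
    rw [← Finset.sum_filter]
    refine Finset.sum_congr ?_ fun i _ => rfl
    ext i
    simp
  omega

end Dominance

/-! ### Schur functions as spherical functions -/

section SchurSph

variable {N : ℕ}

lemma sum_Iic_lt_of_ne {l m : Fin N → ℕ} (hne : m ≠ l)
    (h : ∀ r, ∑ i ∈ Finset.Iic r, m i ≤ ∑ i ∈ Finset.Iic r, l i) :
    ∑ r, ∑ i ∈ Finset.Iic r, m i < ∑ r, ∑ i ∈ Finset.Iic r, l i := by
  refine Finset.sum_lt_sum (fun r _ => h r) ?_
  by_contra! hc
  have heq : ∀ r, ∑ i ∈ Finset.Iic r, m i = ∑ i ∈ Finset.Iic r, l i := fun r =>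
    (h r).antisymm (hc r (Finset.mem_univ r))
  refine hne (funext fun r => ?_)
  induction r using WellFoundedLT.induction with
  | _ r ih =>
    have hr := heq r
    rw [← Finset.Iio_insert, Finset.sum_insert (by simp), Finset.sum_insert (by simp),
      Finset.sum_congr rfl fun i hi => ih i (Finset.mem_Iio.1 hi)] at hr
    exact Nat.add_right_cancel hr

variable (μ : Measure (UN N)) [IsProbabilityMeasure μ] [μ.IsHaarMeasure]

lemma exists_schur_eq_smul_sph {l : Fin N → ℕ} (hl : Antitone l) :
    ∃ e : Fin N → ℕ, hwWeight e = l ∧ schur l 1 ≠ 0 ∧ schur l = schur l 1 • sph μ e := by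
  induction hs : ∑ r, ∑ i ∈ Finset.Iic r, l i using Nat.strong_induction_on generalizing l with
  | _ s ih =>
  obtain ⟨e, he⟩ := exists_hwWeight_eq hl
  obtain ⟨q, hq, -⟩ := exists_sph_eq μ e (toFun_hwPoly e)
  have hclass : IsClass (toFun N q) := hq ▸ isClass_sph μ e
  have hzero : ∀ m, Antitone m → m ∉ ({l} : Finset (Fin N → ℕ)) →
      schurCoeff m (diagRes N q) = 0 := by
    intro m hm hml
    rw [Finset.mem_singleton] at hml
    by_contra hne
    have hle := sum_Iic_le_of_schurCoeff_ne_zero μ hq hne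
    rw [he] at hle
    obtain ⟨e', hw, -, he'⟩ := ih _ (hs ▸ sum_Iic_lt_of_ne hml hle) hm rfl
    refine hne ?_
    rw [← integral_schur_mul μ hclass, he', hq]
    simp only [Pi.smul_apply, smul_eq_mul, mul_assoc]
    rw [integral_const_mul, integral_sph_mul_sph μ (by rwa [hw, he]), mul_zero]
  have h := eq_sum_schurCoeff hclass {l} (by simpa using hl) hzero
  rw [Finset.sum_singleton, hq] at h
  have h1 := congrFun h 1
  rw [sph_one, Pi.smul_apply, smul_eq_mul] at h1
  have hne : schur l 1 ≠ 0 := right_ne_zero_of_mul (h1 ▸ one_ne_zero)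
  refine ⟨e, he, hne, ?_⟩
  rw [h, smul_smul, mul_comm, ← h1, one_smul]

lemma continuous_schur (l : Fin N → ℕ) : Continuous (schur l) :=
  continuous_of_mem_matPoly (schur_mem_matPoly l)

lemma schur_mul_comm (l : Fin N → ℕ) (X Y : Matrix (Fin N) (Fin N) ℂ) :
    schur l (X * Y) = schur l (Y * X) := by
  have htr : ∀ k, ((X * Y) ^ (k + 1)).trace = ((Y * X) ^ (k + 1)).trace := by
    intro k
    have h : X * (Y * X) ^ k = (X * Y) ^ k * X := by
      induction k with
      | zero => simp
      | succ k ih => rw [pow_succ, ← mul_assoc, ih, pow_succ]; simp only [mul_assoc]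
    rw [pow_succ, ← mul_assoc, ← h, mul_assoc, Matrix.trace_mul_comm, pow_succ, mul_assoc]
  have hh : ∀ k, hMat (X * Y) k = hMat (Y * X) k := by
    intro k
    induction k using Nat.strong_induction_on with
    | _ k ih =>
      cases k with
      | zero => rw [hMat_zero, hMat_zero]
      | succ k =>
        rw [hMat, hMat]
        congr 1
        refine Finset.sum_congr rfl fun m _ => ?_
        rw [ih (k - m) (by omega), htr]
  simp only [schur, hMatZ, hh]

lemma schur_one_mul_integral_conj {l : Fin N → ℕ} (hl : Antitone l)
    (A B : Matrix (Fin N) (Fin N) ℂ) :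
    schur l 1 * ∫ U : UN N, schur l (A * (U.1 * B * U.1ᴴ)) ∂μ = schur l A * schur l B := by
  obtain ⟨e, -, -, he⟩ := exists_schur_eq_smul_sph μ hl
  have h : ∀ Z, schur l Z = schur l 1 * sph μ e Z := fun Z => congrFun he Z
  have hint : ∫ U : UN N, schur l (A * (U.1 * B * U.1ᴴ)) ∂μ =
      schur l 1 * (sph μ e A * sph μ e B) := by
    rw [← integral_sph_mul_conj, ← integral_const_mul]
    exact integral_congr_ae (.of_forall fun U => h _)
  rw [hint, h A, h B]
  ring

lemma integral_schur_mul_schur {l : Fin N → ℕ} (hl : Antitone l) :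
    ∫ U : UN N, schur l U.1 * schur l U.1ᴴ ∂μ = 1 := by
  obtain ⟨q, hq⟩ := schur_mem_matPoly l
  have hq : toFun N q = schur l := hq
  have h := integral_schur_mul μ (hq ▸ isClass_schur l) l
  rwa [schurCoeff_schur hl hl hq, if_pos rfl, hq] at h

lemma schur_one_mul_integral_mul {l : Fin N → ℕ} (hl : Antitone l)
    (A B : Matrix (Fin N) (Fin N) ℂ) :
    schur l 1 * ∫ U : UN N, schur l (A * U.1) * schur l (U.1ᴴ * B) ∂μ = schur l (A * B) := by
  obtain ⟨e, -, hne, he⟩ := exists_schur_eq_smul_sph μ hl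
  have h : ∀ Z, schur l Z = schur l 1 * sph μ e Z := fun Z => congrFun he Z
  obtain ⟨c, hc⟩ : ∃ c : ℂ, ∀ X : Matrix (Fin N) (Fin N) ℂ,
      ∫ U : UN N, schur l (X * U.1) * schur l U.1ᴴ ∂μ = c * schur l X := by
    refine ⟨∫ U : UN N, hwFun e U.1 * schur l U.1ᴴ ∂μ, fun X => ?_⟩
    rw [h X, mul_left_comm, ← integral_sph_mul μ e (continuous_schur l) (isClass_schur l),
      ← integral_const_mul]
    refine integral_congr_ae (.of_forall fun U => ?_)
    simp only
    rw [h (X * U.1), mul_assoc]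
  have hc1 : schur l 1 * c = 1 := by
    rw [mul_comm, ← hc]
    simpa using integral_schur_mul_schur μ hl
  have hmem : (fun B : Matrix (Fin N) (Fin N) ℂ =>
      ∫ U : UN N, schur l (A * U.1) * schur l (U.1ᴴ * B) ∂μ) ∈ matPoly N := by
    have := integral_mem_matPoly μ (c := fun U => schur l (A * U.1))
      ((continuous_schur l).comp (by fun_prop)) (F := fun U => U.1ᴴ) (by fun_prop)
      (continuous_const (y := (1 : Matrix (Fin N) (Fin N) ℂ))) (schur_mem_matPoly l)
    simpa only [Matrix.mul_one] using this
  refine congrFun (eq_of_unitary (mul_mem (Subalgebra.algebraMap_mem (matPoly N) (schur l 1)) hmem)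
    (comp_mul_left_mem_matPoly (schur_mem_matPoly l) A) fun V => ?_) B
  change schur l 1 * ∫ U : UN N, schur l (A * U.1) * schur l (U.1ᴴ * V.1) ∂μ = schur l (A * V.1)
  rw [← integral_mul_left_eq_self (μ := μ) _ V]
  have hV : ∀ U : UN N, schur l (A * (V * U).1) * schur l ((V * U).1ᴴ * V.1) =
      schur l (A * V.1 * U.1) * schur l U.1ᴴ := by
    intro U
    rw [coe_mul_UN, conjTranspose_mul, Matrix.mul_assoc U.1ᴴ, conjTranspose_mul_self_UN,
      Matrix.mul_one, Matrix.mul_assoc]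
  simp only [hV, hc]
  rw [← mul_assoc, hc1, one_mul]

end SchurSph

lemma schur_one_ne_zero {N : ℕ} (μ : Measure (UN N)) [IsProbabilityMeasure μ] [μ.IsHaarMeasure]
    {l : Fin N → ℕ} (hl : Antitone l) : schur l 1 ≠ 0 :=
  (exists_schur_eq_smul_sph μ hl).choose_spec.2.1

/-! ### Products along the cycles of a permutation -/

section CycleProd

variable {α R : Type*} [Monoid R]

/-- The product of the values of `F` along the first `k` points of the orbit of `x`. -/
def segProd (σ : Equiv.Perm α) (F : α → R) (x : α) (k : ℕ) : R :=
  ((List.range k).map fun t => F ((σ ^ t) x)).prod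

lemma segProd_add (σ : Equiv.Perm α) (F : α → R) (x : α) (a b : ℕ) :
    segProd σ F x (a + b) = segProd σ F x a * segProd σ F ((σ ^ a) x) b := by
  simp only [segProd, List.range_add, List.map_append, List.prod_append, List.map_map]
  congr 3
  funext t
  rw [Function.comp_apply, ← Equiv.Perm.mul_apply, ← pow_add, add_comm]

lemma segProd_one (σ : Equiv.Perm α) (F : α → R) (x : α) : segProd σ F x 1 = F x := by
  simp [segProd]

lemma segProd_congr {σ σ' : Equiv.Perm α} {F F' : α → R} {x : α} {k : ℕ}
    (h : ∀ t < k, F ((σ ^ t) x) = F' ((σ' ^ t) x)) : segProd σ F x k = segProd σ' F' x k := by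
  unfold segProd
  congr 1
  exact List.map_congr_left fun t ht => h t (List.mem_range.1 ht)

lemma minimalPeriod_pos [Finite α] (σ : Equiv.Perm α) (x : α) : 0 < Function.minimalPeriod σ x :=
  Function.minimalPeriod_pos_of_mem_periodicPts (σ.injective.mem_periodicPts x)

lemma pow_minimalPeriod_apply (σ : Equiv.Perm α) (x : α) :
    (σ ^ Function.minimalPeriod σ x) x = x := by
  rw [← Equiv.Perm.iterate_eq_pow]
  exact Function.iterate_minimalPeriod

lemma exists_lt_minimalPeriod [Finite α] {σ : Equiv.Perm α} {x y : α} (h : σ.SameCycle x y) :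
    ∃ t < Function.minimalPeriod σ x, (σ ^ t) x = y := by
  obtain ⟨t, rfl⟩ := h.exists_nat_pow_eq
  refine ⟨t % Function.minimalPeriod σ x, Nat.mod_lt _ (minimalPeriod_pos σ x), ?_⟩
  rw [← Equiv.Perm.iterate_eq_pow, ← Equiv.Perm.iterate_eq_pow,
    Function.iterate_mod_minimalPeriod_eq]

lemma pow_apply_ne {σ : Equiv.Perm α} {x : α} {s t : ℕ} (hst : s < t)
    (ht : t < Function.minimalPeriod σ x) : (σ ^ s) x ≠ (σ ^ t) x := fun h => by
  rw [← Equiv.Perm.iterate_eq_pow, ← Equiv.Perm.iterate_eq_pow] at h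
  exact hst.ne (Function.iterate_injOn_Iio_minimalPeriod (hst.trans ht) ht h)

lemma cycleProd_eq_segProd (σ : Equiv.Perm α) (F : α → R) (x : α) :
    cycleProd σ F x = segProd σ F x (Function.minimalPeriod σ x) := rfl

lemma apply_cycleProd_of_sameCycle [Finite α] {M : Type*} {s : R → M}
    (hs : ∀ a b, s (a * b) = s (b * a)) {σ : Equiv.Perm α} (F : α → R) {x y : α}
    (h : σ.SameCycle x y) : s (cycleProd σ F x) = s (cycleProd σ F y) := by
  obtain ⟨t, rfl⟩ := h.exists_nat_pow_eq
  clear h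
  induction t with
  | zero => simp
  | succ t ih =>
    rw [ih, pow_succ', Equiv.Perm.mul_apply]
    set z := (σ ^ t) x
    have hper : Function.minimalPeriod σ (σ z) = Function.minimalPeriod σ z :=
      Function.minimalPeriod_apply (σ.injective.mem_periodicPts z)
    obtain ⟨k, hk⟩ := Nat.exists_eq_succ_of_ne_zero (minimalPeriod_pos σ z).ne'
    rw [cycleProd_eq_segProd, cycleProd_eq_segProd, hper, hk, Nat.succ_eq_one_add,
      segProd_add, segProd_one, pow_one, hs, add_comm 1 k, segProd_add, segProd_one,
      ← Equiv.Perm.mul_apply (σ ^ k), ← pow_succ, ← Nat.succ_eq_add_one, ← hk,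
      pow_minimalPeriod_apply]

/-- `T` meets every cycle of `σ` exactly once. -/
def IsTransversal (σ : Equiv.Perm α) (T : Finset α) : Prop :=
  ∀ x, ∃! r, r ∈ T ∧ σ.SameCycle r x

lemma IsTransversal.eq {σ : Equiv.Perm α} {T : Finset α} (hT : IsTransversal σ T) {r r' : α}
    (hr : r ∈ T) (hr' : r' ∈ T) (h : σ.SameCycle r r') : r = r' :=
  (hT r').unique ⟨hr, h⟩ ⟨hr', Equiv.Perm.SameCycle.refl σ r'⟩

lemma exists_isTransversal [Fintype α] (σ : Equiv.Perm α) (x : α) :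
    ∃ T, IsTransversal σ T ∧ x ∈ T := by
  set rep : α → α := fun z => if σ.SameCycle x z then x else
    (Quotient.mk (Equiv.Perm.SameCycle.setoid σ) z).out with hrep
  have h1 : ∀ z, σ.SameCycle (rep z) z := by
    intro z
    simp only [hrep]
    split_ifs with h
    · exact h
    · exact Quotient.mk_out (s := Equiv.Perm.SameCycle.setoid σ) z
  have h2 : ∀ z w, σ.SameCycle z w → rep z = rep w := by
    intro z w h
    simp only [hrep]
    have hiff : σ.SameCycle x z ↔ σ.SameCycle x w :=
      ⟨fun h' => h'.trans h, fun h' => h'.trans h.symm⟩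
    have hq : Quotient.mk (Equiv.Perm.SameCycle.setoid σ) z =
        Quotient.mk (Equiv.Perm.SameCycle.setoid σ) w := Quotient.sound h
    simp only [hiff, hq]
  refine ⟨Finset.univ.image rep, fun z => ⟨rep z, ⟨Finset.mem_image_of_mem _ (Finset.mem_univ z),
    h1 z⟩, ?_⟩, ?_⟩
  · rintro r ⟨hr, hz⟩
    obtain ⟨w, -, rfl⟩ := Finset.mem_image.1 hr
    exact h2 w z ((h1 w).symm.trans hz)
  · refine Finset.mem_image.2 ⟨x, Finset.mem_univ x, ?_⟩
    simp only [hrep]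
    rw [if_pos (Equiv.Perm.SameCycle.refl σ x)]

lemma prod_eq_of_isTransversal {M : Type*} [CommMonoid M] {σ : Equiv.Perm α} {T T' : Finset α}
    (hT : IsTransversal σ T) (hT' : IsTransversal σ T') {g : α → M}
    (hg : ∀ x y, σ.SameCycle x y → g x = g y) : ∏ r ∈ T, g r = ∏ r ∈ T', g r := by
  choose f hf hf' using fun x => (hT' x).exists
  choose f' hf₂ hf₂' using fun x => (hT x).exists
  refine Finset.prod_bij' (fun r _ => f r) (fun r _ => f' r) (fun r _ => hf r) (fun r _ => hf₂ r)
    (fun r hr => ?_) (fun r hr => ?_) (fun r _ => hg _ _ (hf' r).symm)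
  · exact hT.eq (hf₂ _) hr ((hf₂' _).trans (hf' _))
  · exact hT'.eq (hf _) hr ((hf' _).trans (hf₂' _))

end CycleProd

section Cut

variable {α : Type*} {σ : Equiv.Perm α} {x y : α}

lemma swap_mul_pow_apply [DecidableEq α] {z : α} {k : ℕ}
    (h : ∀ t < k, (σ ^ (t + 1)) z ≠ x ∧ (σ ^ (t + 1)) z ≠ y) :
    ((Equiv.swap x y * σ) ^ k) z = (σ ^ k) z := by
  induction k with
  | zero => rfl
  | succ k ih =>
    rw [pow_succ', Equiv.Perm.mul_apply, ih fun t ht => h t (ht.trans k.lt_succ_self),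
      Equiv.Perm.mul_apply, ← Equiv.Perm.mul_apply σ, ← pow_succ']
    exact Equiv.swap_apply_of_ne_of_ne (h k k.lt_succ_self).1 (h k k.lt_succ_self).2

lemma swap_mul_pow_apply_of_not_sameCycle [DecidableEq α] (hxy : σ.SameCycle x y) {z : α}
    (hz : ¬σ.SameCycle x z) (k : ℕ) : ((Equiv.swap x y * σ) ^ k) z = (σ ^ k) z :=
  swap_mul_pow_apply fun t _ => ⟨fun h => hz (Equiv.Perm.SameCycle.symm ⟨(t + 1 : ℕ), h⟩),
    fun h => hz (hxy.trans (Equiv.Perm.SameCycle.symm ⟨(t + 1 : ℕ), h⟩))⟩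

lemma minimalPeriod_swap_mul_of_not_sameCycle [DecidableEq α] (hxy : σ.SameCycle x y)
    {z : α} (hz : ¬σ.SameCycle x z) :
    Function.minimalPeriod (Equiv.swap x y * σ) z = Function.minimalPeriod σ z := by
  refine Nat.dvd_antisymm ?_ ?_ <;> rw [← Function.isPeriodicPt_iff_minimalPeriod_dvd,
    Function.IsPeriodicPt, Function.IsFixedPt, Equiv.Perm.iterate_eq_pow]
  · rw [swap_mul_pow_apply_of_not_sameCycle hxy hz, pow_minimalPeriod_apply]
  · rw [← swap_mul_pow_apply_of_not_sameCycle hxy hz, pow_minimalPeriod_apply]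

lemma sameCycle_swap_mul_of_not_sameCycle [Finite α] [DecidableEq α] (hxy : σ.SameCycle x y)
    {z w : α} (hz : ¬σ.SameCycle x z) : (Equiv.swap x y * σ).SameCycle z w ↔ σ.SameCycle z w := by
  constructor <;> intro h <;> obtain ⟨t, rfl⟩ := h.exists_nat_pow_eq
  · rw [swap_mul_pow_apply_of_not_sameCycle hxy hz]
    exact ⟨t, rfl⟩
  · rw [← swap_mul_pow_apply_of_not_sameCycle hxy hz]
    exact ⟨t, rfl⟩

/-- Multiplying by a transposition cuts an arc off a cycle. -/
lemma swap_mul_arc [Finite α] [DecidableEq α] {a : ℕ} (ha : 0 < a) (hper : (σ ^ a) x = y)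
    (h : ∀ t < a, 0 < t → (σ ^ t) x ≠ x ∧ (σ ^ t) x ≠ y) :
    (∀ t < a, ((Equiv.swap x y * σ) ^ t) x = (σ ^ t) x) ∧
      Function.minimalPeriod (Equiv.swap x y * σ) x = a := by
  have h1 : ∀ t < a, ((Equiv.swap x y * σ) ^ t) x = (σ ^ t) x := fun t ht =>
    swap_mul_pow_apply fun s hs => h (s + 1) (by omega) s.succ_pos
  obtain ⟨b, rfl⟩ := Nat.exists_eq_succ_of_ne_zero ha.ne'
  refine ⟨h1, ?_⟩
  have hfix : ((Equiv.swap x y * σ) ^ (b + 1)) x = x := by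
    rw [pow_succ', Equiv.Perm.mul_apply, h1 b b.lt_succ_self, Equiv.Perm.mul_apply,
      ← Equiv.Perm.mul_apply σ, ← pow_succ', hper, Equiv.swap_apply_right]
  have hdvd : Function.minimalPeriod (Equiv.swap x y * σ) x ∣ b + 1 := by
    rw [← Function.isPeriodicPt_iff_minimalPeriod_dvd, Function.IsPeriodicPt, Function.IsFixedPt,
      Equiv.Perm.iterate_eq_pow, hfix]
  refine (Nat.le_of_dvd b.succ_pos hdvd).antisymm ?_
  by_contra! hlt
  refine (h _ hlt (minimalPeriod_pos _ x)).1 ?_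
  rw [← h1 _ hlt, pow_minimalPeriod_apply]

lemma exists_arcs [Finite α] (hxy : σ.SameCycle x y) (hne : x ≠ y) :
    ∃ a b : ℕ, Function.minimalPeriod σ x = (a + 1) + (b + 1) ∧ (σ ^ (a + 1)) x = y ∧
      (σ ^ (b + 1)) y = x ∧ ∀ s t, s < t → t < (a + 1) + (b + 1) → (σ ^ s) x ≠ (σ ^ t) x := by
  obtain ⟨c, hc, hcy⟩ := exists_lt_minimalPeriod hxy
  obtain ⟨a, rfl⟩ := Nat.exists_eq_succ_of_ne_zero (n := c) (by rintro rfl; exact hne hcy)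
  obtain ⟨b, hb⟩ := Nat.exists_eq_add_of_lt hc
  have hb' : Function.minimalPeriod σ x = (a + 1) + (b + 1) := by omega
  refine ⟨a, b, hb', hcy, ?_, fun s t hst ht => pow_apply_ne hst (hb' ▸ ht)⟩
  rw [← hcy, ← Equiv.Perm.mul_apply, ← pow_add, Nat.succ_eq_add_one, add_comm (b + 1), ← hb',
    pow_minimalPeriod_apply]

/-- Multiplying by a transposition joins two different cycles. -/
lemma sameCycle_swap_mul [Finite α] [DecidableEq α] (hxy : ¬σ.SameCycle x y) :
    (Equiv.swap x y * σ).SameCycle x y := by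
  obtain ⟨k, hk⟩ := Nat.exists_eq_succ_of_ne_zero (minimalPeriod_pos σ x).ne'
  refine ⟨(k + 1 : ℕ), ?_⟩
  have h : ((Equiv.swap x y * σ) ^ k) x = (σ ^ k) x := swap_mul_pow_apply fun t ht =>
    ⟨(pow_apply_ne (s := 0) t.succ_pos (by omega)).symm, fun h => hxy ⟨(t + 1 : ℕ), h⟩⟩
  rw [zpow_natCast, pow_succ', Equiv.Perm.mul_apply, h, Equiv.Perm.mul_apply,
    ← Equiv.Perm.mul_apply σ, ← pow_succ', ← Nat.succ_eq_add_one, ← hk, pow_minimalPeriod_apply,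
    Equiv.swap_apply_left]

/-- How the products along the cycles change when a cycle is cut by a transposition. -/
lemma exists_prod_cycleProd_eq [Fintype α] [DecidableEq α] {R M : Type*} [Monoid R] [CommMonoid M]
    {s : R → M} (hs : ∀ a b, s (a * b) = s (b * a)) (hxy : σ.SameCycle x y) (hne : x ≠ y)
    {T T' : Finset α} (hT : IsTransversal σ T) (hT' : IsTransversal (Equiv.swap x y * σ) T')
    (F : α → R) : ∃ (c : M) (A B : R), ∀ F' : α → R, (∀ z, z ≠ x → z ≠ y → F' z = F z) →
      ∏ r ∈ T, s (cycleProd σ F' r) = c * s (F' x * A * (F' y * B)) ∧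
      ∏ r ∈ T', s (cycleProd (Equiv.swap x y * σ) F' r) = c * (s (F' x * A) * s (F' y * B)) := by
  obtain ⟨a, b, hper, hay, hbx, hinj⟩ := exists_arcs hxy hne
  have hbpow : ∀ t, (σ ^ t) y = (σ ^ (t + (a + 1))) x := fun t => by
    rw [pow_add, Equiv.Perm.mul_apply, hay]
  have hx0 : ∀ t, 0 < t → t < (a + 1) + (b + 1) → (σ ^ t) x ≠ x := fun t ht ht' =>
    (hinj 0 t ht ht').symm
  obtain ⟨hxpow, hxper⟩ := swap_mul_arc (σ := σ) (x := x) (y := y) a.succ_pos hay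
    fun t ht ht0 => ⟨hx0 t ht0 (by omega), fun h => hinj t (a + 1) ht (by omega) (h.trans hay.symm)⟩
  obtain ⟨hypow, hyper⟩ := swap_mul_arc (σ := σ) (x := y) (y := x) b.succ_pos hbx
    fun t ht ht0 => by
      rw [hbpow]
      exact ⟨fun h => hinj (a + 1) (t + (a + 1)) (by omega) (by omega) (hay.trans h.symm),
        hx0 _ (by omega) (by omega)⟩
  rw [Equiv.swap_comm] at hypow hyper
  set ρ := Equiv.swap x y * σ with hρ
  obtain ⟨T₀, hT₀, hxT₀⟩ := exists_isTransversal σ x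
  have hnot : ∀ r ∈ T₀.erase x, ¬σ.SameCycle x r := fun r hr h =>
    (Finset.ne_of_mem_erase hr) (hT₀.eq (Finset.mem_of_mem_erase hr) hxT₀ h.symm)
  have hxyρ : ¬ρ.SameCycle x y := fun h => by
    obtain ⟨t, ht, hty⟩ := exists_lt_minimalPeriod h
    rw [hxper] at ht
    rw [hxpow t ht, ← hay] at hty
    exact hinj t (a + 1) ht (by omega) hty
  have hcycle : ∀ z, σ.SameCycle x z → ρ.SameCycle x z ∨ ρ.SameCycle y z := by
    intro z hz
    obtain ⟨t, ht, rfl⟩ := exists_lt_minimalPeriod hz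
    rw [hper] at ht
    rcases lt_or_ge t (a + 1) with h | h
    · exact Or.inl ⟨t, by rw [zpow_natCast, hxpow t h]⟩
    · obtain ⟨u, rfl⟩ := Nat.exists_eq_add_of_le' h
      exact Or.inr ⟨u, by rw [zpow_natCast, hypow u (by omega), hbpow]⟩
  have hyT₀ : y ∉ T₀.erase x := fun h => hnot y h hxy
  have hT₁ : IsTransversal ρ (insert x (insert y (T₀.erase x))) := by
    intro z
    by_cases hz : σ.SameCycle x z
    · have hout : ∀ r ∈ T₀.erase x, ¬ρ.SameCycle r z := fun r hr h => hnot r hr (hz.trans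
        ((sameCycle_swap_mul_of_not_sameCycle hxy (hnot r hr)).1 h).symm)
      rcases hcycle z hz with h | h
      · refine ⟨x, ⟨Finset.mem_insert_self _ _, h⟩, fun r hr => ?_⟩
        rcases Finset.mem_insert.1 hr.1 with h' | h'
        · exact h'
        rcases Finset.mem_insert.1 h' with rfl | h'
        · exact absurd (h.trans hr.2.symm) hxyρ
        · exact absurd hr.2 (hout r h')
      · refine ⟨y, ⟨Finset.mem_insert_of_mem (Finset.mem_insert_self _ _), h⟩, fun r hr => ?_⟩
        rcases Finset.mem_insert.1 hr.1 with rfl | h'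
        · exact absurd (hr.2.trans h.symm) hxyρ
        rcases Finset.mem_insert.1 h' with h' | h'
        · exact h'
        · exact absurd hr.2 (hout r h')
    · have hiff : ∀ r, ρ.SameCycle r z ↔ σ.SameCycle r z := fun r => by
        rw [Equiv.Perm.sameCycle_comm, sameCycle_swap_mul_of_not_sameCycle hxy hz,
          Equiv.Perm.sameCycle_comm]
      obtain ⟨r, ⟨hr, hrz⟩, huniq⟩ := hT₀ z
      refine ⟨r, ⟨?_, (hiff r).2 hrz⟩, fun r' hr' => ?_⟩
      · refine Finset.mem_insert_of_mem (Finset.mem_insert_of_mem (Finset.mem_erase.2 ⟨?_, hr⟩))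
        rintro rfl
        exact hz hrz
      · have hz' := (hiff r').1 hr'.2
        rcases Finset.mem_insert.1 hr'.1 with rfl | h'
        · exact absurd hz' hz
        rcases Finset.mem_insert.1 h' with rfl | h'
        · exact absurd (hxy.trans hz') hz
        · exact huniq r' ⟨Finset.mem_of_mem_erase h', hz'⟩
  refine ⟨∏ r ∈ T₀.erase x, s (cycleProd σ F r), segProd σ F (σ x) a, segProd σ F (σ y) b,
    fun F' hF' => ?_⟩
  have hsegx : segProd σ F' x (a + 1) = F' x * segProd σ F (σ x) a := by
    rw [add_comm, segProd_add, segProd_one, pow_one]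
    congr 1
    refine segProd_congr fun t ht => hF' _ ?_ ?_ <;>
      rw [← Equiv.Perm.mul_apply, ← pow_succ]
    · exact hx0 _ t.succ_pos (by omega)
    · rw [← hay]
      exact hinj _ _ (by omega) (by omega)
  have hsegy : segProd σ F' y (b + 1) = F' y * segProd σ F (σ y) b := by
    rw [add_comm, segProd_add, segProd_one, pow_one]
    congr 1
    refine segProd_congr fun t ht => hF' _ ?_ ?_ <;>
      rw [← Equiv.Perm.mul_apply, ← pow_succ, hbpow]
    · exact hx0 _ (by omega) (by omega)
    · intro h
      exact hinj (a + 1) (t + 1 + (a + 1)) (by omega) (by omega) (hay.trans h.symm)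
  have hrest : ∀ r ∈ T₀.erase x, cycleProd σ F' r = cycleProd σ F r := fun r hr =>
    segProd_congr fun t _ => hF' _ (fun h => hnot r hr (Equiv.Perm.SameCycle.symm ⟨t, h⟩))
      (fun h => hnot r hr (hxy.trans (Equiv.Perm.SameCycle.symm ⟨t, h⟩)))
  have hrest' : ∀ r ∈ T₀.erase x, cycleProd ρ F' r = cycleProd σ F r := fun r hr => by
    rw [← hrest r hr, cycleProd_eq_segProd, cycleProd_eq_segProd,
      minimalPeriod_swap_mul_of_not_sameCycle hxy (hnot r hr)]
    exact segProd_congr fun t _ => by rw [swap_mul_pow_apply_of_not_sameCycle hxy (hnot r hr)]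
  constructor
  · rw [prod_eq_of_isTransversal hT hT₀ fun _ _ => apply_cycleProd_of_sameCycle hs F',
      ← Finset.mul_prod_erase T₀ _ hxT₀, mul_comm,
      Finset.prod_congr rfl fun r hr => by rw [hrest r hr],
      cycleProd_eq_segProd, hper, segProd_add, hay, hsegx, hsegy]
  · rw [prod_eq_of_isTransversal hT' hT₁ fun _ _ => apply_cycleProd_of_sameCycle hs F',
      Finset.prod_insert (by simp [hne]), Finset.prod_insert hyT₀, ← mul_assoc, mul_comm,
      Finset.prod_congr rfl fun r hr => by rw [hrest' r hr],
      cycleProd_eq_segProd, cycleProd_eq_segProd, hxper, hyper,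
      segProd_congr (σ' := σ) (F' := F') fun t ht => by rw [hxpow t ht],
      segProd_congr (σ := ρ) (σ' := σ) (F := F') (F' := F') fun t ht => by rw [hypow t ht],
      hsegx, hsegy]

end Cut

/-! ### Integration over the edges -/

section Edges

variable {N : ℕ} (μ : Measure (UN N)) [IsProbabilityMeasure μ] [μ.IsHaarMeasure]

lemma integral_edge {α : Type*} [Fintype α] [DecidableEq α] {l : Fin N → ℕ} (hl : Antitone l)
    {σ : Equiv.Perm α} {x y : α} (hne : x ≠ y) {T T' : Finset α} (hT : IsTransversal σ T)
    (hT' : IsTransversal (Equiv.swap x y * σ) T') (F : α → Matrix (Fin N) (Fin N) ℂ)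
    (D : UN N → α → Matrix (Fin N) (Fin N) ℂ) (hDx : ∀ U, D U x = U.1 * F x)
    (hDy : ∀ U, D U y = U.1ᴴ * F y) (hD : ∀ U z, z ≠ x → z ≠ y → D U z = F z) :
    schur l 1 * ∫ U, ∏ r ∈ T, schur l (cycleProd σ (D U) r) ∂μ =
      ∏ r ∈ T', schur l (cycleProd (Equiv.swap x y * σ) F r) := by
  by_cases hxy : σ.SameCycle x y
  · obtain ⟨c, A, B, h⟩ := exists_prod_cycleProd_eq (schur_mul_comm l) hxy hne hT hT' F
    have h1 : ∀ U : UN N, ∏ r ∈ T, schur l (cycleProd σ (D U) r) =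
        c * schur l (F y * B * (U.1 * (F x * A) * U.1ᴴ)) := fun U => by
      rw [(h (D U) (hD U)).1, hDx, hDy, ← schur_mul_comm l (U.1 * (F x * A) * U.1ᴴ)]
      simp only [Matrix.mul_assoc]
    simp only [h1]
    rw [integral_const_mul, mul_left_comm, schur_one_mul_integral_conj μ hl,
      (h F fun _ _ _ => rfl).2, mul_comm (schur l (F y * B))]
  · have hxy' : (Equiv.swap x y * σ).SameCycle x y := sameCycle_swap_mul hxy
    have hσ : Equiv.swap x y * (Equiv.swap x y * σ) = σ := by
      rw [← mul_assoc, Equiv.swap_mul_self, one_mul]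
    obtain ⟨c, A, B, h⟩ := exists_prod_cycleProd_eq (schur_mul_comm l) hxy' hne hT' (hσ.symm ▸ hT) F
    rw [hσ] at h
    have h1 : ∀ U : UN N, ∏ r ∈ T, schur l (cycleProd σ (D U) r) =
        c * (schur l (F x * A * U.1) * schur l (U.1ᴴ * (F y * B))) := fun U => by
      rw [(h (D U) (hD U)).2, hDx, hDy, Matrix.mul_assoc U.1, schur_mul_comm l U.1,
        Matrix.mul_assoc U.1ᴴ]
    simp only [h1]
    rw [integral_const_mul, mul_left_comm, schur_one_mul_integral_mul μ hl,
      (h F fun _ _ _ => rfl).1]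

lemma integral_pi_update {n : ℕ} {G : (Fin n → UN N) → ℂ} (hG : Continuous G) (i : Fin n) :
    ∫ X, G X ∂(Measure.pi fun _ => μ) =
      ∫ X, ∫ U, G (Function.update X i U) ∂μ ∂(Measure.pi fun _ => μ) := by
  have h1 : ∀ U : UN N, ∫ X, G (Pi.mulSingle i U * X) ∂(Measure.pi fun _ => μ) =
      ∫ X, G X ∂(Measure.pi fun _ => μ) := fun U => integral_mul_left_eq_self G _
  have h2 : ∀ (U : UN N) (X : Fin n → UN N),
      Pi.mulSingle i U * X = Function.update X i (U * X i) := by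
    intro U X
    funext j
    by_cases hj : j = i
    · subst hj; simp
    · simp [hj]
  calc ∫ X, G X ∂(Measure.pi fun _ => μ)
      = ∫ U, ∫ X, G (Pi.mulSingle i U * X) ∂(Measure.pi fun _ => μ) ∂μ := by
        simp only [h1, integral_const, probReal_univ, one_smul]
    _ = ∫ X, ∫ U, G (Pi.mulSingle i U * X) ∂μ ∂(Measure.pi fun _ => μ) := by
        refine integral_integral_swap (integrable_of_continuous _ (hG.comp ?_))
        have hc : Continuous fun U : UN N => (Pi.mulSingle i U : Fin n → UN N) := by
          simp only [Pi.mulSingle]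
          fun_prop
        exact (hc.comp continuous_fst).mul continuous_snd
    _ = ∫ X, ∫ U, G (Function.update X i U) ∂μ ∂(Measure.pi fun _ => μ) := by
        refine integral_congr_ae (.of_forall fun X => ?_)
        simp only [h2]
        exact integral_mul_right_eq_self (fun U => G (Function.update X i U)) (X i)

/-- Dressing of the corner matrices on the edges in `S`. -/
def dressOn {n : ℕ} (S : Finset (Fin n)) (C : Fin n × Bool → Matrix (Fin N) (Fin N) ℂ)
    (X : Fin n → Matrix (Fin N) (Fin N) ℂ) (h : Fin n × Bool) : Matrix (Fin N) (Fin N) ℂ :=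
  if h.1 ∈ S then dress C X h else C h

/-- The involution exchanging the two sides of the edges in `S`. -/
def tauOn {n : ℕ} (S : Finset (Fin n)) : Equiv.Perm (Fin n × Bool) :=
  Function.Involutive.toPerm (fun h => if h.1 ∈ S then (h.1, !h.2) else h) fun h => by
    by_cases hS : h.1 ∈ S <;> simp [hS]

lemma tauOn_apply {n : ℕ} (S : Finset (Fin n)) (h : Fin n × Bool) :
    tauOn S h = if h.1 ∈ S then (h.1, !h.2) else h := rfl

lemma tauOn_insert {n : ℕ} {S : Finset (Fin n)} {i : Fin n} (hi : i ∉ S) :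
    tauOn S * Equiv.swap (i, true) (i, false) = tauOn (insert i S) := by
  ext1 ⟨j, b⟩
  rw [Equiv.Perm.mul_apply]
  by_cases hj : j = i
  · subst hj
    cases b
    · rw [Equiv.swap_apply_right]
      simp [tauOn_apply, hi]
    · rw [Equiv.swap_apply_left]
      simp [tauOn_apply, hi]
  · rw [Equiv.swap_apply_of_ne_of_ne (by simp [hj]) (by simp [hj])]
    simp [tauOn_apply, hj]

lemma tauOn_univ (n : ℕ) : tauOn (Finset.univ : Finset (Fin n)) = tauPerm n := by
  ext1 ⟨j, b⟩
  simp [tauOn_apply, tauPerm]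

lemma continuous_prod_schur_cycleProd {E : Type*} [TopologicalSpace E] {α : Type*}
    (l : Fin N → ℕ) (σ : Equiv.Perm α) (T : Finset α) {D : E → α → Matrix (Fin N) (Fin N) ℂ}
    (hD : ∀ x, Continuous fun e => D e x) :
    Continuous fun e => ∏ r ∈ T, schur l (cycleProd σ (D e) r) := by
  refine continuous_finsetProd _ fun r _ => (continuous_schur l).comp ?_
  unfold cycleProd
  exact continuous_list_prod _ fun t _ => hD _

/-- Integrating out the edges in `S`. -/
lemma integral_edges {n : ℕ} {l : Fin N → ℕ} (hl : Antitone l) (S : Finset (Fin n))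
    (C : Fin n × Bool → Matrix (Fin N) (Fin N) ℂ) (σ : Equiv.Perm (Fin n × Bool))
    {T T' : Finset (Fin n × Bool)} (hT : IsTransversal σ T)
    (hT' : IsTransversal (tauOn S * σ) T') :
    schur l 1 ^ S.card * ∫ X : Fin n → UN N,
        ∏ r ∈ T, schur l (cycleProd σ (dressOn S C fun i => (X i).1) r)
        ∂(Measure.pi fun _ => μ) =
      ∏ r ∈ T', schur l (cycleProd (tauOn S * σ) C r) := by
  induction S using Finset.induction_on generalizing σ T with
  | empty =>
    have h1 : tauOn (∅ : Finset (Fin n)) = 1 := by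
      ext1 h
      simp [tauOn_apply]
    rw [h1, one_mul] at hT' ⊢
    have h2 : ∀ X, dressOn ∅ C X = C := fun X => by
      funext h
      simp [dressOn]
    simp only [h2, integral_const, probReal_univ, one_smul, Finset.card_empty, pow_zero, one_mul]
    exact prod_eq_of_isTransversal hT hT' fun _ _ =>
      apply_cycleProd_of_sameCycle (schur_mul_comm l) C
  | insert i S hi ih =>
    have hcont : Continuous fun X : Fin n → UN N =>
        ∏ r ∈ T, schur l (cycleProd σ (dressOn (insert i S) C fun i => (X i).1) r) := by
      refine continuous_prod_schur_cycleProd l σ T fun h => ?_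
      simp only [dressOn, dress]
      split_ifs <;> fun_prop
    obtain ⟨T₁, hT₁, -⟩ := exists_isTransversal (Equiv.swap (i, true) (i, false) * σ) (i, true)
    rw [← tauOn_insert hi, mul_assoc] at hT' ⊢
    rw [integral_pi_update μ hcont i, Finset.card_insert_of_notMem hi, pow_succ, mul_assoc,
      ← integral_const_mul, ← ih _ hT₁ hT']
    congr 1
    refine integral_congr_ae (.of_forall fun X => ?_)
    refine integral_edge μ hl (by simp) hT hT₁ (dressOn S C fun i => (X i).1) _ ?_ ?_ ?_
    · intro U
      simp [dressOn, dress, hi]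
    · intro U
      simp [dressOn, dress, hi]
    · rintro U ⟨j, b⟩ hj hj'
      have hji : j ≠ i := by
        rintro rfl
        cases b
        exacts [hj' rfl, hj rfl]
      simp [dressOn, dress, hji]

end Edges

/-! ### The Cauchy–Littlewood coefficients -/

section Cauchy

open MvPolynomial

lemma derivation_prod {ι R A : Type*} [DecidableEq ι] [CommSemiring R] [CommSemiring A]
    [Algebra R A] (D : Derivation R A A) (s : Finset ι) (f : ι → A) :
    D (∏ i ∈ s, f i) = ∑ i ∈ s, (∏ j ∈ s.erase i, f j) * D (f i) := by
  induction s using Finset.induction_on with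
  | empty => simp
  | insert a s ha ih =>
    rw [Finset.prod_insert ha, D.leibniz, ih, Finset.sum_insert ha, Finset.erase_insert ha,
      smul_eq_mul, smul_eq_mul, add_comm, Finset.mul_sum]
    refine congrArg₂ (· + ·) rfl ?_
    refine Finset.sum_congr rfl fun i hi => ?_
    have hia : a ≠ i := fun h => ha (h ▸ hi)
    rw [Finset.erase_insert_of_ne hia, Finset.prod_insert (by simp [ha]), mul_assoc]

/-- The complete homogeneous symmetric functions in power sums rescaled by `c`. -/
def hScaled (c : ℂ) (k : ℕ) : MvPolynomial ℕ+ ℂ := aeval (fun m : ℕ+ => C c * X m) (hPow k)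

lemma hScaled_zero (c : ℂ) : hScaled c 0 = 1 := by
  rw [hScaled, hPow, map_one]

lemma hScaled_newton (c : ℂ) (k : ℕ) :
    (k : MvPolynomial ℕ+ ℂ) * hScaled c k =
      ∑ m ∈ Finset.range k, C c * X (Nat.succPNat m) * hScaled c (k - (m + 1)) := by
  cases k with
  | zero => simp
  | succ k =>
    rw [hScaled, hPow, map_mul, map_sum, algHom_C, ← mul_assoc]
    have h : ((k + 1 : ℕ) : MvPolynomial ℕ+ ℂ) *
        algebraMap ℂ (MvPolynomial ℕ+ ℂ) (((k : ℂ) + 1)⁻¹) = 1 := by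
      rw [← map_natCast (algebraMap ℂ (MvPolynomial ℕ+ ℂ)), ← map_mul, Nat.cast_succ,
        mul_inv_cancel₀ (Nat.cast_add_one_ne_zero k), map_one]
    rw [h, one_mul]
    refine Finset.sum_congr rfl fun m _ => ?_
    rw [map_mul, Nat.add_sub_add_right]
    exact congrArg (· * _) (aeval_X _ (Nat.succPNat m))

lemma pderiv_hScaled (c : ℂ) (j : ℕ+) (k : ℕ) :
    pderiv j (hScaled c k) = if (j : ℕ) ≤ k then C (c / j) * hScaled c (k - j) else 0 := by
  induction k using Nat.strong_induction_on with
  | _ k ih =>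
    rcases Nat.eq_zero_or_pos k with rfl | hk
    · rw [hScaled_zero, pderiv_one, if_neg (by simp)]
    have hk0 : (k : MvPolynomial ℕ+ ℂ) ≠ 0 := by exact_mod_cast hk.ne'
    apply mul_left_cancel₀ hk0
    have h1 : (k : MvPolynomial ℕ+ ℂ) * pderiv j (hScaled c k) =
        pderiv j ((k : MvPolynomial ℕ+ ℂ) * hScaled c k) := by
      rw [← map_natCast (C : ℂ →+* MvPolynomial ℕ+ ℂ), pderiv_C_mul]
    rw [h1, hScaled_newton, map_sum]
    have h2 : ∀ m ∈ Finset.range k,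
        pderiv j (C c * X (Nat.succPNat m) * hScaled c (k - (m + 1))) =
          (if m + 1 = j then C c * hScaled c (k - j) else 0) +
            if m < k - j then C (c / j) * (C c * X (Nat.succPNat m) *
              hScaled c (k - j - (m + 1))) else 0 := by
      intro m hm
      have hm' := Finset.mem_range.1 hm
      rw [pderiv_mul, pderiv_C_mul, ih _ (by omega), pderiv_X]
      have hj := j.pos
      congr 1
      · by_cases hmj : m + 1 = j
        · have : j = Nat.succPNat m := PNat.eq (by simp [← hmj])
          rw [if_pos hmj, ← hmj, this, Pi.single_eq_same, mul_one]
        · rw [if_neg hmj, Pi.single_eq_of_ne, mul_zero, zero_mul]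
          rintro rfl
          exact hmj (by simp)
      · by_cases hmj : m < k - j
        · rw [if_pos hmj, if_pos (by omega), Nat.sub_right_comm]
          ring
        · rw [if_neg hmj, if_neg (by omega), mul_zero]
    rw [Finset.sum_congr rfl h2, Finset.sum_add_distrib, ← Finset.sum_filter,
      ← Finset.sum_filter (fun m => m < k - (j : ℕ))]
    by_cases hjk : (j : ℕ) ≤ k
    · have hj := j.pos
      have e1 : (Finset.range k).filter (fun m => m + 1 = (j : ℕ)) = {(j : ℕ) - 1} := by
        ext m; simp only [Finset.mem_filter, Finset.mem_range, Finset.mem_singleton]; omega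
      have e2 : (Finset.range k).filter (fun m => m < k - (j : ℕ)) = Finset.range (k - j) := by
        ext m; simp only [Finset.mem_filter, Finset.mem_range]; omega
      rw [e1, e2, Finset.sum_singleton, ← Finset.mul_sum, ← hScaled_newton, if_pos hjk]
      have h3 : (C c : MvPolynomial ℕ+ ℂ) = C (c / j) * ((j : ℕ) : MvPolynomial ℕ+ ℂ) := by
        rw [← map_natCast (C : ℂ →+* MvPolynomial ℕ+ ℂ), ← map_mul, div_mul_cancel₀]
        exact_mod_cast j.ne_zero
      rw [h3, Nat.cast_sub hjk]
      ring
    · rw [if_neg hjk, mul_zero, Finset.filter_false_of_mem, Finset.filter_false_of_mem]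
      · simp
      · intro m _; omega
      · intro m hm
        have := Finset.mem_range.1 hm
        omega

lemma constantCoeff_hScaled (c : ℂ) {k : ℕ} (hk : k ≠ 0) : constantCoeff (hScaled c k) = 0 := by
  have h := congrArg constantCoeff (hScaled_newton c k)
  rw [map_mul, map_natCast, map_sum, Finset.sum_eq_zero fun m _ => by simp] at h
  exact (mul_eq_zero.1 h).resolve_left (Nat.cast_ne_zero.2 hk)

/-- The coefficient of `∏ m, p_m ^ d m` in `exp (c ∑ m, p_m (∑ i, y_i ^ m) / m)`. -/
def expCoeff (N : ℕ) (c : ℂ) (d : ℕ+ →₀ ℕ) : MvPolynomial (Fin N) ℂ :=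
  d.prod fun m k => (C (c / m) * ∑ i, X i ^ (m : ℕ)) ^ k * C ((k.factorial : ℂ)⁻¹)

lemma expCoeff_zero (N : ℕ) (c : ℂ) : expCoeff N c 0 = 1 := Finsupp.prod_zero_index

lemma expCoeff_add_single (N : ℕ) (c : ℂ) (d : ℕ+ →₀ ℕ) (m : ℕ+) :
    C ((d m : ℂ) + 1) * expCoeff N c (d + Finsupp.single m 1) =
      C (c / m) * ∑ i, X i ^ (m : ℕ) * expCoeff N c d := by
  have h0 : ∀ m : ℕ+, (C (c / m) * ∑ i : Fin N, X i ^ (m : ℕ)) ^ 0 *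
      C (((0 : ℕ).factorial : ℂ)⁻¹) = 1 := fun m => by simp
  have he : (d + Finsupp.single m 1).erase m = d.erase m := by
    ext j
    by_cases hj : j = m
    · subst hj; simp
    · simp [hj]
  rw [expCoeff, expCoeff, ← Finsupp.mul_prod_erase' d m _ h0,
    ← Finsupp.mul_prod_erase' (d + Finsupp.single m 1) m _ h0, he, ← Finset.sum_mul]
  have h1 : (d + Finsupp.single m 1 : ℕ+ →₀ ℕ) m = d m + 1 := by simp
  have h2 : ((d m : ℂ) + 1) * (((d m + 1).factorial : ℕ) : ℂ)⁻¹ = ((d m).factorial : ℂ)⁻¹ := by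
    rw [Nat.factorial_succ, Nat.cast_mul, mul_inv, Nat.cast_succ,
      mul_inv_cancel_left₀ (Nat.cast_add_one_ne_zero _)]
  rw [h1, ← h2, C_mul, pow_succ]
  ring

lemma coeff_expCoeff {N : ℕ} (c : ℂ) (d : ℕ+ →₀ ℕ) (β : Fin N →₀ ℕ) :
    coeff β (expCoeff N c d) = coeff d (∏ i, hScaled c (β i)) := by
  suffices H : ∀ f d : ℕ+ →₀ ℕ,
      (∀ β, coeff β (expCoeff N c d) = coeff d (∏ i, hScaled c (β i))) →
      ∀ β, coeff β (expCoeff N c (d + f)) = coeff (d + f) (∏ i, hScaled c (β i)) by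
    have := H d 0 (fun β => ?_) β
    · rwa [zero_add] at this
    rw [expCoeff_zero, coeff_one, ← constantCoeff_eq, map_prod]
    split_ifs with hβ
    · subst hβ
      simp [hScaled_zero]
    · obtain ⟨i, hi⟩ := Finsupp.ne_iff.1 (Ne.symm hβ)
      exact (Finset.prod_eq_zero (Finset.mem_univ i) (constantCoeff_hScaled c hi)).symm
  intro f
  induction f using Finsupp.induction_linear with
  | zero => intro d hd; simpa using hd
  | add f g hf hg =>
    intro d hd
    rw [← add_assoc]
    exact hg _ (hf _ hd)
  | single m b =>
    induction b with
    | zero => intro d hd; simpa using hd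
    | succ b ih =>
      intro d hd β
      replace hd := ih d hd
      rw [Finsupp.single_add, ← add_assoc]
      generalize d + Finsupp.single m b = e at hd ⊢
      have hne : ((e m : ℂ) + 1) ≠ 0 := Nat.cast_add_one_ne_zero _
      apply mul_left_cancel₀ hne
      rw [← coeff_C_mul, expCoeff_add_single, mul_comm _ (coeff _ (∏ i, hScaled c (β i))),
        ← coeff_pderiv, derivation_prod, coeff_C_mul, coeff_sum, coeff_sum, Finset.mul_sum]
      refine Finset.sum_congr rfl fun i _ => ?_
      rw [pderiv_hScaled, X_pow_eq_monomial, coeff_monomial_mul']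
      simp only [Finsupp.single_le_iff]
      split_ifs with hm
      · rw [one_mul, hd, mul_left_comm, coeff_C_mul,
          ← Finset.prod_erase_mul _ _ (Finset.mem_univ i)]
        congr 3
        · refine Finset.prod_congr rfl fun j hj => ?_
          simp [(Finset.ne_of_mem_erase hj).symm]
        · simp
      · simp

lemma aeval_hPowZ (c : ℂ) (k : ℤ) :
    aeval (fun m : ℕ+ => C c * X m) (hPowZ k) = if k < 0 then 0 else hScaled c k.toNat := by
  rw [hPowZ]
  split_ifs
  · rw [map_zero]
  · rfl

lemma schurCoeff_expCoeff {N : ℕ} (l : Fin N → ℕ) (d : ℕ+ →₀ ℕ) :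
    schurCoeff l (expCoeff N N d) = coeff d (schurNP N l) := by
  rw [schurCoeff, coeff_alternant_mul, schurNP, schurP, det_eq_sum_prod_row, map_sum, coeff_sum]
  refine Finset.sum_congr rfl fun τ _ => ?_
  rw [map_mul, map_prod, map_intCast, ← map_intCast (C : ℂ →+* MvPolynomial ℕ+ ℂ), coeff_C_mul]
  congr 1
  simp only [Matrix.of_apply, aeval_hPowZ, coeffZ]
  split_ifs with h
  · rw [coeff_expCoeff]
    congr 1
    refine Finset.prod_congr rfl fun i _ => ?_
    rw [if_neg (not_lt.2 (h i))]
    rfl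
  · obtain ⟨i, hi⟩ := not_forall.1 h
    rw [not_le] at hi
    rw [Finset.prod_eq_zero (Finset.mem_univ i), coeff_zero]
    exact if_pos hi

end Cauchy

/-! ### Expansion of the exponential in Schur polynomials -/

section Expansion

open MvPolynomial

/-- The coefficient of `∏ m, p_m ^ d m` in `exp (N ∑ m, p_m Tr (Z ^ m) / m)`. -/
def expTrace (N : ℕ) (d : ℕ+ →₀ ℕ) (Z : Matrix (Fin N) (Fin N) ℂ) : ℂ :=
  ∏ m ∈ d.support, ((N : ℂ) * (Z ^ (m : ℕ)).trace / ((m : ℕ) : ℂ)) ^ (d m) /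
    (Nat.factorial (d m) : ℂ)

lemma expTrace_mem_matPoly (N : ℕ) (d : ℕ+ →₀ ℕ) : expTrace N d ∈ matPoly N := by
  have h : expTrace N d = ∏ m ∈ d.support, ((Nat.factorial (d m) : ℂ)⁻¹ •
      (((N : ℂ) / ((m : ℕ) : ℂ)) •
        fun Z : Matrix (Fin N) (Fin N) ℂ => (Z ^ (m : ℕ)).trace) ^ (d m)) := by
    funext Z
    rw [Finset.prod_apply, expTrace]
    refine Finset.prod_congr rfl fun m _ => ?_
    simp only [Pi.smul_apply, Pi.pow_apply, smul_eq_mul]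
    rw [div_mul_eq_mul_div, div_eq_inv_mul]
  rw [h]
  exact prod_mem fun m _ => (matPoly N).smul_mem
    (pow_mem ((matPoly N).smul_mem (trace_pow_mem_matPoly m) _) _) _

lemma isClass_expTrace (N : ℕ) (d : ℕ+ →₀ ℕ) : IsClass (expTrace N d) := by
  intro V Z
  unfold expTrace
  refine Finset.prod_congr rfl fun m _ => ?_
  have h := isClass_trace_pow (N := N) (m : ℕ) V Z
  simp only at h
  rw [h]

lemma diagRes_eq_expCoeff {N : ℕ} (d : ℕ+ →₀ ℕ) {p : EntryPoly N} (hp : toFun N p = expTrace N d) :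
    diagRes N p = expCoeff N N d := by
  refine MvPolynomial.funext fun y => ?_
  rw [eval_diagRes, hp, expTrace, expCoeff, Finsupp.prod, map_prod]
  refine Finset.prod_congr rfl fun m _ => ?_
  simp only [map_mul, map_pow, map_sum, eval_C, eval_X, Matrix.diagonal_pow, Matrix.trace_diagonal,
    Pi.pow_apply]
  rw [div_mul_eq_mul_div, div_eq_mul_inv (_ ^ _)]

lemma exists_expTrace_eq_sum (N : ℕ) (d : ℕ+ →₀ ℕ) : ∃ s : Finset (PartitionN N),
    (∀ l ∉ s, coeff d (schurNP N l.1) = 0) ∧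
    ∀ Z, expTrace N d Z = ∑ l ∈ s, coeff d (schurNP N l.1) * schur l.1 Z := by
  obtain ⟨p, hp⟩ := expTrace_mem_matPoly N d
  replace hp : toFun N p = expTrace N d := hp
  let val : PartitionN N ↪ (Fin N → ℕ) := ⟨fun l => l.1, Subtype.val_injective⟩
  have hinj : Function.Injective fun l : PartitionN N => toExp (l.1 + stair N) := fun a b h =>
    Subtype.ext (add_right_cancel (toExp_injective h))
  let s : Finset (PartitionN N) :=
    (alternant (stair N) * diagRes N p).support.preimage _ hinj.injOn
  have hs : ∀ l ∉ s, coeff d (schurNP N l.1) = 0 := by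
    intro l hl
    rw [← schurCoeff_expCoeff, ← diagRes_eq_expCoeff d hp]
    simpa [s, schurCoeff] using hl
  refine ⟨s, hs, fun Z => ?_⟩
  have h := eq_sum_schurCoeff (p := p) (hp ▸ isClass_expTrace N d)
    (s.map val) ?_ ?_
  · rw [← hp, h, Finset.sum_map, Finset.sum_apply]
    refine Finset.sum_congr rfl fun l _ => ?_
    rw [diagRes_eq_expCoeff d hp, Pi.smul_apply, smul_eq_mul]
    exact congrArg (· * _) (schurCoeff_expCoeff l.1 d)
  · intro l hl
    obtain ⟨l', -, rfl⟩ := Finset.mem_map.1 hl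
    exact l'.2
  · intro l hl hls
    rw [diagRes_eq_expCoeff d hp, schurCoeff_expCoeff]
    exact hs ⟨l, hl⟩ fun h => hls (Finset.mem_map.2 ⟨_, h, rfl⟩)

end Expansion

/-! ### Reduction to the special unitary group -/

section Special

variable {N : ℕ}

lemma exists_scalar_mul_SUN (hN : 1 ≤ N) (U : UN N) :
    ∃ (z : ℂ) (V : SUN N), starRingEnd ℂ z * z = 1 ∧
      (U : Matrix (Fin N) (Fin N) ℂ) = z • ((V : UN N) : Matrix (Fin N) (Fin N) ℂ) := by
  obtain ⟨z, hz⟩ := IsAlgClosed.exists_pow_nat_eq (U : Matrix (Fin N) (Fin N) ℂ).det (n := N) hN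
  have hdet : ‖(U : Matrix (Fin N) (Fin N) ℂ).det‖ = 1 :=
    CStarRing.norm_of_mem_unitary (Matrix.det_of_mem_unitary U.2)
  have hz1 : ‖z‖ = 1 := by
    rw [← hz, norm_pow] at hdet
    exact (pow_eq_one_iff_of_nonneg (norm_nonneg z) (by omega)).1 hdet
  have hzz : starRingEnd ℂ z * z = 1 := by
    rw [mul_comm, Complex.mul_conj', hz1]
    norm_num
  have hz0 : z ≠ 0 := right_ne_zero_of_mul_eq_one hzz
  have hV : z⁻¹ • (U : Matrix (Fin N) (Fin N) ℂ) ∈ Matrix.unitaryGroup (Fin N) ℂ := by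
    rw [Matrix.mem_unitaryGroup_iff, star_smul, Matrix.smul_mul, Matrix.mul_smul,
      Matrix.mem_unitaryGroup_iff.1 U.2, smul_smul, RCLike.star_def, map_inv₀, ← mul_inv,
      mul_comm, hzz, inv_one, one_smul]
  refine ⟨z, ⟨⟨_, hV⟩, ?_⟩, hzz, ?_⟩
  · change (z⁻¹ • (U : Matrix (Fin N) (Fin N) ℂ)).det = 1
    rw [Matrix.det_smul, Fintype.card_fin, inv_pow, hz, inv_mul_cancel₀]
    rw [← hz]
    exact pow_ne_zero _ hz0
  · change _ = z • (z⁻¹ • (U : Matrix (Fin N) (Fin N) ℂ))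
    rw [smul_smul, mul_inv_cancel₀ hz0, one_smul]

lemma cycleProd_smul {α : Type*} (σ : Equiv.Perm α) (c : α → ℂ)
    (F : α → Matrix (Fin N) (Fin N) ℂ) (x : α) :
    cycleProd σ (fun y => c y • F y) x = cycleProd σ c x • cycleProd σ F x := by
  unfold cycleProd
  induction List.range (Function.minimalPeriod σ x) with
  | nil => simp
  | cons t L ih =>
    simp only [List.map_cons, List.prod_cons]
    rw [ih, Matrix.smul_mul, Matrix.mul_smul, smul_smul]

lemma cycleProd_eq_prod_univ {α M : Type*} [Fintype α] [DecidableEq α] [CommMonoid M]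
    {σ : Equiv.Perm α} (h : ∀ x y, σ.SameCycle x y) (c : α → M) (x : α) :
    cycleProd σ c x = ∏ y, c y := by
  have h1 : cycleProd σ c x = ∏ t ∈ Finset.range (Function.minimalPeriod σ x), c ((σ ^ t) x) := rfl
  rw [h1]
  refine Finset.prod_bij (fun t _ => (σ ^ t) x) (fun _ _ => Finset.mem_univ _) ?_ ?_ fun _ _ => rfl
  · intro s hs t ht hst
    rw [← Equiv.Perm.iterate_eq_pow, ← Equiv.Perm.iterate_eq_pow] at hst
    exact Function.iterate_injOn_Iio_minimalPeriod (Finset.mem_range.1 hs)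
      (Finset.mem_range.1 ht) hst
  · intro y _
    obtain ⟨t, ht, hty⟩ := exists_lt_minimalPeriod (h x y)
    exact ⟨t, Finset.mem_range.2 ht, hty⟩

lemma cycleProd_dress_smul {n : ℕ} {σ : Equiv.Perm (Fin n × Bool)} (h : ∀ x y, σ.SameCycle x y)
    (C : Fin n × Bool → Matrix (Fin N) (Fin N) ℂ) {z : Fin n → ℂ}
    (hz : ∀ i, starRingEnd ℂ (z i) * z i = 1) (X : Fin n → Matrix (Fin N) (Fin N) ℂ)
    (x : Fin n × Bool) :
    cycleProd σ (dress C fun i => z i • X i) x = cycleProd σ (dress C X) x := by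
  have h1 : (dress C fun i => z i • X i) = fun s : Fin n × Bool =>
      (if s.2 then z s.1 else starRingEnd ℂ (z s.1)) • dress C X s := by
    funext s
    unfold dress
    split_ifs <;> simp
  rw [h1, cycleProd_smul, cycleProd_eq_prod_univ h, Fintype.prod_prod_type]
  simp only [Fintype.prod_bool, if_true, Bool.false_eq_true, if_false, mul_comm (z _), hz,
    Finset.prod_const_one, one_smul]

lemma integral_SUN_eq_integral_UN (hN : 1 ≤ N) {n : ℕ} (μU : Measure (UN N)) [μU.IsHaarMeasure]
    [IsProbabilityMeasure μU] (μSU : Measure (SUN N)) [μSU.IsHaarMeasure]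
    [IsProbabilityMeasure μSU] {F : (Fin n → Matrix (Fin N) (Fin N) ℂ) → ℂ} (hF : Continuous F)
    (hinv : ∀ (z : Fin n → ℂ), (∀ i, starRingEnd ℂ (z i) * z i = 1) →
      ∀ X, F (fun i => z i • X i) = F X) :
    ∫ X : Fin n → SUN N, F (fun i => ((X i : UN N) : Matrix (Fin N) (Fin N) ℂ))
        ∂(Measure.pi fun _ => μSU) =
      ∫ X : Fin n → UN N, F (fun i => (X i : Matrix (Fin N) (Fin N) ℂ))
        ∂(Measure.pi fun _ => μU) := by
  let incl : (Fin n → SUN N) → Fin n → UN N := fun Y i => Y i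
  let G : (Fin n → UN N) → ℂ := fun X => F fun i => (X i : Matrix (Fin N) (Fin N) ℂ)
  have hG : Continuous G := hF.comp (by fun_prop)
  have hincl : Continuous incl := continuous_pi fun i =>
    continuous_subtype_val.comp (continuous_apply i)
  have h1 : ∀ U : Fin n → UN N, ∫ Y, G (U * incl Y) ∂(Measure.pi fun _ => μSU) =
      ∫ Y, G (incl Y) ∂(Measure.pi fun _ => μSU) := by
    intro U
    choose z V hz hV using fun i => exists_scalar_mul_SUN hN (U i)
    have h2 : ∀ Y, G (U * incl Y) = G (incl (V * Y)) := by
      intro Y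
      refine Eq.trans (congrArg F (funext fun i => ?_)) (hinv z hz _)
      simp only [incl, Pi.mul_apply, Submonoid.coe_mul, hV, Matrix.smul_mul]
      rfl
    simp only [h2]
    exact integral_mul_left_eq_self (fun Y => G (incl Y)) V
  calc ∫ Y, G (incl Y) ∂(Measure.pi fun _ => μSU)
      = ∫ U, ∫ Y, G (U * incl Y) ∂(Measure.pi fun _ => μSU) ∂(Measure.pi fun _ => μU) := by
        simp only [h1, integral_const, probReal_univ, one_smul]
    _ = ∫ Y, ∫ U, G (U * incl Y) ∂(Measure.pi fun _ => μU) ∂(Measure.pi fun _ => μSU) :=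
        integral_integral_swap (integrable_of_continuous _
          (hG.comp (continuous_fst.mul (hincl.comp continuous_snd))))
    _ = ∫ U, G U ∂(Measure.pi fun _ => μU) := by
        simp only [integral_mul_right_eq_self G, integral_const, probReal_univ, one_smul]

end Special

/-! ### The single-vertex integral -/

lemma continuous_cycleProd_dress {N n : ℕ} (σ : Equiv.Perm (Fin n × Bool))
    (C : Fin n × Bool → Matrix (Fin N) (Fin N) ℂ) (x : Fin n × Bool) :
    Continuous fun X : Fin n → Matrix (Fin N) (Fin N) ℂ => cycleProd σ (dress C X) x := by
  unfold cycleProd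
  refine continuous_list_prod _ fun t _ => ?_
  simp only [dress]
  split_ifs <;> fun_prop

lemma integral_schur_cycleProd_dress {N n : ℕ} (μ : Measure (UN N)) [μ.IsHaarMeasure]
    [IsProbabilityMeasure μ] {l : Fin N → ℕ} (hl : Antitone l) {σ : Equiv.Perm (Fin n × Bool)}
    (hσ : ∀ x y, σ.SameCycle x y) (x : Fin n × Bool) (C : Fin n × Bool → Matrix (Fin N) (Fin N) ℂ)
    {T : Finset (Fin n × Bool)} (hT : IsTransversal (tauPerm n * σ) T) :
    ∫ X : Fin n → UN N, schur l (cycleProd σ (dress C fun i => (X i).1) x)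
        ∂(Measure.pi fun _ => μ) =
      schur l 1 ^ (-(n : ℤ)) * ∏ r ∈ T, schur l (cycleProd (tauPerm n * σ) C r) := by
  have hx : IsTransversal σ {x} := fun y => ⟨x, ⟨Finset.mem_singleton_self x, hσ x y⟩,
    fun r hr => Finset.mem_singleton.1 hr.1⟩
  have hdress : ∀ X : Fin n → Matrix (Fin N) (Fin N) ℂ, dressOn Finset.univ C X = dress C X :=
    fun X => funext fun h => if_pos (Finset.mem_univ _)
  have h := integral_edges μ hl Finset.univ C σ hx (tauOn_univ n ▸ hT)
  simp only [hdress, Finset.prod_singleton, Finset.card_univ, Fintype.card_fin, tauOn_univ] at h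
  rw [← h, _root_.zpow_neg, zpow_natCast,
    inv_mul_cancel_left₀ (pow_ne_zero n (schur_one_ne_zero μ hl))]

/-- Single-vertex partition function: as formal power series in
`p = (p_1, p_2, …)` (i.e. coefficient by coefficient, the coefficient of the monomial
`∏_m p_m^{d m}` of `exp(N Σ_m (p_m/m) Tr(𝔙(X)^m))` being
`∏_m (N Tr(𝔙(X)^m)/m)^{d m} / (d m)!`), the `SU(N)^n` and `U(N)^n` integrals coincide
and both equal `Σ_{λ : ℓ(λ) ≤ N} s_λ(I_N)^{-n} s_λ(Np) ∏_f s_λ(𝔙*_f)`. -/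
theorem statement4 {N n : ℕ} (hN : 1 ≤ N) (hn : 0 < n)
    (σ : Equiv.Perm (Fin n × Bool))
    (hcyc : σ.IsCycle) (hsupp : σ.support = Finset.univ)
    (C : Fin n × Bool → Matrix (Fin N) (Fin N) ℂ)
    (Rf : Finset (Fin n × Bool))
    (hRf : ∀ x, ∃! r, r ∈ Rf ∧ (tauPerm n * σ).SameCycle r x)
    (μU : Measure (UN N)) [μU.IsHaarMeasure] [IsProbabilityMeasure μU]
    (μSU : Measure (SUN N)) [μSU.IsHaarMeasure] [IsProbabilityMeasure μSU]
    (d : ℕ+ →₀ ℕ) :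
    (∫ X : Fin n → SUN N,
        ∏ m ∈ d.support,
          ((N : ℂ) * ((cycleProd σ
              (dress C fun i => (((X i : UN N) : Matrix (Fin N) (Fin N) ℂ))) (⟨0, hn⟩, true)) ^ (m : ℕ)).trace
            / ((m : ℕ) : ℂ)) ^ (d m) / (Nat.factorial (d m) : ℂ)
        ∂(Measure.pi fun _ : Fin n => μSU)) =
      (∫ X : Fin n → UN N,
        ∏ m ∈ d.support,
          ((N : ℂ) * ((cycleProd σ
              (dress C fun i => ((X i : Matrix (Fin N) (Fin N) ℂ))) (⟨0, hn⟩, true)) ^ (m : ℕ)).trace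
            / ((m : ℕ) : ℂ)) ^ (d m) / (Nat.factorial (d m) : ℂ)
        ∂(Measure.pi fun _ : Fin n => μU)) ∧
    (∫ X : Fin n → UN N,
        ∏ m ∈ d.support,
          ((N : ℂ) * ((cycleProd σ
              (dress C fun i => ((X i : Matrix (Fin N) (Fin N) ℂ))) (⟨0, hn⟩, true)) ^ (m : ℕ)).trace
            / ((m : ℕ) : ℂ)) ^ (d m) / (Nat.factorial (d m) : ℂ)
        ∂(Measure.pi fun _ : Fin n => μU)) =
      ∑' l : PartitionN N,
        (schur l.1 (1 : Matrix (Fin N) (Fin N) ℂ)) ^ (-(n : ℤ)) *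
          MvPolynomial.coeff d (schurNP N l.1) *
          ∏ f ∈ Rf, schur l.1 (cycleProd (tauPerm n * σ) C f) := by
  have hσ : ∀ x y, σ.SameCycle x y := fun x y => hcyc.sameCycle
    (Equiv.Perm.mem_support.1 (hsupp ▸ Finset.mem_univ x))
    (Equiv.Perm.mem_support.1 (hsupp ▸ Finset.mem_univ y))
  have hcont : Continuous fun X : Fin n → Matrix (Fin N) (Fin N) ℂ =>
      cycleProd σ (dress C X) (⟨0, hn⟩, true) := continuous_cycleProd_dress σ C _
  refine ⟨integral_SUN_eq_integral_UN hN μU μSU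
    (F := fun X => expTrace N d (cycleProd σ (dress C X) (⟨0, hn⟩, true)))
    ((continuous_of_mem_matPoly (expTrace_mem_matPoly N d)).comp hcont)
    fun z hz X => congrArg (expTrace N d) (cycleProd_dress_smul hσ C hz X _), ?_⟩
  obtain ⟨s, hs, hsum⟩ := exists_expTrace_eq_sum N d
  rw [tsum_eq_sum (s := s) fun l hl => by rw [hs l hl, mul_zero, zero_mul]]
  calc _ = ∫ X : Fin n → UN N, ∑ l ∈ s, MvPolynomial.coeff d (schurNP N l.1) *
          schur l.1 (cycleProd σ (dress C fun i => (X i).1) (⟨0, hn⟩, true))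
          ∂(Measure.pi fun _ => μU) :=
        integral_congr_ae (.of_forall fun X => hsum _)
    _ = _ := by
        rw [integral_finsetSum]
        · refine Finset.sum_congr rfl fun l _ => ?_
          rw [integral_const_mul, integral_schur_cycleProd_dress μU l.2 hσ _ C hRf]
          ring
        · intro l _
          refine (integrable_of_continuous _ ((continuous_schur l.1).comp
            (hcont.comp ?_))).const_mul _
          fun_prop

end
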